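/- Let g = gl_N(A^pol_{2n}) and h = gl_N ⊕ sp_{2n} ⊂ g, with N sufficiently large relative to n. For every j = 0,…,n the Chern–Weil homomorphism χ: (S^j h)^{*h} → H^{2j}(g,h) into the relative Lie algebra cohomology with trivial coefficients K is an isomorphism. -/

import Mathlib

noncomputable section
open MvPolynomial MeasureTheory

/-- The ground ring `K = ℂ[ε,ε⁻¹]` of Laurent polynomials in `ε`. -/
abbrev Kc : Type := LaurentPolynomial ℂ

/-- The element `ε ∈ K`. -/
def eps : Kc := LaurentPolynomial.T 1

/-- The underlying space of the polynomial Weyl algebra `A^pol_{2n}`: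
polynomials in the variables `y_1, …, y_{2n}` (with `y_{2r-1} = p_r`, `y_{2r} = q_r`,
`0`-indexed below) over `K`. -/
abbrev Apol (n : ℕ) : Type := MvPolynomial (Fin (2*n)) Kc

/-- The `k`-fold tensor power `A^{⊗k}` of `A = A^pol_{2n}` over `K`, realized as the
polynomial ring in `k` groups of `2n` variables. -/
abbrev Tens (n k : ℕ) : Type := MvPolynomial (Fin k × Fin (2*n)) Kc

/-- index of `p_r` among the variables `y` (0-indexed). -/
def pVar (n : ℕ) (r : Fin n) : Fin (2*n) := ⟨2*r.1, by have := r.2; omega⟩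
/-- index of `q_r` among the variables `y` (0-indexed). -/
def qVar (n : ℕ) (r : Fin n) : Fin (2*n) := ⟨2*r.1+1, by have := r.2; omega⟩

/-- Partial derivative in the variable `y_v` of the `i`-th tensor factor, as a `K`-linear
endomorphism of `A^{⊗k}`. -/
def Dop (n k : ℕ) (i : Fin k) (v : Fin (2*n)) : Module.End Kc (Tens n k) :=
  (pderiv (i, v)).toLinearMap

/-- The operator `α_{ij}` on `A^{⊗k}`:
`α_{ij} = (1/2) ∑_r (∂_{p_r}⊗∂_{q_r} − ∂_{q_r}⊗∂_{p_r})` acting on factors `i` and `j`.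
By construction `α_{ji} = −α_{ij}`. -/
def alphaOp (n k : ℕ) (i j : Fin k) : Module.End Kc (Tens n k) :=
  algebraMap ℂ Kc (1/2) • ∑ r : Fin n,
    (Dop n k i (pVar n r) * Dop n k j (qVar n r) - Dop n k i (qVar n r) * Dop n k j (pVar n r))

/-- The operator `π_{2n}` on `A^{⊗(2n+1)}`:
`π_{2n}(a_0⊗⋯⊗a_{2n}) = ∑_{σ∈S_{2n}} sign(σ) a_0⊗∂_{y_{σ(1)}}a_1⊗⋯⊗∂_{y_{σ(2n)}}a_{2n}`. -/
def piOp (n : ℕ) : Module.End Kc (Tens n (2*n+1)) :=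
  ∑ σ : Equiv.Perm (Fin (2*n)),
    (Equiv.Perm.sign σ : ℤ) •
      (List.ofFn (fun m : Fin (2*n) => Dop n (2*n+1) m.succ (σ m))).prod

/-- Pairs `i < j` in `Fin m`. -/
abbrev Pairs (m : ℕ) : Type := {p : Fin m × Fin m // p.1 < p.2}

/-- The simplex `Δ_m = {0 ≤ u_1 ≤ ⋯ ≤ u_m ≤ 1}` in `ℝ^m`. -/
def simplexSet (m : ℕ) : Set (Fin m → ℝ) :=
  {u | (∀ i, 0 ≤ u i ∧ u i ≤ 1) ∧ ∀ i j : Fin m, i ≤ j → u i ≤ u j}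

/-- Extension of `u : ℝ^m` to `ℝ^{m+1}` by the convention `u_0 = 0`. -/
def cons0 (m : ℕ) (u : Fin m → ℝ) : Fin (m+1) → ℝ := Fin.cons 0 u

/-- The (commuting) product `∏_{i<j} α_{ij}^{K(i,j)}`. -/
def alphaPowProd (n k : ℕ) (K : Pairs k → ℕ) : Module.End Kc (Tens n k) :=
  (Finset.univ.toList.map (fun p : Pairs k => alphaOp n k p.1.1 p.1.2 ^ (K p))).prod

/-- The Hochschild cochain `τ_{2n} : A^{⊗(2n+1)} → K`,
`τ_{2n}(a) = μ_{2n} ∫_{Δ_{2n}} ∏_{0≤i<j≤2n} e^{ε(2u_i−2u_j+1)α_{ij}} π_{2n}(a) du`,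
with the exponentials expanded as (locally finite) Taylor series and integrated term by
term; `μ` takes the product of the constant terms of the factors. -/
def tau (n : ℕ) (a : Tens n (2*n+1)) : Kc :=
  ∑ K ∈ Fintype.piFinset (fun _ : Pairs (2*n+1) => Finset.range (a.totalDegree + 1)),
    (algebraMap ℂ Kc
        ((((∫ u in simplexSet (2*n),
            ∏ p : Pairs (2*n+1),
              (2 * cons0 (2*n) u p.1.1 - 2 * cons0 (2*n) u p.1.2 + 1) ^ (K p)) : ℝ) : ℂ)
          * (∏ p : Pairs (2*n+1), ((K p).factorial : ℂ))⁻¹)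
        * eps ^ (∑ p : Pairs (2*n+1), K p)) •
      constantCoeff (alphaPowProd n (2*n+1) K (piOp n a))

/-- The embedding of `A` as the `i`-th tensor factor of `A^{⊗k}`. -/
def embA (n k : ℕ) (i : Fin k) : Apol n →ₐ[Kc] Tens n k :=
  rename (fun v => (i, v))

/-- The elementary tensor `a_0 ⊗ ⋯ ⊗ a_{k-1} ∈ A^{⊗k}`. -/
def elemT {n k : ℕ} (a : Fin k → Apol n) : Tens n k :=
  ∏ i : Fin k, embA n k i (a i)

/-- `exp(ε f)` applied to `a`, for a locally nilpotent operator `f` that strictly decreases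
total degree (so that the series is finite on every argument). -/
def expEps {n k : ℕ} (f : Module.End Kc (Tens n k)) (a : Tens n k) : Tens n k :=
  ∑ m ∈ Finset.range (a.totalDegree + 1),
    (algebraMap ℂ Kc ((m.factorial : ℂ)⁻¹) * eps ^ m) • (f ^ m) a

/-- The Moyal star product `f ⋆ g = m(exp(εα)(f⊗g))` on `A^pol_{2n}`. -/
def moyal (n : ℕ) (f g : Apol n) : Apol n :=
  aeval (fun v : Fin 2 × Fin (2*n) => (X v.2 : Apol n))
    (expEps (alphaOp n 2 0 1) (elemT ![f, g]))

/-- The bracket `[f,g]_ε = (1/ε)(f⋆g − g⋆f)`. -/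
def brkt (n : ℕ) (f g : Apol n) : Apol n :=
  (LaurentPolynomial.T (-1) : Kc) • (moyal n f g - moyal n g f)

/-- `sp_{2n}`, identified with the space of homogeneous quadratic polynomials in the `y`'s
with complex coefficients, as a ℂ-submodule of `A^pol_{2n}`. -/
def spSub (n : ℕ) : Submodule ℂ (Apol n) :=
  Submodule.span ℂ {f : Apol n | ∃ i j : Fin (2*n), f = X i * X j}


/-- `gl_N(A^pol_{2n}) = M_N(ℂ) ⊗ A^pol_{2n}`, realized as `N × N` matrices over the
Weyl algebra. -/
abbrev glA (n N : ℕ) : Type := Matrix (Fin N) (Fin N) (Apol n)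

/-- Matrix multiplication over the Weyl algebra (entrywise Moyal products). -/
def matMul (n N : ℕ) (Z W : glA n N) : glA n N :=
  fun i j => ∑ l : Fin N, moyal n (Z i l) (W l j)

/-- The Lie bracket `(1/ε)(ZW − WZ)` on `gl_N(A^pol_{2n})`. -/
def glBr (n N : ℕ) (Z W : glA n N) : glA n N :=
  (LaurentPolynomial.T (-1) : Kc) • (matMul n N Z W - matMul n N W Z)

/-- Generators of the subalgebra `h = gl_N ⊕ sp_{2n}`: scalar-matrix elements `M ⊗ 1`
and central quadratic elements `1 ⊗ a`, `a ∈ sp_{2n}`. -/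
def hSet (n N : ℕ) : Set (glA n N) :=
  {Z | (∃ M : Matrix (Fin N) (Fin N) ℂ, Z = M.map (algebraMap ℂ (Apol n))) ∨
       (∃ a : Apol n, a ∈ spSub n ∧ Z = Matrix.diagonal (fun _ => a))}

/-- The subalgebra `gl_N ⊕ sp_{2n} ⊂ gl_N(A^pol_{2n})` (its `K`-span). -/
def hK (n N : ℕ) : Submodule Kc (glA n N) := Submodule.span Kc (hSet n N)

/-- The Lie cochain `φ^N(T)` associated with a Hochschild cochain `T`:
`φ^N(T)(M_1⊗a_1,…,M_k⊗a_k)(M_0⊗a_0) = ∑_{σ∈S_k} sign(σ)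
τ(a_0⊗a_{σ(1)}⊗⋯⊗a_{σ(k)}) tr(M_0M_{σ(1)}⋯M_{σ(k)})`, written for general matrices
over `A` by chaining matrix indices through the trace. -/
def phiN (n N k : ℕ) (T : Tens n (k+1) → Kc) (Xs : Fin k → glA n N) (w : glA n N) : Kc :=
  ∑ σ : Equiv.Perm (Fin k), (Equiv.Perm.sign σ : ℤ) •
    ∑ idx : Fin (k+1) → Fin N,
      T (elemT (Fin.cons (w (idx 0) (idx 1))
        (fun m : Fin k => (Xs (σ m)) (idx m.succ) (idx (m.succ + 1)))))

/-- The Lie cochain `Θ^N_{2n} = φ^N(τ_{2n})`. -/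
def Theta (n N : ℕ) (v : Fin (2*n) → glA n N) (w : glA n N) : Kc :=
  phiN n N (2*n) (tau n) v w

/-- The tuple `([v_i,v_j], v_0, …, v̂_i, …, v̂_j, …, v_d)` (`i < j`) used in the
Chevalley–Eilenberg differential. -/
def pairTuple {G : Type*} (d : ℕ) (v : Fin (d+1) → G) (br : G) (i j : Fin (d+1)) :
    Fin d → G :=
  fun m =>
    if hm : m.1 = 0 then br
    else if h1 : m.1 - 1 < i.1 then v ⟨m.1 - 1, by have := i.2; omega⟩
    else if h2 : m.1 < j.1 then v ⟨m.1, by have := j.2; omega⟩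
    else v ⟨m.1 + 1, by have := m.2; omega⟩

/-- Lie algebra cochain of degree `k` with trivial coefficients `K`: `K`-multilinear and
alternating. -/
def IsTrivCochain (n N k : ℕ) (c : (Fin k → glA n N) → Kc) : Prop :=
  (∀ (v : Fin k → glA n N) (i : Fin k) (x y : glA n N),
      c (Function.update v i (x + y))
        = c (Function.update v i x) + c (Function.update v i y)) ∧
  (∀ (v : Fin k → glA n N) (i : Fin k) (s : Kc) (x : glA n N),
      c (Function.update v i (s • x)) = s * c (Function.update v i x)) ∧
  (∀ (v : Fin k → glA n N) (i j : Fin k), i ≠ j → v i = v j → c v = 0)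

/-- Relative conditions (for the pair `(gl_N(A), gl_N ⊕ sp_{2n})`, trivial coefficients):
vanishing if an argument lies in `h`, and `h`-invariance. -/
def IsRelTriv (n N k : ℕ) (c : (Fin k → glA n N) → Kc) : Prop :=
  (∀ (v : Fin k → glA n N) (i : Fin k), v i ∈ hK n N → c v = 0) ∧
  (∀ Z ∈ hK n N, ∀ v : Fin k → glA n N,
      ∑ i : Fin k, c (Function.update v i (glBr n N Z (v i))) = 0)

/-- The Chevalley–Eilenberg differential with trivial coefficients. -/
def dTriv (n N k : ℕ) (c : (Fin k → glA n N) → Kc) : (Fin (k+1) → glA n N) → Kc :=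
  fun v =>
    ∑ i : Fin (k+1), ∑ l : Fin (k+1),
      (if i < l then (-1:Kc)^(i.1+l.1) • c (pairTuple k v (glBr n N (v i) (v l)) i l)
       else 0)

/-- `c` is the coboundary of a relative cochain (trivial coefficients). -/
def IsRelTrivCobd (n N : ℕ) : (k : ℕ) → ((Fin k → glA n N) → Kc) → Prop
  | 0, c => c = 0
  | (m+1), c => ∃ b, IsTrivCochain n N m b ∧ IsRelTriv n N m b ∧ c = dTriv n N m b

/-- An (extension to `g` of an) invariant polynomial `P ∈ (S^j h)^{*h}`:
a `K`-multilinear symmetric form, `ad h`-invariant on `h`-tuples. -/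
def IsInvPoly (n N j : ℕ) (P : (Fin j → glA n N) → Kc) : Prop :=
  (∀ (w : Fin j → glA n N) (r : Fin j) (x y : glA n N),
      P (Function.update w r (x + y))
        = P (Function.update w r x) + P (Function.update w r y)) ∧
  (∀ (w : Fin j → glA n N) (r : Fin j) (s : Kc) (x : glA n N),
      P (Function.update w r (s • x)) = s * P (Function.update w r x)) ∧
  (∀ (w : Fin j → glA n N) (ρ : Equiv.Perm (Fin j)), P (w ∘ ρ) = P w) ∧
  (∀ Z ∈ hK n N, ∀ w : Fin j → glA n N, (∀ r, w r ∈ hK n N) →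
      ∑ r : Fin j, P (Function.update w r (glBr n N Z (w r))) = 0)

/-- `pr` is an `ad h`-equivariant projection of `g = gl_N(A)` onto `h = gl_N ⊕ sp_{2n}`. -/
def IsEquivProj (n N : ℕ) (pr : glA n N →ₗ[Kc] glA n N) : Prop :=
  (∀ Z, pr Z ∈ hK n N) ∧ (∀ Z ∈ hK n N, pr Z = Z) ∧
  (∀ Z ∈ hK n N, ∀ W, pr (glBr n N Z W) = glBr n N Z (pr W))

/-- The curvature `C(v,w) = [pr v, pr w] − pr [v,w]` of an equivariant projection. -/
def curvOf (n N : ℕ) (pr : glA n N →ₗ[Kc] glA n N) (v w : glA n N) : glA n N :=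
  glBr n N (pr v) (pr w) - pr (glBr n N v w)

/-- The Chern–Weil cocycle `χ(P)(v_1∧⋯∧v_{2j}) = (1/j!)∑'_σ sign σ
P(C(v_{σ(1)},v_{σ(2)}),…,C(v_{σ(2j−1)},v_{σ(2j)}))`, the sum over `σ ∈ S_{2j}` with
`σ(2i−1) < σ(2i)`. -/
def chern (n N j : ℕ) (pr : glA n N →ₗ[Kc] glA n N) (P : (Fin j → glA n N) → Kc)
    (v : Fin (2*j) → glA n N) : Kc :=
  algebraMap ℂ Kc ((j.factorial : ℂ))⁻¹ *
    ∑ σ : Equiv.Perm (Fin (2*j)),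
      if (∀ t : Fin j, σ ⟨2*t.1, by have := t.2; omega⟩ < σ ⟨2*t.1+1, by have := t.2; omega⟩)
      then (Equiv.Perm.sign σ : ℤ) •
        P (fun t : Fin j => curvOf n N pr
            (v (σ ⟨2*t.1, by have := t.2; omega⟩))
            (v (σ ⟨2*t.1+1, by have := t.2; omega⟩)))
      else 0

set_option linter.unusedSimpArgs false
set_option linter.unusedVariables false
set_option linter.unnecessarySimpa false
set_option linter.style.longLine false
set_option linter.unusedSectionVars false

namespace CW
open ExteriorAlgebra

variable {K : Type*} [CommRing K] {M : Type*} [AddCommGroup M] [Module K M]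


lemma foldE (s : K) (A : M →ₗ[K] CliffordAlgebra (0 : QuadraticForm K M) →ₗ[K]
      CliffordAlgebra (0 : QuadraticForm K M))
    (h : ∀ x w, A x (CliffordAlgebra.ι 0 x * w) + s • (CliffordAlgebra.ι 0 x * A x w) = 0) :
    ∃ F : CliffordAlgebra (0 : QuadraticForm K M) →ₗ[K] CliffordAlgebra (0 : QuadraticForm K M),
      F 1 = 0 ∧ ∀ x w, F (CliffordAlgebra.ι 0 x * w) = s • (CliffordAlgebra.ι 0 x * F w) + A x w := by
  refine ⟨CliffordAlgebra.foldr' (0 : QuadraticForm K M)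
    (LinearMap.mk₂ K (fun m (p : CliffordAlgebra (0 : QuadraticForm K M) × CliffordAlgebra (0 : QuadraticForm K M)) =>
        s • (CliffordAlgebra.ι 0 m * p.2) + A m p.1)
      (by intros; simp [add_mul]; abel) (by intros; simp [smul_comm s])
      (by intros; simp [mul_add]; abel) (by intros; simp [smul_comm s]))
    ?_ 0, ?_, ?_⟩
  · intro m x fx
    simp only [LinearMap.mk₂_apply]
    have h1 := h m x
    have h2 := CliffordAlgebra.ι_sq_scalar (0 : QuadraticForm K M) m
    rw [mul_add, mul_smul_comm, ← mul_assoc, h2]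
    simp only [_root_.zero_apply, map_zero, zero_mul, smul_zero, zero_add, zero_smul]
    rw [add_comm]; exact h1
  · have h2 : (1 : CliffordAlgebra (0 : QuadraticForm K M)) = algebraMap K _ 1 := by
      rw [map_one]
    rw [h2, CliffordAlgebra.foldr'_algebraMap, smul_zero]
  · intro x w
    rw [CliffordAlgebra.foldr'_ι_mul, LinearMap.mk₂_apply]

/-- the exterior algebra, as a pointed module -/
def Lam (K M : Type*) [CommRing K] [AddCommGroup M] [Module K M] : Type _ :=
  CliffordAlgebra (0 : QuadraticForm K M)

instance : AddCommGroup (Lam K M) :=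
  inferInstanceAs (AddCommGroup (CliffordAlgebra (0 : QuadraticForm K M)))
instance : Module K (Lam K M) :=
  inferInstanceAs (Module K (CliffordAlgebra (0 : QuadraticForm K M)))
instance : One (Lam K M) := ⟨(1 : CliffordAlgebra (0 : QuadraticForm K M))⟩

/-- operators on the exterior algebra -/
abbrev Op (K M : Type*) [CommRing K] [AddCommGroup M] [Module K M] : Type _ :=
  Module.End K (Lam K M)

/-- left multiplication by a vector, bundled -/
def eL : M →ₗ[K] Op K M :=
  (LinearMap.mul K (CliffordAlgebra (0 : QuadraticForm K M))) ∘ₗ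
    (CliffordAlgebra.ι (0 : QuadraticForm K M))

/-- left multiplication by a vector -/
def e (x : M) : Op K M := eL x

lemma e_def (x : M) (w : CliffordAlgebra (0 : QuadraticForm K M)) :
    (e x : Op K M) w = (CliffordAlgebra.ι (0 : QuadraticForm K M) x * w :
      CliffordAlgebra (0 : QuadraticForm K M)) := rfl

lemma e_add (x y : M) : (e (x + y) : Op K M) = e x + e y := eL.map_add x y
lemma e_sub (x y : M) : (e (x - y) : Op K M) = e x - e y := eL.map_sub x y
lemma e_neg (x : M) : (e (-x) : Op K M) = -e x := eL.map_neg x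
lemma e_zero : (e (0 : M) : Op K M) = 0 := eL.map_zero
lemma e_smul (c : K) (x : M) : (e (c • x) : Op K M) = c • e x := eL.map_smul c x
lemma e_sum {α : Type*} (s : Finset α) (f : α → M) :
    (e (∑ a ∈ s, f a) : Op K M) = ∑ a ∈ s, e (f a) := map_sum eL f s

lemma e_sq (x : M) : (e x * e x : Op K M) = 0 := by
  refine LinearMap.ext fun (w : CliffordAlgebra (0 : QuadraticForm K M)) => ?_
  change CliffordAlgebra.ι (0 : QuadraticForm K M) x * (CliffordAlgebra.ι (0 : QuadraticForm K M) x * w) = (0 : CliffordAlgebra (0 : QuadraticForm K M))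
  rw [← mul_assoc, CliffordAlgebra.ι_sq_scalar]; simp

lemma e_anti (x y : M) : (e x * e y + e y * e x : Op K M) = 0 := by
  have h := e_sq (K := K) (x + y)
  rw [e_add] at h
  have h1 := e_sq (K := K) x
  have h2 := e_sq (K := K) y
  linear_combination (norm := noncomm_ring) h - h1 - h2

lemma op_ind {p : Lam K M → Prop} (h1 : p 1) (hs : ∀ (c : K) x, p x → p (c • x))
    (ha : ∀ x y, p x → p y → p (x + y)) (he : ∀ m x, p x → p (e m x)) (x) : p x := by
  refine CliffordAlgebra.left_induction (Q := (0 : QuadraticForm K M)) (P := p) ?_ ha ?_ x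
  · intro r
    have := hs r _ h1
    rwa [show (r • (1 : Lam K M)) = algebraMap K (CliffordAlgebra (0 : QuadraticForm K M)) r from
      (Algebra.algebraMap_eq_smul_one (A := CliffordAlgebra (0 : QuadraticForm K M)) r).symm] at this
  · intro x m h
    exact he m x h

lemma op_eqOn {N : Type*} [AddCommGroup N] [Module K N] {Z W : Lam K M →ₗ[K] N}
    (h1 : Z 1 = W 1)
    (he : ∀ x w, Z w = W w → Z (e x w) = W (e x w)) : Z = W := by
  refine LinearMap.ext fun w => ?_
  induction w using op_ind with
  | h1 => exact h1
  | hs c x h => simp [h]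
  | ha x y hx hy => simp [hx, hy]
  | he m x h => exact he m x h

lemma op_comm0 {Z : Op K M} (h1 : Z 1 = 0) (he : ∀ x, Z * e x = e x * Z) : Z = 0 := by
  apply op_eqOn
  · simpa using h1
  · intro x w h
    have := LinearMap.congr_fun (he x) w
    simp only [Module.End.mul_apply] at this
    rw [this, h]; simp

lemma op_anti0 {Z : Op K M} (h1 : Z 1 = 0) (he : ∀ x, Z * e x + e x * Z = 0) : Z = 0 := by
  apply op_eqOn
  · simpa using h1
  · intro x w h
    have := LinearMap.congr_fun (he x) w
    simp only [Module.End.mul_apply, LinearMap.add_apply] at this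
    rw [h] at this; simpa using this

/-- contraction -/
def ct (f : Module.Dual K M) : Op K M :=
  CliffordAlgebra.contractLeft (Q := (0 : QuadraticForm K M)) f

lemma ct_one (f : Module.Dual K M) : ct f 1 = 0 :=
  CliffordAlgebra.contractLeft_one (0 : QuadraticForm K M) f

lemma ct_e (f : Module.Dual K M) (x : M) : ct f * e x + e x * ct f = f x • (1 : Op K M) := by
  refine LinearMap.ext fun w => ?_
  have := CliffordAlgebra.contractLeft_ι_mul (Q := (0 : QuadraticForm K M)) (d := f) x w
  exact eq_sub_iff_add_eq.mp this

lemma ct_add (f g : Module.Dual K M) : ct (f + g) = ct f + ct g := by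
  unfold ct; exact map_add _ _ _
lemma ct_sub (f g : Module.Dual K M) : ct (f - g) = ct f - ct g := by
  unfold ct; exact map_sub _ _ _
lemma ct_neg (f : Module.Dual K M) : ct (-f) = -ct f := by
  unfold ct; exact map_neg _ _
lemma ct_smul (c : K) (f : Module.Dual K M) : ct (c • f) = c • ct f := by
  unfold ct; exact map_smul _ _ _
lemma ct_zero : ct (0 : Module.Dual K M) = 0 := by
  unfold ct; exact map_zero _
lemma ct_sum {α : Type*} (s : Finset α) (f : α → Module.Dual K M) :
    ct (∑ a ∈ s, f a) = ∑ a ∈ s, ct (f a) := by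
  unfold ct; exact map_sum _ _ _

lemma ct_anti (f g : Module.Dual K M) : ct f * ct g + ct g * ct f = 0 := by
  refine LinearMap.ext fun w => ?_
  have := CliffordAlgebra.contractLeft_comm (Q := (0 : QuadraticForm K M)) (d := f) (d' := g) w
  exact eq_neg_iff_add_eq_zero.mp this

lemma ct_sq (f : Module.Dual K M) : ct f * ct f = 0 := by
  refine LinearMap.ext fun w => ?_
  exact CliffordAlgebra.contractLeft_contractLeft (Q := (0 : QuadraticForm K M)) (d := f) w


lemma fold_ex (s : K) (A : M →ₗ[K] Op K M) (h : ∀ x, A x * e x + s • (e x * A x) = 0) :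
    ∃ F : Op K M, F 1 = 0 ∧ ∀ x, F * e x = s • (e x * F) + A x := by
  obtain ⟨F, h1, h2⟩ := foldE (K := K) (M := M) s A (fun x w => LinearMap.congr_fun (h x) w)
  exact ⟨F, h1, fun x => LinearMap.ext fun w => h2 x w⟩

/-- operator `F` with `F 1 = 0` and `F e_x = s e_x F + A_x` -/
def fold (s : K) (A : M →ₗ[K] Op K M) (h : ∀ x, A x * e x + s • (e x * A x) = 0) : Op K M :=
  (fold_ex s A h).choose

lemma fold_one (s : K) (A : M →ₗ[K] Op K M) (h) : fold s A h 1 = 0 :=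
  (fold_ex s A h).choose_spec.1

lemma fold_e (s : K) (A : M →ₗ[K] Op K M) (h) (x : M) :
    fold s A h * e x = s • (e x * fold s A h) + A x :=
  (fold_ex s A h).choose_spec.2 x

/-- derivation extension -/
def der (f : Module.End K M) : Op K M :=
  fold 1 (eL ∘ₗ f) (by intro x; rw [one_smul]; exact e_anti (f x) x)

lemma der_one (f : Module.End K M) : der f 1 = 0 := fold_one _ _ _

lemma der_e (f : Module.End K M) (x : M) : der f * e x = e x * der f + e (f x) := by
  unfold der; rw [fold_e, one_smul]; rfl

lemma der_uniq {f : Module.End K M} {Z : Op K M} (h1 : Z 1 = 0)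
    (h : ∀ x, Z * e x = e x * Z + e (f x)) : Z = der f := by
  rw [← sub_eq_zero]
  apply op_comm0
  · simp [h1, der_one]
  · intro x
    linear_combination (norm := noncomm_ring) h x - der_e f x

lemma der_add (f g : Module.End K M) : der (f + g) = der f + der g := by
  symm; apply der_uniq
  · simp [der_one]
  · intro x
    rw [LinearMap.add_apply, e_add]
    linear_combination (norm := noncomm_ring) der_e f x + der_e g x

lemma der_smul (c : K) (f : Module.End K M) : der (c • f) = c • der f := by
  symm; apply der_uniq
  · simp [der_one]
  · intro x
    rw [LinearMap.smul_apply, e_smul, smul_mul_assoc, der_e, mul_smul_comm, smul_add]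

/-- `der` as a linear map -/
def derL : Module.End K M →ₗ[K] Op K M :=
  { toFun := der, map_add' := der_add, map_smul' := der_smul }

lemma der_neg (f : Module.End K M) : der (-f) = -der f := derL.map_neg f
lemma der_sub (f g : Module.End K M) : der (f - g) = der f - der g := derL.map_sub f g
lemma der_zero : der (0 : Module.End K M) = 0 := derL.map_zero
lemma der_sum {α : Type*} (s : Finset α) (f : α → Module.End K M) :
    der (∑ a ∈ s, f a) = ∑ a ∈ s, der (f a) := map_sum derL f s

lemma der_comm (f g : Module.End K M) : der f * der g - der g * der f = der (f * g - g * f) := by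
  apply der_uniq
  · simp [der_one]
  · intro x
    have h1 := der_e f x
    have h2 := der_e g x
    have h3 := der_e f (g x)
    have h4 := der_e g (f x)
    rw [LinearMap.sub_apply, e_sub, Module.End.mul_apply, Module.End.mul_apply]
    linear_combination (norm := noncomm_ring) der f * h2 - der g * h1 + h1 * der g - h2 * der f + h3 - h4

lemma der_ct (f : Module.End K M) (φ : Module.Dual K M) :
    der f * ct φ = ct φ * der f - ct (φ ∘ₗ f) := by
  rw [← sub_eq_zero]
  apply op_anti0
  · simp [der_one, ct_one]
  · intro x
    have h1 := der_e f x
    have h2 := ct_e φ x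
    have h3 := ct_e φ (f x)
    have h4 := ct_e (φ ∘ₗ f) x
    rw [LinearMap.comp_apply] at h4
    have h5 : der f * (φ x • (1 : Op K M)) = (φ x • (1 : Op K M)) * der f := by simp
    linear_combination (norm := noncomm_ring) der f * h2 - h2 * der f - h1 * ct φ - ct φ * h1 + h4 - h3 + h5

lemma der_rank1 (φ : Module.Dual K M) (x : M) : e x * ct φ = der (φ.smulRight x) := by
  apply der_uniq
  · simp [ct_one]
  · intro y
    rw [LinearMap.smulRight_apply, e_smul]
    have h1 := ct_e φ y
    have h2 := e_anti (K := K) x y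
    have h3 : e x * (φ y • (1 : Op K M)) = φ y • e x := by simp
    linear_combination (norm := noncomm_ring) e x * h1 - h2 * ct φ + h3

/-- contraction by a two-form -/
def om (β : M →ₗ[K] Module.Dual K M) (hβ : ∀ x, β x x = 0) : Op K M :=
  fold 1 ({ toFun := ct, map_add' := ct_add, map_smul' := ct_smul } ∘ₗ β)
    (by intro x; have := ct_e (β x) x; rw [hβ, zero_smul] at this; simpa using this)

lemma om_one (β : M →ₗ[K] Module.Dual K M) (hβ) : om β hβ 1 = 0 := fold_one _ _ _

lemma om_e (β : M →ₗ[K] Module.Dual K M) (hβ) (x : M) :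
    om β hβ * e x = e x * om β hβ + ct (β x) := by
  unfold om; rw [fold_e, one_smul]; rfl

lemma om_uniq {β : M →ₗ[K] Module.Dual K M} (hβ) {Z : Op K M} (h1 : Z 1 = 0)
    (h : ∀ x, Z * e x = e x * Z + ct (β x)) : Z = om β hβ := by
  rw [← sub_eq_zero]
  apply op_comm0
  · simp [h1, om_one]
  · intro x
    linear_combination (norm := noncomm_ring) h x - om_e β hβ x

/-- boundary-type operator attached to an alternating bilinear map -/
def bd (β : M →ₗ[K] Module.End K M) (hβ : ∀ x, β x x = 0) : Op K M :=
  fold (-1) (derL ∘ₗ β)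
    (by intro x; have := der_e (β x) x; rw [hβ, e_zero, add_zero] at this
        rw [LinearMap.comp_apply, neg_one_smul]
        exact (congrArg (· + _) this).trans (add_neg_cancel _))

lemma bd_one (β : M →ₗ[K] Module.End K M) (hβ) : bd β hβ 1 = 0 := fold_one _ _ _

lemma bd_e (β : M →ₗ[K] Module.End K M) (hβ) (x : M) :
    bd β hβ * e x = - (e x * bd β hβ) + der (β x) := by
  unfold bd; rw [fold_e, neg_one_smul]; rfl

lemma bd_uniq {β : M →ₗ[K] Module.End K M} (hβ) {Z : Op K M} (h1 : Z 1 = 0)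
    (h : ∀ x, Z * e x = -(e x * Z) + der (β x)) : Z = bd β hβ := by
  rw [← sub_eq_zero]
  apply op_anti0
  · simp [h1, bd_one]
  · intro x
    linear_combination (norm := noncomm_ring) h x - bd_e β hβ x

lemma om_ct (β : M →ₗ[K] Module.Dual K M) (hβ) (φ : Module.Dual K M) :
    om β hβ * ct φ = ct φ * om β hβ := by
  rw [← sub_eq_zero]
  apply op_anti0
  · simp [om_one, ct_one]
  · intro x
    have h1 := om_e β hβ x
    have h2 := ct_e φ x
    have h3 := ct_anti φ (β x)
    have h5 : om β hβ * (φ x • (1 : Op K M)) = (φ x • (1 : Op K M)) * om β hβ := by simp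
    linear_combination (norm := noncomm_ring) om β hβ * h2 - h2 * om β hβ - h1 * ct φ - ct φ * h1 - h3 + h5

lemma om_om (β γ : M →ₗ[K] Module.Dual K M) (hβ hγ) :
    om β hβ * om γ hγ = om γ hγ * om β hβ := by
  rw [← sub_eq_zero]
  apply op_comm0
  · simp [om_one]
  · intro x
    have h1 := om_e β hβ x
    have h2 := om_e γ hγ x
    have h3 := om_ct β hβ (γ x)
    have h4 := om_ct γ hγ (β x)
    linear_combination (norm := noncomm_ring) om β hβ * h2 + h1 * om γ hγ - om γ hγ * h1 - h2 * om β hβ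
      + h3 - h4

/-- infinitesimal action on a bilinear form, value in duals -/
def actD (f : Module.End K M) (β : M →ₗ[K] Module.Dual K M) : M →ₗ[K] Module.Dual K M :=
  - (β ∘ₗ f) - (LinearMap.lcomp K K f) ∘ₗ β

lemma actD_apply (f : Module.End K M) (β : M →ₗ[K] Module.Dual K M) (x y : M) :
    actD f β x y = - β (f x) y - β x (f y) := rfl

lemma alt_swap {N : Type*} [AddCommGroup N] [Module K N] {β : M →ₗ[K] M →ₗ[K] N}
    (hβ : ∀ x, β x x = 0) (x y : M) : β x y = - β y x := by
  have := hβ (x + y)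
  simp only [map_add, LinearMap.add_apply, hβ, zero_add, add_zero] at this
  rw [eq_neg_iff_add_eq_zero, add_comm]; exact this

lemma actD_alt (f : Module.End K M) {β : M →ₗ[K] Module.Dual K M} (hβ : ∀ x, β x x = 0) (x : M) :
    actD f β x x = 0 := by
  rw [actD_apply, alt_swap hβ (f x) x]; simp

lemma der_om (f : Module.End K M) (β : M →ₗ[K] Module.Dual K M) (hβ) :
    der f * om β hβ - om β hβ * der f = om (actD f β) (actD_alt f hβ) := by
  apply om_uniq
  · simp [der_one, om_one]
  · intro x
    have h1 := der_e f x
    have h2 := om_e β hβ x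
    have h3 := om_e β hβ (f x)
    have h4 := der_ct f (β x)
    have h5 : ct (actD f β x) = - ct (β (f x)) - ct (β x ∘ₗ f) := by
      rw [← ct_neg, ← ct_sub]; rfl
    rw [h5]
    linear_combination (norm := noncomm_ring) der f * h2 + h1 * om β hβ - om β hβ * h1 - h2 * der f
      + h4 - h3

/-- infinitesimal action on a bilinear map -/
def actE (f : Module.End K M) (β : M →ₗ[K] Module.End K M) : M →ₗ[K] Module.End K M :=
  (LinearMap.llcomp K M M M f) ∘ₗ β - (β ∘ₗ f) - (LinearMap.lcomp K M f) ∘ₗ β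

lemma actE_apply (f : Module.End K M) (β : M →ₗ[K] Module.End K M) (x y : M) :
    actE f β x y = f (β x y) - β (f x) y - β x (f y) := rfl

lemma actE_alt (f : Module.End K M) {β : M →ₗ[K] Module.End K M} (hβ : ∀ x, β x x = 0) (x : M) :
    actE f β x x = 0 := by
  rw [actE_apply, alt_swap hβ (f x) x, hβ]; simp

lemma der_bd (f : Module.End K M) (β : M →ₗ[K] Module.End K M) (hβ) :
    der f * bd β hβ - bd β hβ * der f = bd (actE f β) (actE_alt f hβ) := by
  apply bd_uniq
  · simp [der_one, bd_one]
  · intro x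
    have h1 := der_e f x
    have h2 := bd_e β hβ x
    have h3 := bd_e β hβ (f x)
    have h4 := der_comm f (β x)
    have h5 : der (actE f β x) = der (f * β x - β x * f) - der (β (f x)) := by
      rw [← der_sub]; congr 1
      ext y; simp [actE_apply]; abel
    rw [h5, ← h4]
    linear_combination (norm := noncomm_ring) der f * h2 - h1 * bd β hβ - bd β hβ * h1 - h2 * der f - h3

lemma bd_congr {β γ : M →ₗ[K] Module.End K M} (hβ hγ) (h : ∀ x y, β x y = γ x y) :
    bd β hβ = bd γ hγ := by
  have : β = γ := by ext x y; exact h x y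
  subst this; rfl

lemma om_congr {β γ : M →ₗ[K] Module.Dual K M} (hβ hγ) (h : ∀ x y, β x y = γ x y) :
    om β hβ = om γ hγ := by
  have : β = γ := by ext x y; exact h x y
  subst this; rfl

lemma bd_zero (h) : bd (0 : M →ₗ[K] Module.End K M) h = 0 := by
  symm; apply bd_uniq
  · simp
  · intro x; simp [der_zero]

lemma om_zero (h) : om (0 : M →ₗ[K] Module.Dual K M) h = 0 := by
  symm; apply om_uniq
  · simp
  · intro x; simp [ct_zero]

lemma bd_add {β γ : M →ₗ[K] Module.End K M} (hβ hγ h) :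
    bd (β + γ) h = bd β hβ + bd γ hγ := by
  symm; apply bd_uniq
  · simp [bd_one]
  · intro x
    rw [LinearMap.add_apply, der_add]
    linear_combination (norm := noncomm_ring) bd_e β hβ x + bd_e γ hγ x

lemma bd_smul (c : K) {β : M →ₗ[K] Module.End K M} (hβ h) :
    bd (c • β) h = c • bd β hβ := by
  symm; apply bd_uniq
  · simp [bd_one]
  · intro x
    rw [LinearMap.smul_apply, der_smul, smul_mul_assoc, bd_e, mul_smul_comm, smul_add, smul_neg]

lemma bd_ct (β : M →ₗ[K] Module.End K M) (hβ) (φ : Module.Dual K M) (h) :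
    bd β hβ * ct φ + ct φ * bd β hβ = om ((LinearMap.llcomp K M M K φ) ∘ₗ β) h := by
  apply om_uniq
  · simp [bd_one, ct_one]
  · intro x
    have h1 := bd_e β hβ x
    have h2 := ct_e φ x
    have h3 := der_ct (β x) φ
    have h5 : bd β hβ * (φ x • (1 : Op K M)) = (φ x • (1 : Op K M)) * bd β hβ := by simp
    have h6 : ct (((LinearMap.llcomp K M M K φ) ∘ₗ β) x) = ct (φ ∘ₗ β x) := rfl
    rw [h6]
    linear_combination (norm := noncomm_ring) bd β hβ * h2 - h2 * bd β hβ + h5 - h1 * ct φ + ct φ * h1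
      - h3

/-- Jacobi identity (derivation form) -/
def Jac (β : M →ₗ[K] Module.End K M) : Prop :=
  ∀ x y z, β x (β y z) = β (β x y) z + β y (β x z)

lemma L_comm {β : M →ₗ[K] Module.End K M} (hJ : Jac β) (x y : M) :
    der (β x) * der (β y) - der (β y) * der (β x) = der (β (β x y)) := by
  rw [der_comm]; congr 1; ext z
  simp [hJ x y z]

lemma L_bd {β : M →ₗ[K] Module.End K M} (hβ) (hJ : Jac β) (x : M) :
    der (β x) * bd β hβ = bd β hβ * der (β x) := by
  rw [← sub_eq_zero, der_bd, bd_congr _ (γ := 0) (by simp), bd_zero]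
  intro y z
  rw [actE_apply, hJ x y z]; simp

lemma bd_sq {β : M →ₗ[K] Module.End K M} (hβ) (hJ : Jac β) : bd β hβ * bd β hβ = 0 := by
  apply op_comm0
  · simp [bd_one]
  · intro x
    have h1 := bd_e β hβ x
    have h2 := L_bd hβ hJ x
    linear_combination (norm := noncomm_ring) bd β hβ * h1 - h1 * bd β hβ - h2

end CW

namespace CW
open ExteriorAlgebra

variable {K : Type*} [CommRing K] {M : Type*} [AddCommGroup M] [Module K M]

lemma pj_ex : ∃ P : ℕ → Op K M, P 0 1 = 1 ∧ (∀ p, P (p + 1) 1 = 0) ∧ (∀ x, P 0 * e x = 0) ∧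
    ∀ p x, P (p + 1) * e x = e x * P p := by
  refine ⟨fun p => (GradedAlgebra.proj (fun i : ℕ ↦ ⋀[K]^i M) p :
    ExteriorAlgebra K M →ₗ[K] ExteriorAlgebra K M), ?_⟩
  have hone : (1 : ExteriorAlgebra K M) ∈ ⋀[K]^0 M := by
    rw [exteriorPower, pow_zero]; exact Submodule.one_le.1 le_rfl
  refine ⟨?_, ?_, ?_, ?_⟩
  · exact DirectSum.decompose_of_mem_same (fun i : ℕ ↦ ⋀[K]^i M) hone
  · intro p
    exact DirectSum.decompose_of_mem_ne (fun i : ℕ ↦ ⋀[K]^i M) hone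
      (Nat.succ_ne_zero p).symm
  · intro x
    refine LinearMap.ext fun (w : ExteriorAlgebra K M) => ?_
    have hx : ExteriorAlgebra.ι K x ∈ ⋀[K]^1 M := by
      rw [exteriorPower, pow_one]; exact LinearMap.mem_range_self _ x
    exact DirectSum.coe_decompose_mul_of_left_mem_of_not_le (fun i : ℕ ↦ ⋀[K]^i M) (b := w)
      (i := 1) (n := 0) hx (by omega)
  · intro p x
    refine LinearMap.ext fun (w : ExteriorAlgebra K M) => ?_
    have hx : ExteriorAlgebra.ι K x ∈ ⋀[K]^1 M := by
      rw [exteriorPower, pow_one]; exact LinearMap.mem_range_self _ x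
    have := DirectSum.coe_decompose_mul_add_of_left_mem (fun i : ℕ ↦ ⋀[K]^i M) (b := w)
      (i := 1) (j := p) hx
    rw [add_comm] at this
    exact this

/-- projection to degree `p` -/
def pj (p : ℕ) : Op K M := (pj_ex (K := K) (M := M)).choose p

lemma pj_zero_one : (pj 0 : Op K M) 1 = 1 := (pj_ex (K := K) (M := M)).choose_spec.1
lemma pj_succ_one (p : ℕ) : (pj (p + 1) : Op K M) 1 = 0 :=
  (pj_ex (K := K) (M := M)).choose_spec.2.1 p
lemma pj_zero_e (x : M) : (pj 0 : Op K M) * e x = 0 :=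
  (pj_ex (K := K) (M := M)).choose_spec.2.2.1 x
lemma pj_succ_e (p : ℕ) (x : M) : (pj (p + 1) : Op K M) * e x = e x * pj p :=
  (pj_ex (K := K) (M := M)).choose_spec.2.2.2 p x

lemma pj_zero_e' (x : M) (w : Lam K M) : pj 0 (e x w) = 0 :=
  LinearMap.congr_fun (pj_zero_e (K := K) x) w
lemma pj_succ_e' (p : ℕ) (x : M) (w : Lam K M) : pj (p + 1) (e x w) = e x (pj p w) :=
  LinearMap.congr_fun (pj_succ_e (K := K) p x) w

/-- wedge monomials -/
def mw (p : ℕ) : M [⋀^Fin p]→ₗ[K] Lam K M :=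
  (ExteriorAlgebra.ιMulti K p : M [⋀^Fin p]→ₗ[K] ExteriorAlgebra K M)

lemma mw_zero (v : Fin 0 → M) : (mw 0 v : Lam K M) = 1 :=
  ExteriorAlgebra.ιMulti_zero_apply v

lemma mw_succ {p : ℕ} (v : Fin (p + 1) → M) :
    (mw (p + 1) v : Lam K M) = e (v 0) (mw p (Fin.tail v)) :=
  ExteriorAlgebra.ιMulti_succ_apply v

lemma mw_cons {p : ℕ} (x : M) (v : Fin p → M) :
    (mw (p + 1) (Fin.cons x v : Fin (p + 1) → M) : Lam K M) = e x (mw p v) := by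
  rw [mw_succ]; simp

variable (K M) in
/-- degree `p` part -/
def Dg (p : ℕ) : Submodule K (Lam K M) := Submodule.span K (Set.range (mw p))

lemma mw_mem {p : ℕ} (v : Fin p → M) : mw p v ∈ Dg K M p := Submodule.subset_span ⟨v, rfl⟩

lemma Dg_ind {p : ℕ} {N : Type*} [AddCommGroup N] [Module K N] {Z W : Lam K M →ₗ[K] N}
    (h : ∀ v : Fin p → M, Z (mw p v) = W (mw p v)) {w : Lam K M} (hw : w ∈ Dg K M p) :
    Z w = W w := by
  have : Dg K M p ≤ LinearMap.eqLocus Z W := by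
    rw [Dg, Submodule.span_le]
    rintro _ ⟨v, rfl⟩
    exact h v
  exact this hw

lemma one_mem : (1 : Lam K M) ∈ Dg K M 0 := by
  have := mw_mem (K := K) (M := M) (p := 0) (fun i => i.elim0)
  rwa [mw_zero] at this

lemma Dg_le {p : ℕ} {S : Submodule K (Lam K M)} (h : ∀ v : Fin p → M, mw p v ∈ S) :
    Dg K M p ≤ S := by
  rw [Dg, Submodule.span_le]
  rintro _ ⟨v, rfl⟩
  exact h v

lemma e_mem {p : ℕ} (x : M) {w : Lam K M} (hw : w ∈ Dg K M p) : e x w ∈ Dg K M (p + 1) := by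
  have : Dg K M p ≤ (Dg K M (p + 1)).comap (e x) := by
    apply Dg_le
    intro v
    rw [Submodule.mem_comap]
    rw [← mw_cons]
    exact mw_mem _
  exact this hw

lemma Dg_zero_eq {w : Lam K M} (hw : w ∈ Dg K M 0) : ∃ c : K, w = c • 1 := by
  have : Dg K M 0 ≤ Submodule.span K {(1 : Lam K M)} := by
    apply Dg_le
    intro v
    rw [mw_zero]; exact Submodule.mem_span_singleton_self _
  obtain ⟨c, hc⟩ := Submodule.mem_span_singleton.1 (this hw)
  exact ⟨c, hc.symm⟩

/-- induction on degree: a submodule family is stable -/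
lemma Dg_succ_le {p : ℕ} {S : Submodule K (Lam K M)} (h : ∀ x, ∀ w ∈ Dg K M p, e x w ∈ S) :
    Dg K M (p + 1) ≤ S := by
  apply Dg_le
  intro v
  rw [mw_succ]
  exact h _ _ (mw_mem _)

lemma pj_mem (p : ℕ) (w : Lam K M) : pj p w ∈ Dg K M p := by
  induction w using op_ind generalizing p with
  | h1 =>
    cases p with
    | zero => rw [pj_zero_one]; exact one_mem
    | succ p => rw [pj_succ_one]; exact zero_mem _
  | hs c x h => rw [map_smul]; exact Submodule.smul_mem _ _ (h p)
  | ha x y hx hy => rw [map_add]; exact add_mem (hx p) (hy p)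
  | he m x h =>
    cases p with
    | zero => rw [pj_zero_e']; exact zero_mem _
    | succ p => rw [pj_succ_e']; exact e_mem _ (h p)

lemma pj_mw (p q : ℕ) (v : Fin q → M) :
    (pj p (mw q v) : Lam K M) = if p = q then mw q v else 0 := by
  induction q generalizing p with
  | zero =>
    rw [mw_zero]
    cases p with
    | zero => simp [pj_zero_one]
    | succ p => simp [pj_succ_one]
  | succ q ih =>
    rw [mw_succ]
    cases p with
    | zero => simp [pj_zero_e']
    | succ p => rw [pj_succ_e', ih]; by_cases h : p = q <;> simp [h]

lemma pj_same {p : ℕ} {w : Lam K M} (hw : w ∈ Dg K M p) : pj p w = w := by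
  have := Dg_ind (Z := pj p) (W := LinearMap.id) (fun v => by rw [pj_mw]; simp) hw
  simpa using this

lemma pj_ne {p q : ℕ} (h : p ≠ q) {w : Lam K M} (hw : w ∈ Dg K M q) : pj p w = 0 := by
  have := Dg_ind (Z := pj p) (W := 0) (fun v => by rw [pj_mw]; simp [h]) hw
  simpa using this

lemma sum_pj (w : Lam K M) : ∃ n, ∀ m, n ≤ m → w = ∑ p ∈ Finset.range m, pj p w := by
  induction w using op_ind with
  | h1 =>
    refine ⟨1, fun m hm => ?_⟩
    obtain ⟨m, rfl⟩ := Nat.exists_eq_add_of_le' hm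
    rw [Finset.sum_range_succ']; simp [pj_zero_one, pj_succ_one]
  | hs c x h =>
    obtain ⟨n, h⟩ := h
    refine ⟨n, fun m hm => ?_⟩
    simp_rw [map_smul]; rw [← Finset.smul_sum, ← h m hm]
  | ha x y hx hy =>
    obtain ⟨n, h⟩ := hx
    obtain ⟨n', h'⟩ := hy
    refine ⟨max n n', fun m hm => ?_⟩
    simp_rw [map_add]; rw [Finset.sum_add_distrib, ← h m (by omega), ← h' m (by omega)]
  | he x w h =>
    obtain ⟨n, h⟩ := h
    refine ⟨n + 1, fun m hm => ?_⟩
    obtain ⟨m, rfl⟩ := Nat.exists_eq_add_of_le' (show 1 ≤ m by omega)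
    rw [Finset.sum_range_succ']
    simp_rw [pj_zero_e', pj_succ_e']
    rw [← map_sum, ← h m (by omega), add_zero]

lemma op_eq_of_Dg {N : Type*} [AddCommGroup N] [Module K N] {Z W : Lam K M →ₗ[K] N}
    (h : ∀ p, ∀ w ∈ Dg K M p, Z w = W w) : Z = W := by
  refine LinearMap.ext fun w => ?_
  obtain ⟨n, hn⟩ := sum_pj w
  rw [hn n le_rfl, map_sum, map_sum]
  exact Finset.sum_congr rfl fun p _ => h p _ (pj_mem p w)

lemma der_mem (f : Module.End K M) {p : ℕ} {w : Lam K M} (hw : w ∈ Dg K M p) :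
    der f w ∈ Dg K M p := by
  induction p generalizing w with
  | zero =>
    obtain ⟨c, rfl⟩ := Dg_zero_eq hw
    rw [map_smul, der_one, smul_zero]; exact zero_mem _
  | succ p ih =>
    refine Dg_succ_le (S := (Dg K M (p+1)).comap (der f)) (fun x w hw => ?_) hw
    have := LinearMap.congr_fun (der_e f x) w
    simp only [Module.End.mul_apply, LinearMap.add_apply] at this
    rw [Submodule.mem_comap, this]
    exact add_mem (e_mem _ (ih hw)) (e_mem _ hw)

lemma ct_zero_deg (f : Module.Dual K M) {w : Lam K M} (hw : w ∈ Dg K M 0) : ct f w = 0 := by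
  obtain ⟨c, rfl⟩ := Dg_zero_eq hw
  rw [map_smul, ct_one, smul_zero]

lemma ct_mem (f : Module.Dual K M) {p : ℕ} {w : Lam K M} (hw : w ∈ Dg K M (p + 1)) :
    ct f w ∈ Dg K M p := by
  induction p generalizing w with
  | zero =>
    refine Dg_succ_le (S := (Dg K M 0).comap (ct f)) (fun x w hw => ?_) hw
    have := LinearMap.congr_fun (ct_e f x) w
    simp only [Module.End.mul_apply, LinearMap.add_apply, ct_zero_deg f hw, map_zero, add_zero] at this
    rw [Submodule.mem_comap, this]
    exact Submodule.smul_mem _ _ hw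
  | succ p ih =>
    refine Dg_succ_le (S := (Dg K M (p + 1)).comap (ct f)) (fun x w hw => ?_) hw
    have := eq_sub_of_add_eq (LinearMap.congr_fun (ct_e f x) w)
    simp only [Module.End.mul_apply] at this
    rw [Submodule.mem_comap, this]
    exact sub_mem (Submodule.smul_mem _ _ hw) (e_mem _ (ih hw))

lemma bd_zero_deg (β : M →ₗ[K] Module.End K M) (hβ) {w : Lam K M} (hw : w ∈ Dg K M 0) :
    bd β hβ w = 0 := by
  obtain ⟨c, rfl⟩ := Dg_zero_eq hw
  rw [map_smul, bd_one, smul_zero]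

lemma bd_one_deg (β : M →ₗ[K] Module.End K M) (hβ) {w : Lam K M} (hw : w ∈ Dg K M 1) :
    bd β hβ w = 0 := by
  refine Dg_succ_le (S := LinearMap.ker (bd β hβ)) (fun x w hw => ?_) hw
  obtain ⟨c, rfl⟩ := Dg_zero_eq hw
  have := LinearMap.congr_fun (bd_e β hβ x) 1
  simp only [Module.End.mul_apply, LinearMap.add_apply, bd_one, der_one, LinearMap.neg_apply, map_zero] at this
  rw [LinearMap.mem_ker, map_smul, map_smul, this]; simp

lemma bd_mem (β : M →ₗ[K] Module.End K M) (hβ) {p : ℕ} {w : Lam K M} (hw : w ∈ Dg K M (p + 1)) :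
    bd β hβ w ∈ Dg K M p := by
  induction p generalizing w with
  | zero => rw [bd_one_deg β hβ hw]; exact zero_mem _
  | succ p ih =>
    refine Dg_succ_le (S := (Dg K M (p + 1)).comap (bd β hβ)) (fun x w hw => ?_) hw
    have := LinearMap.congr_fun (bd_e β hβ x) w
    simp only [Module.End.mul_apply, LinearMap.add_apply, LinearMap.neg_apply] at this
    rw [Submodule.mem_comap, this]
    exact add_mem (neg_mem (e_mem _ (ih hw))) (der_mem _ hw)

lemma om_zero_deg (β : M →ₗ[K] Module.Dual K M) (hβ) {w : Lam K M} (hw : w ∈ Dg K M 0) :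
    om β hβ w = 0 := by
  obtain ⟨c, rfl⟩ := Dg_zero_eq hw
  rw [map_smul, om_one, smul_zero]

lemma om_one_deg (β : M →ₗ[K] Module.Dual K M) (hβ) {w : Lam K M} (hw : w ∈ Dg K M 1) :
    om β hβ w = 0 := by
  refine Dg_succ_le (S := LinearMap.ker (om β hβ)) (fun x w hw => ?_) hw
  have := LinearMap.congr_fun (om_e β hβ x) w
  simp only [Module.End.mul_apply, LinearMap.add_apply, om_zero_deg β hβ hw, ct_zero_deg _ hw, map_zero] at this
  rw [LinearMap.mem_ker, this]; simp

lemma om_mem (β : M →ₗ[K] Module.Dual K M) (hβ) {p : ℕ} {w : Lam K M} (hw : w ∈ Dg K M (p + 2)) :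
    om β hβ w ∈ Dg K M p := by
  induction p generalizing w with
  | zero =>
    refine Dg_succ_le (S := (Dg K M 0).comap (om β hβ)) (fun x w hw => ?_) hw
    have := LinearMap.congr_fun (om_e β hβ x) w
    simp only [Module.End.mul_apply, LinearMap.add_apply, om_one_deg β hβ hw, map_zero, zero_add] at this
    rw [Submodule.mem_comap, this]
    exact ct_mem _ hw
  | succ p ih =>
    refine Dg_succ_le (S := (Dg K M (p + 1)).comap (om β hβ)) (fun x w hw => ?_) hw
    have := LinearMap.congr_fun (om_e β hβ x) w
    simp only [Module.End.mul_apply, LinearMap.add_apply] at this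
    rw [Submodule.mem_comap, this]
    exact add_mem (e_mem _ (ih hw)) (ct_mem _ hw)

lemma der_id {p : ℕ} {w : Lam K M} (hw : w ∈ Dg K M p) : der 1 w = (p : K) • w := by
  induction p generalizing w with
  | zero =>
    obtain ⟨c, rfl⟩ := Dg_zero_eq hw
    rw [map_smul, der_one]; simp
  | succ p ih =>
    refine Dg_succ_le (S := LinearMap.eqLocus (der 1) (((p + 1 : ℕ) : K) • LinearMap.id)) (fun x w hw => ?_) hw
    have := LinearMap.congr_fun (der_e 1 x) w
    simp only [Module.End.mul_apply, LinearMap.add_apply, ih hw, Module.End.one_apply] at this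
    rw [LinearMap.mem_eqLocus, this]
    simp [add_smul]

/-- the augmentation -/
def eps0 : Lam K M →ₗ[K] K :=
  (ExteriorAlgebra.algebraMapInv.toLinearMap : ExteriorAlgebra K M →ₗ[K] K)

lemma eps0_one : eps0 (1 : Lam K M) = 1 := map_one (ExteriorAlgebra.algebraMapInv : ExteriorAlgebra K M →ₐ[K] K)

lemma eps0_e (x : M) (w : Lam K M) : eps0 (e x w) = 0 := by
  have h := map_mul (ExteriorAlgebra.algebraMapInv : ExteriorAlgebra K M →ₐ[K] K) (ExteriorAlgebra.ι K x) w
  have h2 : (ExteriorAlgebra.algebraMapInv : ExteriorAlgebra K M →ₐ[K] K) (ExteriorAlgebra.ι K x) = 0 := by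
    simp [ExteriorAlgebra.algebraMapInv]
  rw [h2, zero_mul] at h
  exact h

lemma eps0_pos {p : ℕ} {w : Lam K M} (hw : w ∈ Dg K M (p + 1)) : eps0 w = 0 :=
  Dg_succ_le (S := LinearMap.ker eps0) (fun x w _ => eps0_e x w) hw

lemma eq_eps0 {w : Lam K M} (hw : w ∈ Dg K M 0) : w = eps0 w • 1 := by
  obtain ⟨c, rfl⟩ := Dg_zero_eq hw
  simp [eps0_one]

/-- functional attached to an alternating form -/
def hat {p : ℕ} (c : M [⋀^Fin p]→ₗ[K] K) : Lam K M →ₗ[K] K :=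
  (ExteriorAlgebra.liftAlternating (Pi.single p c) : ExteriorAlgebra K M →ₗ[K] K)

lemma hat_mw {p : ℕ} (c : M [⋀^Fin p]→ₗ[K] K) (v : Fin p → M) : hat c (mw p v) = c v := by
  have := ExteriorAlgebra.liftAlternating_apply_ιMulti (R := K) (Pi.single p c) v
  rw [Pi.single_eq_same] at this
  exact this

lemma hat_ne {p q : ℕ} (h : q ≠ p) (c : M [⋀^Fin p]→ₗ[K] K) {w : Lam K M} (hw : w ∈ Dg K M q) :
    hat c w = 0 := by
  have := Dg_ind (Z := hat c) (W := 0) (fun v => ?_) hw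
  · simpa using this
  · have := ExteriorAlgebra.liftAlternating_apply_ιMulti (R := K) (Pi.single p c) v
    rw [Pi.single_eq_of_ne h] at this
    exact this

section map
variable {M' : Type*} [AddCommGroup M'] [Module K M']

def mp (f : M →ₗ[K] M') : Lam K M →ₗ[K] Lam K M' :=
  ((ExteriorAlgebra.map f).toLinearMap : ExteriorAlgebra K M →ₗ[K] ExteriorAlgebra K M')

lemma mp_one (f : M →ₗ[K] M') : mp f (1 : Lam K M) = 1 :=
  map_one (ExteriorAlgebra.map f)

lemma mp_e (f : M →ₗ[K] M') (x : M) (w : Lam K M) : mp f (e x w) = e (f x) (mp f w) := by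
  have := map_mul (ExteriorAlgebra.map f) (ExteriorAlgebra.ι K x) w
  rw [ExteriorAlgebra.map_apply_ι] at this
  exact this

lemma mp_mem (f : M →ₗ[K] M') {p : ℕ} {w : Lam K M} (hw : w ∈ Dg K M p) : mp f w ∈ Dg K M' p := by
  induction p generalizing w with
  | zero =>
    obtain ⟨c, rfl⟩ := Dg_zero_eq hw
    rw [map_smul, mp_one]; exact Submodule.smul_mem _ _ one_mem
  | succ p ih =>
    refine Dg_succ_le (S := (Dg K M' (p + 1)).comap (mp f)) (fun x w hw => ?_) hw
    rw [Submodule.mem_comap, mp_e]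
    exact e_mem _ (ih hw)

lemma mp_der (f : M →ₗ[K] M') (g : Module.End K M) (g' : Module.End K M')
    (h : ∀ x, f (g x) = g' (f x)) (w : Lam K M) : mp f (der g w) = der g' (mp f w) := by
  have : mp f ∘ₗ der g = der g' ∘ₗ mp f := by
    apply op_eqOn
    · simp [der_one, mp_one]
    · intro x w hw
      have h1 := LinearMap.congr_fun (der_e g x) w
      have h2 := LinearMap.congr_fun (der_e g' (f x)) (mp f w)
      simp only [Module.End.mul_apply, LinearMap.add_apply, LinearMap.comp_apply] at h1 h2 hw ⊢
      rw [h1, map_add, mp_e, mp_e, hw, mp_e, h2, h]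
  exact LinearMap.congr_fun this w

end map

end CW

namespace CW
section good
variable {K : Type*} [CommRing K] {N : Type*} [AddCommGroup N] [Module K N]

/-- filtration attached to a family of operators -/
def Fil {d : ℕ} (L : Fin d → Module.End K N) : ℕ → Submodule K N
  | 0 => ⊥
  | (k + 1) => ⨅ i, (Fil L k).comap (L i)

lemma Fil_succ {d : ℕ} {L : Fin d → Module.End K N} {k : ℕ} {x : N} :
    x ∈ Fil L (k + 1) ↔ ∀ i, L i x ∈ Fil L k := by
  simp [Fil, Submodule.mem_iInf]

lemma Fil_zero {d : ℕ} {L : Fin d → Module.End K N} {x : N} : x ∈ Fil L 0 ↔ x = 0 := by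
  simp [Fil]

lemma Fil_mono {d : ℕ} {L : Fin d → Module.End K N} {k : ℕ} : Fil L k ≤ Fil L (k + 1) := by
  induction k with
  | zero => intro x hx; rw [Fil_zero] at hx; subst hx; exact zero_mem _
  | succ k ih =>
    intro x hx
    rw [Fil_succ] at hx ⊢
    exact fun i => ih (hx i)

lemma Fil_mono' {d : ℕ} {L : Fin d → Module.End K N} {k l : ℕ} (h : k ≤ l) : Fil L k ≤ Fil L l := by
  induction h with
  | refl => exact le_rfl
  | step _ ih => exact ih.trans Fil_mono

/-- vectors on which `W` is invertible, witnessed by a polynomial -/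
def Good (W : Module.End K N) : Submodule K N where
  carrier := {x | ∃ Q : Polynomial K, Q.coeff 0 = 1 ∧ Polynomial.aeval W Q x = 0}
  zero_mem' := ⟨1, by simp, by simp⟩
  add_mem' := by
    rintro x y ⟨Q, h1, h2⟩ ⟨R, h3, h4⟩
    refine ⟨Q * R, by rw [Polynomial.mul_coeff_zero, h1, h3, one_mul], ?_⟩
    rw [map_add]
    nth_rw 1 [mul_comm Q R]
    simp [map_mul, h2, h4]
  smul_mem' := by
    rintro c x ⟨Q, h1, h2⟩
    exact ⟨Q, h1, by simp [h2]⟩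

lemma aeval_commute {W Z : Module.End K N} (h : Commute W Z) (Q : Polynomial K) :
    Commute (Polynomial.aeval W Q) Z := by
  rw [Polynomial.aeval_eq_sum_range]
  exact Commute.sum_left _ _ _ (fun i _ => (h.pow_left i).smul_left _)

lemma aeval_mem {W : Module.End K N} {S : Submodule K N} (h : ∀ x ∈ S, W x ∈ S) (Q : Polynomial K)
    {x : N} (hx : x ∈ S) : Polynomial.aeval W Q x ∈ S := by
  rw [Polynomial.aeval_eq_sum_range, LinearMap.sum_apply]
  refine sum_mem (fun i hi => ?_)
  clear hi
  rw [LinearMap.smul_apply]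
  refine S.smul_mem _ ?_
  induction i with
  | zero => simpa using hx
  | succ i ih => rw [pow_succ', Module.End.mul_apply]; exact h _ ih

lemma Good_stable {W Z : Module.End K N} (h : Commute W Z) {x : N} (hx : x ∈ Good W) :
    Z x ∈ Good W := by
  obtain ⟨Q, h1, h2⟩ := hx
  refine ⟨Q, h1, ?_⟩
  have : Commute (Polynomial.aeval W Q) Z := aeval_commute h Q
  have h3 := LinearMap.congr_fun this.eq x
  simp only [Module.End.mul_apply] at h3
  rw [h3, h2, map_zero]

lemma Good_step {W : Module.End K N} {k : K} (hk : IsUnit k) {x : N} (hx : W x - k • x ∈ Good W) :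
    x ∈ Good W := by
  obtain ⟨Q, h1, h2⟩ := hx
  obtain ⟨u, rfl⟩ := hk
  refine ⟨Q * (Polynomial.C (-(↑u⁻¹ : K)) * (Polynomial.X - Polynomial.C (u : K))), ?_, ?_⟩
  · simp [Polynomial.mul_coeff_zero, h1]
  · have : Polynomial.aeval W (Polynomial.C (-(↑u⁻¹ : K)) * (Polynomial.X - Polynomial.C (u : K))) x
      = (-(↑u⁻¹ : K)) • (W x - (u : K) • x) := by
      simp [map_mul, map_sub, Algebra.smul_def, Module.algebraMap_end_apply]
      simp [smul_sub, smul_smul]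
    rw [map_mul, Module.End.mul_apply, this, map_smul, h2, smul_zero]

lemma Good_inv {W : Module.End K N} : ∃ G : Good W →ₗ[K] N,
    (∀ x, G x ∈ Good W) ∧ (∀ x, W (G x) = x) ∧ (∀ x (h : W x ∈ Good W), x ∈ Good W → G ⟨W x, h⟩ = x) ∧
    (∀ x, ∃ P : Polynomial K, G x = Polynomial.aeval W P x) := by
  have hst : ∀ x ∈ Good W, W x ∈ Good W := fun x hx => Good_stable (Commute.refl W) hx
  have key : ∀ x ∈ Good W, ∃ P : Polynomial K, x = W (Polynomial.aeval W P x) := by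
    rintro x ⟨Q, h1, h2⟩
    refine ⟨-Q.divX, ?_⟩
    have h3 := Polynomial.X_mul_divX_add Q
    rw [h1] at h3
    rw [← h3] at h2
    simp only [map_add, map_mul, Polynomial.aeval_X, map_one, LinearMap.add_apply,
      Module.End.mul_apply, Module.End.one_apply] at h2
    rw [map_neg, LinearMap.neg_apply, map_neg]
    exact eq_neg_of_add_eq_zero_right h2
  have hinj : ∀ x ∈ Good W, W x = 0 → x = 0 := by
    intro x hx h0
    obtain ⟨P, hP⟩ := key x hx
    rw [hP]
    have : Commute W (Polynomial.aeval W P) := by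
      have := (Commute.all (Polynomial.X : Polynomial K) P).map (Polynomial.aeval W)
      simpa using this
    have h3 := LinearMap.congr_fun this.eq x
    simp only [Module.End.mul_apply] at h3
    rw [h3, h0, map_zero]
  have hP : ∀ x ∈ Good W, ∀ P : Polynomial K, Polynomial.aeval W P x ∈ Good W := by
    intro x hx P
    apply Good_stable _ hx
    have := (Commute.all (Polynomial.X : Polynomial K) P).map (Polynomial.aeval W)
    simpa using this
  let W' : Module.End K (Good W) := W.restrict hst
  have bij : Function.Bijective W' := by
    constructor
    · rw [injective_iff_map_eq_zero]
      rintro ⟨x, hx⟩ h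
      have : W x = 0 := congrArg Subtype.val h
      exact Subtype.ext (hinj x hx this)
    · rintro ⟨x, hx⟩
      obtain ⟨P, h⟩ := key x hx
      exact ⟨⟨_, hP x hx P⟩, Subtype.ext h.symm⟩
  let eqv := LinearEquiv.ofBijective W' bij
  have hW : ∀ x : Good W, W (eqv.symm x : Good W) = x := by
    intro x
    have := eqv.apply_symm_apply x
    exact congrArg Subtype.val this
  refine ⟨(Good W).subtype ∘ₗ eqv.symm.toLinearMap, fun x => (eqv.symm x).2, hW, ?_, ?_⟩
  · intro x h hx
    have := eqv.symm_apply_apply ⟨x, hx⟩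
    exact congrArg Subtype.val this
  · intro x
    obtain ⟨P, h⟩ := key x x.2
    refine ⟨P, ?_⟩
    have h1 := hW x
    have h2 : W ((eqv.symm x : N) - Polynomial.aeval W P x) = 0 := by
      rw [map_sub, h1, ← h, sub_self]
    exact sub_eq_zero.1 (hinj _ (sub_mem (eqv.symm x).2 (hP x x.2 P)) h2)

end good
end CW

namespace CW
section heis
variable {K : Type*} [CommRing K] {G : Type*} [AddCommGroup G] [Module K G] {d : ℕ}

/-- Lie algebra containing a Heisenberg family acting by commuting derivations -/
structure Heis (K : Type*) [CommRing K] (G : Type*) [AddCommGroup G] [Module K G] (d : ℕ) where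
  br : G →ₗ[K] Module.End K G
  alt : ∀ x, br x x = 0
  jac : Jac br
  pd : Fin d → Module.End K G
  mu : Fin d → Module.End K G
  y : Fin d → G
  one : G
  w : Fin d → Fin d → K
  br_y : ∀ i, br (y i) = pd i
  pd_comm : ∀ i j, pd i * pd j = pd j * pd i
  pd_mu : ∀ i j, pd i * mu j = mu j * pd i + if i = j then 1 else 0
  br_one : br one = 0
  br_yy : ∀ i j, br (y i) (y j) = w i j • one
  nil : ∀ x, ∃ k, x ∈ Fil pd k
  tf : ∀ k : K, k • one = 0 → k = 0

namespace Heis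
variable (A : Heis K G d)

/-- linear extension of `pd` -/
def pdV : (Fin d → K) →ₗ[K] Module.End K G := ∑ i, (LinearMap.proj i).smulRight (A.pd i)

lemma pdV_apply (v : Fin d → K) (x : G) : A.pdV v x = ∑ i, v i • A.pd i x := by
  simp [pdV, LinearMap.sum_apply]

lemma pdV_single (i : Fin d) : A.pdV (Pi.single i 1) = A.pd i := by
  ext x; simp [pdV_apply, Pi.single_apply]

/-- linear extension of `y` -/
def yV : (Fin d → K) →ₗ[K] G := ∑ i, (LinearMap.proj i).smulRight (A.y i)

lemma yV_apply (v : Fin d → K) : A.yV v = ∑ i, v i • A.y i := by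
  simp [yV, LinearMap.sum_apply]

lemma br_yV (v : Fin d → K) : A.br (A.yV v) = A.pdV v := by
  ext x; simp [yV_apply, pdV_apply, map_sum, A.br_y, LinearMap.sum_apply]

lemma pdV_comm (v v' : Fin d → K) (x : G) : A.pdV v (A.pdV v' x) = A.pdV v' (A.pdV v x) := by
  simp only [pdV_apply, map_sum, map_smul, Finset.smul_sum]
  rw [Finset.sum_comm]
  refine Finset.sum_congr rfl fun i _ => Finset.sum_congr rfl fun j _ => ?_
  have := LinearMap.congr_fun (A.pd_comm i j) x
  simp only [Module.End.mul_apply] at this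
  rw [smul_comm, this]

lemma pdV_der (v : Fin d → K) (x z : G) :
    A.pdV v (A.br x z) = A.br (A.pdV v x) z + A.br x (A.pdV v z) := by
  rw [← br_yV]; exact A.jac _ _ _

lemma pdV_mu (v : Fin d → K) (i : Fin d) (x : G) :
    A.pdV v (A.mu i x) = A.mu i (A.pdV v x) + v i • x := by
  have h : ∀ j, A.pd j (A.mu i x) = A.mu i (A.pd j x) + if j = i then x else 0 := by
    intro j
    have := LinearMap.congr_fun (A.pd_mu j i) x
    simp only [Module.End.mul_apply, LinearMap.add_apply] at this
    rw [this]; split_ifs <;> simp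
  simp only [pdV_apply, h, smul_add, Finset.sum_add_distrib, map_sum, map_smul]
  simp

/-- the semidirect product bracket -/
def br' : ((Fin d → K) × G) →ₗ[K] Module.End K ((Fin d → K) × G) :=
  LinearMap.mk₂ K (fun z z' => (0, A.pdV z.1 z'.2 - A.pdV z'.1 z.2 + A.br z.2 z'.2))
    (by intro a b c; ext <;> simp; abel)
    (by intro k a b; ext <;> simp [smul_sub])
    (by intro a b c; ext <;> simp; abel)
    (by intro k a b; ext <;> simp [smul_sub])

lemma br'_apply (z z' : (Fin d → K) × G) :
    A.br' z z' = (0, A.pdV z.1 z'.2 - A.pdV z'.1 z.2 + A.br z.2 z'.2) := rfl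

lemma alt' (z) : A.br' z z = 0 := by
  rw [br'_apply]; simp [A.alt]

lemma jac' : Jac A.br' := by
  intro x y z
  simp only [br'_apply]
  ext
  · simp
  · have h1 := A.jac x.2 y.2 z.2
    have h2 := A.pdV_der x.1 y.2 z.2
    have h3 := A.pdV_der y.1 x.2 z.2
    have h4 := A.pdV_der z.1 x.2 y.2
    have h5 := A.pdV_comm x.1 y.1 z.2
    have h6 := A.pdV_comm x.1 z.1 y.2
    have h7 := A.pdV_comm y.1 z.1 x.2
    have h8 := alt_swap A.alt y.2 (A.pdV z.1 x.2)
    simp only [Prod.snd_add, Prod.fst_add, map_sub, map_add, map_zero, LinearMap.zero_apply, LinearMap.sub_apply,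
      LinearMap.add_apply]
    rw [h1, h2, h3, h4, h5, h6, h7, h8]
    abel

abbrev T := Lam K ((Fin d → K) × G)

/-- block map -/
def P0 (f : Module.End K G) : Module.End K ((Fin d → K) × G) := LinearMap.prodMap 0 f

lemma P0_apply (f : Module.End K G) (z : (Fin d → K) × G) : P0 f z = (0, f z.2) := rfl

lemma P0_mul (f g : Module.End K G) : (P0 f * P0 g : Module.End K ((Fin d → K) × G)) = P0 (f * g) := by
  ext z <;> simp [P0_apply]
lemma P0_sub (f g : Module.End K G) : (P0 f - P0 g : Module.End K ((Fin d → K) × G)) = P0 (f - g) := by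
  ext z <;> simp [P0_apply]

/-- differential of the semidirect product -/
def D : Op K ((Fin d → K) × G) := bd A.br' A.alt'

lemma D_sq : A.D * A.D = 0 := bd_sq _ A.jac'

def bv (i : Fin d) : (Fin d → K) × G := (Pi.single i 1, 0)
def E (i : Fin d) : Op K ((Fin d → K) × G) := e (bv i)
def Lx (i : Fin d) : Op K ((Fin d → K) × G) := der (P0 (A.pd i))
def Mx (i : Fin d) : Op K ((Fin d → K) × G) := der (P0 (A.mu i))
def NG : Op K ((Fin d → K) × G) := der (P0 1)
def PV : Module.End K ((Fin d → K) × G) := LinearMap.prodMap 1 0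
lemma PV_apply (z : (Fin d → K) × G) : PV z = (z.1, 0) := rfl
def NV : Op K ((Fin d → K) × G) := der PV
def cV (i : Fin d) : Module.Dual K ((Fin d → K) × G) := (LinearMap.proj i) ∘ₗ LinearMap.fst K _ _
lemma cV_apply (i : Fin d) (z : (Fin d → K) × G) : cV i z = z.1 i := rfl
def s0 : Op K ((Fin d → K) × G) := ∑ i, E i * A.Mx i

/-- defect of `mu` to be a derivation -/
def gam (i : Fin d) : ((Fin d → K) × G) →ₗ[K] Module.End K ((Fin d → K) × G) :=
  LinearMap.mk₂ K (fun z z' => (0, actE (A.mu i) A.br z.2 z'.2))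
    (by intro a b c; ext <;> simp)
    (by intro k a b; ext <;> simp)
    (by intro a b c; ext <;> simp)
    (by intro k a b; ext <;> simp)
lemma gam_apply (i : Fin d) (z z' : (Fin d → K) × G) :
  A.gam i z z' = (0, actE (A.mu i) A.br z.2 z'.2) := rfl
lemma gam_alt (i : Fin d) (z) : A.gam i z z = 0 := by
  rw [gam_apply, actE_alt _ A.alt]; rfl

/-- weight part of the defect -/
def del (i : Fin d) : ((Fin d → K) × G) →ₗ[K] Module.End K ((Fin d → K) × G) :=
  LinearMap.mk₂ K (fun z z' => (0, z.1 i • z'.2 - z'.1 i • z.2))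
    (by intro a b c; ext <;> simp [add_smul]; abel)
    (by intro k a b; ext <;> simp [smul_sub, mul_smul, smul_comm (b.1 i) k])
    (by intro a b c; ext <;> simp [add_smul]; abel)
    (by intro k a b; ext <;> simp [smul_sub, mul_smul, smul_comm (a.1 i) k])
lemma del_apply (i : Fin d) (z z' : (Fin d → K) × G) :
  del i z z' = ((0 : Fin d → K), z.1 i • z'.2 - z'.1 i • z.2) := rfl
lemma del_alt (i : Fin d) (z : (Fin d → K) × G) : del i z z = 0 := by
  rw [del_apply]; simp

lemma bd_del (i : Fin d) : bd (del i) (del_alt (G := G) (K := K) i) = ct (cV i) * NG := by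
  symm
  apply bd_uniq
  · simp [NG, der_one]
  · intro z
    have h1 : NG * e z = e z * NG + e (P0 1 z) := der_e (K := K) (P0 (1 : Module.End K G)) z
    have h2 := ct_e (cV (K := K) i) z
    have h3 := ct_e (cV (K := K) i) (P0 (1 : Module.End K G) z)
    have h4 : der (del i z) = z.1 i • (NG : Op K ((Fin d → K) × G)) - e (P0 (1 : Module.End K G) z) * ct (cV i) := by
      rw [der_rank1, NG, ← der_smul, ← der_sub]; congr 1
      refine LinearMap.ext fun z' => ?_
      simp [del_apply, P0_apply, cV_apply]
    have h5 : cV i (P0 (1 : Module.End K G) z) = (0 : K) := by simp [P0_apply, cV_apply]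
    rw [h5, zero_smul] at h3
    rw [h4]
    have h6 : (cV i z • (1 : Op K ((Fin d → K) × G))) * NG = z.1 i • NG := by
      rw [cV_apply]; simp
    linear_combination (norm := noncomm_ring) ct (cV i) * h1 + h2 * NG + h3 + h6

lemma Mx_D (i : Fin d) : A.Mx i * A.D = A.D * A.Mx i - ct (cV i) * NG + bd (A.gam i) (A.gam_alt i) := by
  have h1 := der_bd (P0 (A.mu i)) A.br' A.alt'
  have h2 : bd (actE (P0 (A.mu i)) A.br') (actE_alt _ A.alt')
    = bd ((-1 : K) • del i) (by intro z; simp [del_alt]) + bd (A.gam i) (A.gam_alt i) := by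
    rw [← bd_add (h := by intro z; simp [gam_alt, del_alt])]
    apply bd_congr
    intro z z'
    rw [actE_apply]
    simp only [LinearMap.add_apply, LinearMap.smul_apply, gam_apply, del_apply, br'_apply, P0_apply, actE_apply]
    ext
    · simp
    · simp [pdV_mu]; abel
  rw [bd_smul (hβ := del_alt i), bd_del, neg_one_smul] at h2
  rw [h2] at h1
  rw [Mx, D]
  linear_combination (norm := noncomm_ring) h1

lemma NV_sum : ∑ i, (E i * ct (cV i) : Op K ((Fin d → K) × G)) = NV := by
  rw [NV]
  simp only [E, der_rank1, ← der_sum]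
  congr 1
  refine LinearMap.ext fun z => ?_
  rw [LinearMap.sum_apply, PV_apply]
  ext j
  · simp [bv, cV_apply, Prod.fst_sum, Pi.single_apply]
  · simp [bv, cV_apply, Prod.snd_sum]

/-- the Euler-type operator -/
def EE : Op K ((Fin d → K) × G) := ∑ i, A.Mx i * A.Lx i
def R : Op K ((Fin d → K) × G) := ∑ i, E i * bd (A.gam i) (A.gam_alt i)
def WW : Op K ((Fin d → K) × G) := A.D * A.s0 + A.s0 * A.D

lemma Lx_Mx (i j : Fin d) : A.Lx i * A.Mx j = A.Mx j * A.Lx i + if i = j then NG else 0 := by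
  have h := der_comm (P0 (A.pd i)) (P0 (d := d) (A.mu j))
  rw [P0_mul, P0_mul, P0_sub, A.pd_mu, add_sub_cancel_left] at h
  rw [Lx, Mx, NG]
  rw [sub_eq_iff_eq_add'] at h
  rw [h]
  congr 1
  split_ifs
  · rfl
  · rw [← der_zero]; congr 1

lemma D_E (i : Fin d) : A.D * E i = - (E i * A.D) + A.Lx i := by
  rw [D, E, bd_e, Lx]
  congr 2
  refine LinearMap.ext fun z => ?_
  rw [br'_apply, P0_apply]
  simp [bv, pdV_single]

lemma WW_eq : A.WW = A.EE + (d : K) • NG - NV * NG + A.R := by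
  have h : ∀ i, A.D * (E i * A.Mx i) + E i * A.Mx i * A.D = A.Mx i * A.Lx i + NG - E i * ct (cV i) * NG
      + E i * bd (A.gam i) (A.gam_alt i) := by
    intro i
    have h1 := A.D_E i
    have h2 := A.Mx_D i
    have h3 := A.Lx_Mx i i
    rw [if_pos rfl] at h3
    linear_combination (norm := noncomm_ring) h1 * A.Mx i + E i * h2 + h3
  rw [WW, s0, Finset.mul_sum, Finset.sum_mul, ← Finset.sum_add_distrib]
  simp only [h]
  rw [Finset.sum_add_distrib, Finset.sum_sub_distrib, Finset.sum_add_distrib, ← Finset.sum_mul, NV_sum]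
  simp [EE, R, Nat.cast_smul_eq_nsmul]

end Heis
end heis
end CW

namespace CW
section heis3
variable {K : Type*} [CommRing K] {G : Type*} [AddCommGroup G] [Module K G] {d : ℕ}

lemma unit_int [Algebra ℚ K] {m : ℤ} (h : m ≠ 0) : IsUnit (m : K) := by
  have : IsUnit (m : ℚ) := by simpa using h
  have := this.map (algebraMap ℚ K)
  simpa using this

lemma unit_nat [Algebra ℚ K] {m : ℕ} (h : m ≠ 0) : IsUnit (m : K) := by
  have := unit_int (K := K) (m := (m : ℤ)) (by simpa using h)
  simpa using this

namespace Heis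
variable (A : Heis K G d)

/-- projection to the `V` part -/
def Zop : Op K ((Fin d → K) × G) := mp PV

lemma Z_one : (Zop : Op K ((Fin d → K) × G)) 1 = 1 := mp_one _
lemma Z_e (z : (Fin d → K) × G) : (Zop * e z : Op K ((Fin d → K) × G)) = e (PV z) * Zop :=
  LinearMap.ext fun w => mp_e _ _ _
lemma Z_E (i : Fin d) : (Zop * E i : Op K ((Fin d → K) × G)) = E i * Zop := by
  rw [E, Z_e]; rfl

lemma Z_der {f : Module.End K ((Fin d → K) × G)} (h : ∀ z, PV (f z) = 0) : Zop * der f = 0 := by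
  apply op_eqOn
  · simp [der_one]
  · intro x w hw
    have h1 := LinearMap.congr_fun (der_e f x) w
    have h2 := LinearMap.congr_fun (Z_e x) (der f w)
    have h3 := LinearMap.congr_fun (Z_e (f x)) w
    simp only [Module.End.mul_apply, LinearMap.add_apply, LinearMap.zero_apply] at h1 h2 h3 hw ⊢
    rw [h1, map_add, h2, hw, map_zero, h3, h, e_zero]; simp

lemma Z_gam (i : Fin d) : Zop * bd (A.gam i) (A.gam_alt i) = 0 := by
  apply op_eqOn
  · simp [bd_one]
  · intro x w hw
    have h1 := LinearMap.congr_fun (bd_e (A.gam i) (A.gam_alt i) x) w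
    have h2 := LinearMap.congr_fun (Z_e x) (bd (A.gam i) (A.gam_alt i) w)
    have h3 := LinearMap.congr_fun (Z_der (f := A.gam i x) (by intro z; simp [gam_apply, PV_apply])) w
    simp only [Module.End.mul_apply, LinearMap.add_apply, LinearMap.zero_apply, LinearMap.neg_apply] at h1 h2 h3 hw ⊢
    rw [h1, map_add, map_neg, h2, hw, map_zero, h3]; simp

lemma Z_Mx (i : Fin d) : Zop * A.Mx i = 0 := Z_der (by intro z; simp [P0_apply, PV_apply])
lemma Z_Lx (i : Fin d) : Zop * A.Lx i = 0 := Z_der (by intro z; simp [P0_apply, PV_apply])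
lemma Z_NG : (Zop * NG : Op K ((Fin d → K) × G)) = 0 := Z_der (by intro z; simp [P0_apply, PV_apply])
lemma Z_R : Zop * A.R = 0 := by
  rw [R, Finset.mul_sum]
  refine Finset.sum_eq_zero fun i _ => ?_
  rw [← mul_assoc, Z_E, mul_assoc, Z_gam, mul_zero]
lemma Z_s0 : Zop * A.s0 = 0 := by
  rw [s0, Finset.mul_sum]
  refine Finset.sum_eq_zero fun i _ => ?_
  rw [← mul_assoc, Z_E, mul_assoc, Z_Mx, mul_zero]

lemma NG_e (z : (Fin d → K) × G) : (NG * e z : Op K ((Fin d → K) × G)) = e z * NG + e (P0 1 z) := der_e _ _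
lemma NG_Z : (NG * Zop : Op K ((Fin d → K) × G)) = 0 := by
  apply op_eqOn
  · simp [der_one, Z_one, NG]
  · intro x w hw
    have h1 := LinearMap.congr_fun (Z_e x) w
    have h2 := LinearMap.congr_fun (NG_e (PV x)) (Zop w)
    simp only [Module.End.mul_apply, LinearMap.add_apply, LinearMap.zero_apply, LinearMap.neg_apply] at h1 h2 hw ⊢
    rw [h1, h2, hw, P0_apply, PV_apply]
    simp only [map_zero, zero_add]
    rw [show ((0 : Fin d → K), (0 : G)) = 0 from rfl, e_zero]; rfl

/-- falling products in `NG` -/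
def Q : ℕ → Op K ((Fin d → K) × G)
  | 0 => 1
  | (m + 1) => (((m + 1 : ℕ) : K) • 1 - NG) * Q m

lemma Q_succ (m : ℕ) : (Q (m + 1) : Op K ((Fin d → K) × G)) = (((m + 1 : ℕ) : K) • 1 - NG) * Q m := rfl

lemma Q_eV (m : ℕ) (v : Fin d → K) : (Q m * e (v, 0) : Op K ((Fin d → K) × G)) = e (v, 0) * Q m := by
  induction m with
  | zero => simp [Q]
  | succ m ih =>
    have h := NG_e (K := K) (G := G) (v, 0)
    rw [P0_apply] at h
    simp only [map_zero] at h
    rw [show ((0 : Fin d → K), (0 : G)) = 0 from rfl, e_zero, add_zero] at h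
    rw [Q_succ, mul_assoc, ih, ← mul_assoc, sub_mul, h, ← mul_assoc, mul_sub]
    simp

lemma Q_eG (m : ℕ) (x : G) : (Q (m + 1) * e (0, x) : Op K ((Fin d → K) × G)) = - (e (0, x) * (NG * Q m)) := by
  have h := NG_e (K := K) (G := G) ((0 : Fin d → K), x)
  rw [P0_apply] at h
  simp only [Module.End.one_apply] at h
  induction m with
  | zero => simp only [Q_succ, Q]; simp [sub_mul, h]
  | succ m ih =>
    rw [Q_succ (m + 1), mul_assoc, ih, Q_succ m]
    have h2 : ((((m + 1 + 1 : ℕ) : K)) • (1 : Op K ((Fin d → K) × G)))  = (((m + 1 : ℕ) : K)) • 1 + 1 := by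
      push_cast; rw [add_smul ((m : K) + 1), one_smul]
    rw [h2]
    have h5 : ∀ Z : Op K ((Fin d → K) × G), Z * (((m + 1 : ℕ) : K) • 1) = (((m + 1 : ℕ) : K) • 1) * Z := by
      intro Z; simp
    have h6 := h5 (e (0, x))
    have h7 := h5 NG
    generalize ((((m + 1 : ℕ) : K)) • (1 : Op K ((Fin d → K) × G))) = c at *
    linear_combination (norm := noncomm_ring) h * NG * Q m + h6 * NG * Q m + e (0, x) * h7 * Q m

lemma Q_Z (w : Lam K ((Fin d → K) × G)) : ∃ n, ∀ m, n ≤ m → Q m w = ((m.factorial : ℕ) : K) • Zop w := by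
  have up : ∀ (w : Lam K ((Fin d → K) × G)) (m : ℕ), Q m w = ((m.factorial : ℕ) : K) • Zop w →
      Q (m + 1) w = (((m + 1).factorial : ℕ) : K) • Zop w := by
    intro w m h
    have h2 := LinearMap.congr_fun (NG_Z (K := K) (G := G) (d := d)) w
    simp only [Module.End.mul_apply, LinearMap.zero_apply] at h2
    rw [Q_succ, Module.End.mul_apply, h, map_smul, LinearMap.sub_apply, h2, sub_zero, LinearMap.smul_apply,
      smul_smul, Nat.factorial_succ]
    push_cast
    rw [mul_comm]; rfl
  have upn : ∀ (w : Lam K ((Fin d → K) × G)) (n : ℕ), Q n w = ((n.factorial : ℕ) : K) • Zop w →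
      ∀ m, n ≤ m → Q m w = ((m.factorial : ℕ) : K) • Zop w := by
    intro w n h m hm
    induction hm with
    | refl => exact h
    | step _ ih => exact up _ _ ih
  induction w using op_ind with
  | h1 => exact ⟨0, upn _ _ (by simp [Q, Z_one])⟩
  | hs c x h =>
    obtain ⟨n, hn⟩ := h
    exact ⟨n, fun m hm => by rw [map_smul, hn m hm, map_smul, smul_comm]⟩
  | ha x y hx hy =>
    obtain ⟨n, hn⟩ := hx
    obtain ⟨n', hn'⟩ := hy
    exact ⟨max n n', fun m hm => by
      rw [map_add, hn m (le_trans (le_max_left _ _) hm), hn' m (le_trans (le_max_right _ _) hm), map_add, smul_add]⟩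
  | he z w h =>
    obtain ⟨n, hn⟩ := h
    refine ⟨n + 1, upn _ _ ?_⟩
    have hz : z = (z.1, 0) + (0, z.2) := by ext <;> simp
    have h1 := LinearMap.congr_fun (Q_eV (G := G) (n + 1) z.1) w
    have h2 := LinearMap.congr_fun (Q_eG (d := d) (K := K) n z.2) w
    have h3 := LinearMap.congr_fun (NG_Z (K := K) (G := G) (d := d)) w
    have h4 := LinearMap.congr_fun (Z_e z) w
    simp only [Module.End.mul_apply, LinearMap.zero_apply, LinearMap.neg_apply] at h1 h2 h3 h4
    rw [h4, hz, e_add, LinearMap.add_apply, map_add, h1, h2, hn n le_rfl, hn (n + 1) (by omega)]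
    simp only [map_smul, h3, smul_zero, map_zero, neg_zero, add_zero, PV_apply]
    simp

/-- bihomogeneous pieces without pure `V` part -/
def B (q : ℤ) (r : ℕ) : Submodule K (Lam K ((Fin d → K) × G)) :=
  LinearMap.ker (NV - (q : K) • 1) ⊓ LinearMap.ker (NG - (r : K) • 1) ⊓ LinearMap.ker Zop

lemma mem_B {q : ℤ} {r : ℕ} {w : Lam K ((Fin d → K) × G)} :
    w ∈ B q r ↔ NV w = (q : K) • w ∧ NG w = (r : K) • w ∧ Zop w = 0 := by
  simp [B, sub_eq_zero, and_assoc]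

lemma B_zero [Algebra ℚ K] {q : ℤ} {w : Lam K ((Fin d → K) × G)} (hw : w ∈ B q 0) : w = 0 := by
  obtain ⟨-, h2, h3⟩ := mem_B.1 hw
  have h4 : ∀ m, Q m w = ((m.factorial : ℕ) : K) • w := by
    intro m
    induction m with
    | zero => simp [Q]
    | succ m ih =>
      rw [Q_succ, Module.End.mul_apply, ih, map_smul, LinearMap.sub_apply, h2, Nat.factorial_succ]
      simp [smul_smul, mul_comm]
  obtain ⟨n, hn⟩ := Q_Z w
  have h5 := hn n le_rfl
  rw [h4, h3, smul_zero] at h5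
  exact (unit_nat (K := K) (Nat.factorial_ne_zero n)).smul_eq_zero.1 h5

lemma NV_comm (f : Module.End K G) : (NV * der (P0 f) : Op K ((Fin d → K) × G)) = der (P0 f) * NV := by
  rw [NV, ← sub_eq_zero, der_comm, ← der_zero]; congr 1
  refine LinearMap.ext fun z => ?_
  simp [PV_apply, P0_apply]
lemma NG_comm (f : Module.End K G) : (NG * der (P0 f) : Op K ((Fin d → K) × G)) = der (P0 f) * NG := by
  rw [NG, ← sub_eq_zero, der_comm, ← der_zero]; congr 1
  refine LinearMap.ext fun z => ?_
  simp [P0_apply]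
lemma NV_E (i : Fin d) : (NV * E i : Op K ((Fin d → K) × G)) = E i * NV + E i := der_e _ _
lemma NG_E (i : Fin d) : (NG * E i : Op K ((Fin d → K) × G)) = E i * NG := by
  rw [E, NG_e, P0_apply]
  simp only [bv, map_zero]
  rw [show ((0 : Fin d → K), (0 : G)) = 0 from rfl, e_zero, add_zero]
lemma NV_gam (i : Fin d) : NV * bd (A.gam i) (A.gam_alt i) = bd (A.gam i) (A.gam_alt i) * NV := by
  rw [NV, ← sub_eq_zero, der_bd, bd_congr _ (γ := 0) (by simp), bd_zero]
  intro x y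
  simp [actE_apply _ (A.gam i), gam_apply, PV_apply]
lemma NG_gam (i : Fin d) : NG * bd (A.gam i) (A.gam_alt i) = bd (A.gam i) (A.gam_alt i) * NG
    - bd (A.gam i) (A.gam_alt i) := by
  have h := der_bd (P0 (1 : Module.End K G)) (A.gam i) (A.gam_alt i)
  rw [bd_congr (actE_alt _ (A.gam_alt i)) (γ := (-1 : K) • A.gam i) (by simp [A.gam_alt]), bd_smul (hβ := A.gam_alt i), neg_one_smul] at h
  · rw [NG]; linear_combination (norm := noncomm_ring) h
  · intro x y
    simp [actE_apply _ (A.gam i), gam_apply, P0_apply]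
lemma NV_R : NV * A.R = A.R * NV + A.R := by
  rw [R, Finset.mul_sum, Finset.sum_mul, ← Finset.sum_add_distrib]
  refine Finset.sum_congr rfl fun i _ => ?_
  linear_combination (norm := noncomm_ring) NV_E (K := K) (G := G) i * bd (A.gam i) (A.gam_alt i) + E (K := K) (G := G) i * A.NV_gam i
lemma NG_R : NG * A.R = A.R * NG - A.R := by
  rw [R, Finset.mul_sum, Finset.sum_mul, ← Finset.sum_sub_distrib]
  refine Finset.sum_congr rfl fun i _ => ?_
  linear_combination (norm := noncomm_ring) NG_E (K := K) (G := G) i * bd (A.gam i) (A.gam_alt i) + E (K := K) (G := G) i * A.NG_gam i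

lemma B_der (f : Module.End K G) {q : ℤ} {r : ℕ} {w : Lam K ((Fin d → K) × G)} (hw : w ∈ B q r) :
    der (P0 f) w ∈ B q r := by
  rw [mem_B] at hw ⊢
  have h1 := LinearMap.congr_fun (NV_comm (d := d) f) w
  have h2 := LinearMap.congr_fun (NG_comm (d := d) f) w
  have h3 := LinearMap.congr_fun (Z_der (f := P0 (d := d) f) (by intro z; simp [P0_apply, PV_apply])) w
  simp only [Module.End.mul_apply, LinearMap.zero_apply] at h1 h2 h3
  rw [h1, h2, h3, hw.1, hw.2.1]
  simp

lemma B_R {q : ℤ} {r : ℕ} {w : Lam K ((Fin d → K) × G)} (hw : w ∈ B q (r + 1)) : A.R w ∈ B (q + 1) r := by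
  rw [mem_B] at hw ⊢
  have h1 := LinearMap.congr_fun A.NV_R w
  have h2 := LinearMap.congr_fun A.NG_R w
  have h3 := LinearMap.congr_fun A.Z_R w
  simp only [Module.End.mul_apply, LinearMap.zero_apply, LinearMap.add_apply, LinearMap.sub_apply] at h1 h2 h3
  rw [h1, h2, h3, hw.1, hw.2.1]
  refine ⟨?_, ?_, rfl⟩
  · push_cast; rw [add_smul, one_smul, map_smul]
  · push_cast; rw [map_smul, add_smul, one_smul, add_sub_cancel_right]

lemma B_E (i : Fin d) {q : ℤ} {r : ℕ} {w : Lam K ((Fin d → K) × G)} (hw : w ∈ B q r) : E i w ∈ B (q + 1) r := by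
  rw [mem_B] at hw ⊢
  have h1 := LinearMap.congr_fun (NV_E (G := G) i) w
  have h2 := LinearMap.congr_fun (NG_E (G := G) i) w
  have h3 := LinearMap.congr_fun (Z_E (G := G) i) w
  simp only [Module.End.mul_apply, LinearMap.zero_apply, LinearMap.add_apply, LinearMap.sub_apply] at h1 h2 h3
  rw [h1, h2, h3, hw.1, hw.2.1, hw.2.2]
  refine ⟨?_, ?_, by simp⟩
  · push_cast; rw [add_smul, one_smul, map_smul]
  · rw [map_smul]

lemma B_s0 {q : ℤ} {r : ℕ} {w : Lam K ((Fin d → K) × G)} (hw : w ∈ B q r) : A.s0 w ∈ B (q + 1) r := by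
  rw [s0, LinearMap.sum_apply]
  exact sum_mem fun i _ => B_E i (B_der _ hw)

lemma B_EE {q : ℤ} {r : ℕ} {w : Lam K ((Fin d → K) × G)} (hw : w ∈ B q r) : A.EE w ∈ B q r := by
  rw [EE, LinearMap.sum_apply]
  exact sum_mem fun i _ => B_der _ (B_der _ hw)

/-! local nilpotency -/
lemma Fil_e {a b : ℕ} {z : (Fin d → K) × G} {w : Lam K ((Fin d → K) × G)}
    (hz : z ∈ Fil (fun i => P0 (A.pd i)) a) (hw : w ∈ Fil A.Lx b) : e z w ∈ Fil A.Lx (a + b) := by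
  induction hn : a + b generalizing a b z w with
  | zero =>
    have : a = 0 := by omega
    subst this
    rw [Fil_zero] at hz; subst hz; rw [e_zero]; exact zero_mem _
  | succ n ih =>
    rw [Fil_succ]
    intro i
    have h1 : A.Lx i (e z w) = e z (A.Lx i w) + e (P0 (A.pd i) z) w := LinearMap.congr_fun (der_e (P0 (A.pd i)) z) w
    rw [h1]
    rcases a with _ | a
    · rw [Fil_zero] at hz; subst hz; rw [map_zero, e_zero]; simp
    rcases b with _ | b
    · rw [Fil_zero] at hw; subst hw; simp
    refine add_mem (ih (b := b) hz ?_ (by omega)) (ih (a := a) ?_ hw (by omega))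
    · exact Fil_succ.1 hw i
    · exact Fil_succ.1 hz i

lemma Fil_G {k : ℕ} {x : G} (hx : x ∈ Fil A.pd k) : ((0 : Fin d → K), x) ∈ Fil (fun i => P0 (d := d) (A.pd i)) k := by
  induction k generalizing x with
  | zero => rw [Fil_zero] at hx ⊢; rw [hx]; rfl
  | succ k ih =>
    rw [Fil_succ] at hx ⊢
    intro i
    exact ih (hx i)

lemma Fil_ex (w : Lam K ((Fin d → K) × G)) : ∃ k, w ∈ Fil A.Lx k := by
  induction w using op_ind with
  | h1 =>
    refine ⟨1, Fil_succ.2 fun i => ?_⟩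
    rw [Lx, der_one]; exact zero_mem _
  | hs c x h =>
    obtain ⟨k, hk⟩ := h
    exact ⟨k, Submodule.smul_mem _ _ hk⟩
  | ha x y hx hy =>
    obtain ⟨n, hn⟩ := hx
    obtain ⟨n', hn'⟩ := hy
    exact ⟨max n n', add_mem (Fil_mono' (le_max_left _ _) hn) (Fil_mono' (le_max_right _ _) hn')⟩
  | he z w h =>
    obtain ⟨b, hb⟩ := h
    obtain ⟨k, hk⟩ := A.nil z.2
    refine ⟨(k + 1) + b, A.Fil_e ?_ hb⟩
    rw [Fil_succ]
    intro i
    have : z.2 ∈ Fil A.pd (k + 1) := Fil_mono hk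
    exact A.Fil_G (Fil_succ.1 this i)

lemma Lx_EE (j : Fin d) : A.Lx j * A.EE = A.EE * A.Lx j + NG * A.Lx j := by
  rw [EE, Finset.mul_sum, Finset.sum_mul]
  have hc : ∀ i, A.Lx j * A.Lx i = A.Lx i * A.Lx j := by
    intro i
    rw [Lx, Lx, ← sub_eq_zero, der_comm, P0_mul, P0_mul, A.pd_comm, sub_self, der_zero]
  have : ∀ i, A.Lx j * (A.Mx i * A.Lx i) = A.Mx i * A.Lx i * A.Lx j + if j = i then NG * A.Lx i else 0 := by
    intro i
    rw [← mul_assoc, Lx_Mx, add_mul, mul_assoc, hc, ← mul_assoc]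
    split_ifs <;> simp
  simp only [this, Finset.sum_add_distrib]
  simp

lemma Fil_EE {k r : ℕ} {q : ℤ} {w : Lam K ((Fin d → K) × G)} (hw : w ∈ Fil A.Lx (k + 1)) (hB : w ∈ B q r) :
    A.EE w - ((r * k : ℕ) : K) • w ∈ Fil A.Lx k := by
  induction k generalizing w with
  | zero =>
    rw [Fil_succ] at hw
    simp only [Fil_zero] at hw ⊢
    simp [EE, LinearMap.sum_apply, hw]
  | succ k ih =>
    rw [Fil_succ]
    intro j
    have h1 := LinearMap.congr_fun (A.Lx_EE j) w
    have h2 := (mem_B.1 (B_der (A.pd j) hB)).2.1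
    simp only [Module.End.mul_apply, LinearMap.add_apply] at h1
    change NG (A.Lx j w) = _ • A.Lx j w at h2
    have h3 := ih (Fil_succ.1 hw j) (B_der (A.pd j) hB)
    rw [map_sub, h1, h2, map_smul]
    convert h3 using 1
    push_cast
    simp only [mul_add, add_smul, mul_one]
    abel

lemma B_Good [Algebra ℚ K] {q : ℤ} {r : ℕ} (h : q + r ≤ d) : (B q r : Submodule K (Lam K ((Fin d → K) × G))) ≤ Good A.WW := by
  induction r generalizing q with
  | zero => intro w hw; rw [B_zero hw]; exact zero_mem _
  | succ r ih =>
    intro w hw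
    obtain ⟨k, hk⟩ := A.Fil_ex w
    induction k generalizing w with
    | zero => rw [Fil_zero] at hk; subst hk; exact zero_mem _
    | succ k ihk =>
      have hu : IsUnit ((((r + 1 : ℕ) * (d - q + k) : ℤ)) : K) := by
        apply unit_int
        push_cast at h
        apply mul_ne_zero
        · push_cast; omega
        · omega
      apply Good_step hu
      obtain ⟨h1, h2, h3⟩ := mem_B.1 hw
      have h4 : A.WW w = A.EE w + (d : K) • NG w - NV (NG w) + A.R w := by
        rw [WW_eq]; rfl
      have h5 : A.WW w - (((r + 1 : ℕ) * (d - q + k) : ℤ) : K) • w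
          = (A.EE w - (((r + 1) * k : ℕ) : K) • w) + A.R w := by
        rw [h4, h2, map_smul, h1]
        push_cast
        module
      rw [h5]
      refine add_mem (ihk ?_ ?_) (ih (q := q + 1) ?_ (A.B_R hw))
      · exact sub_mem (A.B_EE hw) (Submodule.smul_mem _ _ hw)
      · exact A.Fil_EE hk hw
      · push_cast at h; omega

end Heis
end heis3
end CW

namespace CW
section heis4
variable {K : Type*} [CommRing K] {G : Type*} [AddCommGroup G] [Module K G] {d : ℕ}

lemma lift_inv {N N' : Type*} [AddCommGroup N] [Module K N] [AddCommGroup N'] [Module K N']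
    (W : Module.End K N) (f : N' →ₗ[K] N) (hf : ∀ x, f x ∈ Good W) :
    ∃ g : N' →ₗ[K] N, (∀ x, g x ∈ Good W) ∧ (∀ x, W (g x) = f x) ∧
      ∀ x, ∃ P : Polynomial K, g x = Polynomial.aeval W P (f x) := by
  obtain ⟨g, h1, h2, -, h4⟩ := Good_inv (W := W)
  exact ⟨g ∘ₗ f.codRestrict _ hf, fun x => h1 _, fun x => h2 _, fun x => h4 _⟩

lemma Good_inj {N : Type*} [AddCommGroup N] [Module K N] {W : Module.End K N} {x y : N} (hx : x ∈ Good W)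
    (hy : y ∈ Good W) (h : W x = W y) : x = y := by
  obtain ⟨g, h1, h2, h3, h4⟩ := Good_inv (W := W)
  have hm : W (x - y) ∈ Good W := by rw [map_sub, h, sub_self]; exact zero_mem _
  have h5 := h3 (x - y) hm (sub_mem hx hy)
  have h6 : (⟨W (x - y), hm⟩ : Good W) = 0 := Subtype.ext (by change W (x - y) = 0; rw [map_sub, h, sub_self])
  rw [h6, map_zero] at h5
  exact (sub_eq_zero.1 h5.symm)

lemma Dg_of_eig {M : Type*} [AddCommGroup M] [Module K M] [Algebra ℚ K] {p : ℕ} {w : Lam K M}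
    (h : der 1 w = (p : K) • w) : w ∈ Dg K M p := by
  obtain ⟨n, hn⟩ := sum_pj w
  have h1 := hn n le_rfl
  have key : ∀ r, r ≠ p → pj r w = 0 := by
    intro r hr
    have h2 : pj r (der 1 w) = (r : K) • pj r w := by
      rcases Nat.lt_or_ge r n with hrn | hrn
      · conv_lhs => rw [h1]
        rw [map_sum, map_sum, Finset.sum_eq_single r]
        · rw [der_id (pj_mem r w), map_smul, pj_same (pj_mem r w)]
        · intro b _ hb
          rw [der_id (pj_mem b w), map_smul, pj_ne hb.symm (pj_mem b w), smul_zero]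
        · intro hh; simp [hrn] at hh
      · have : pj r w = 0 := by
          rw [h1, map_sum]
          refine Finset.sum_eq_zero fun b hb => pj_ne ?_ (pj_mem b w)
          simp at hb; omega
        rw [this, h, map_smul, this]; simp
    rw [h, map_smul] at h2
    have h3 : (((r : ℤ) - (p : ℤ) : ℤ) : K) • pj r w = 0 := by
      push_cast; rw [sub_smul, h2, sub_self]
    exact (unit_int (K := K) (by omega)).smul_eq_zero.1 h3
  rw [h1]
  refine sum_mem fun r _ => ?_
  by_cases hr : r = p
  · subst hr; exact pj_mem _ _
  · rw [key r hr]; exact zero_mem _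

namespace Heis
variable (A : Heis K G d)

/-- total degree pieces -/
def Tp (p : ℤ) : Submodule K (Lam K ((Fin d → K) × G)) := ⨆ q : ℤ, ⨆ r : ℕ, ⨆ _ : q + r = p, B q r

lemma B_le_Tp {q : ℤ} {r : ℕ} {p : ℤ} (h : q + r = p) : (B q r : Submodule K (Lam K ((Fin d → K) × G))) ≤ Tp p :=
  le_iSup_of_le q (le_iSup_of_le r (le_iSup_of_le h le_rfl))

lemma Tp_le {p : ℤ} {S : Submodule K (Lam K ((Fin d → K) × G))} (h : ∀ (q : ℤ) (r : ℕ), q + (r : ℤ) = p → B q r ≤ S) : Tp p ≤ S :=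
  iSup_le fun q => iSup_le fun r => iSup_le fun hh => h q r hh

lemma Tp_Good [Algebra ℚ K] {p : ℤ} (h : p ≤ d) : (Tp p : Submodule K (Lam K ((Fin d → K) × G))) ≤ Good A.WW :=
  Tp_le fun q r hh => A.B_Good (by omega)

lemma Tp_s0 {p p' : ℤ} (hp : p' = p + 1) {w : Lam K ((Fin d → K) × G)} (hw : w ∈ Tp p) : A.s0 w ∈ Tp p' := by
  have : (Tp p : Submodule K (Lam K ((Fin d → K) × G))) ≤ (Tp p').comap A.s0 :=
    Tp_le fun q r hh w hw => B_le_Tp (by omega) (A.B_s0 hw)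
  exact this hw

lemma Tp_WW [Algebra ℚ K] {p : ℤ} {w : Lam K ((Fin d → K) × G)} (hw : w ∈ Tp p) : A.WW w ∈ Tp p := by
  have : (Tp p : Submodule K (Lam K ((Fin d → K) × G))) ≤ (Tp p).comap A.WW := by
    refine Tp_le fun q r hh w hw => ?_
    obtain ⟨h1, h2, h3⟩ := mem_B.1 hw
    have h4 : A.WW w = A.EE w + (d : K) • NG w - NV (NG w) + A.R w := by
      rw [WW_eq]; rfl
    rw [Submodule.mem_comap, h4, h2, map_smul, h1]
    refine add_mem (B_le_Tp hh (sub_mem (add_mem (A.B_EE hw) ?_) ?_)) ?_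
    · exact Submodule.smul_mem _ _ (Submodule.smul_mem _ _ hw)
    · exact Submodule.smul_mem _ _ (Submodule.smul_mem _ _ hw)
    · rcases r with _ | r
      · rw [B_zero hw, map_zero]; exact zero_mem _
      · exact B_le_Tp (by push_cast at hh ⊢; omega) (A.B_R hw)
  exact this hw

lemma Tp_der {p : ℤ} {w : Lam K ((Fin d → K) × G)} (hw : w ∈ Tp p) : der 1 w = (p : K) • w := by
  have h0 : (der 1 : Op K ((Fin d → K) × G)) = NV + NG := by
    rw [NV, NG, ← der_add]; congr 1
    refine LinearMap.ext fun z => ?_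
    simp [PV_apply, P0_apply]
  have : (Tp p : Submodule K (Lam K ((Fin d → K) × G))) ≤ LinearMap.ker (der 1 - (p : K) • 1) := by
    refine Tp_le fun q r hh w hw => ?_
    obtain ⟨h1, h2, h3⟩ := mem_B.1 hw
    rw [LinearMap.mem_ker, LinearMap.sub_apply, h0, LinearMap.add_apply, h1, h2, ← hh]
    push_cast
    rw [LinearMap.smul_apply, add_smul]; simp
  have h := this hw
  rw [LinearMap.mem_ker, LinearMap.sub_apply, sub_eq_zero] at h
  exact h

/-- the symplectic form on the `V` part -/
def wf : ((Fin d → K) × G) →ₗ[K] Module.Dual K ((Fin d → K) × G) :=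
  ∑ i, ∑ j, A.w i j • (cV i).smulRight (cV j)

lemma wf_apply (z z' : (Fin d → K) × G) : A.wf z z' = ∑ i, ∑ j, A.w i j * (z.1 i * z'.1 j) := by
  simp [wf, LinearMap.sum_apply, cV_apply]

lemma wf_one (z z' : (Fin d → K) × G) : A.wf z z' • A.one = A.br (A.yV z.1) (A.yV z'.1) := by
  simp only [wf_apply, yV_apply, map_sum, LinearMap.sum_apply, map_smul, LinearMap.smul_apply, A.br_yy,
    Finset.sum_smul, Finset.smul_sum, smul_smul]
  rw [Finset.sum_comm]
  refine Finset.sum_congr rfl fun i _ => Finset.sum_congr rfl fun j _ => ?_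
  congr 1; ring

lemma wf_alt (z) : A.wf z z = 0 := A.tf _ (by rw [wf_one, A.alt])

def Om : Op K ((Fin d → K) × G) := om A.wf A.wf_alt

lemma wf_P0 {z z' : (Fin d → K) × G} (h : z.1 = 0) : A.wf z z' = 0 := by simp [wf_apply, h]
lemma wf_P0' {z z' : (Fin d → K) × G} (h : z'.1 = 0) : A.wf z z' = 0 := by simp [wf_apply, h]

lemma D_Om : A.D * A.Om = A.Om * A.D := by
  rw [← sub_eq_zero]
  apply op_anti0
  · simp [D, Om, om_one, bd_one]
  · intro z
    have h1 := om_e A.wf A.wf_alt z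
    have h2 := bd_e A.br' A.alt' z
    have hz : ∀ x y, ((LinearMap.llcomp K _ _ K (A.wf z)) ∘ₗ A.br') x y = 0 := by
      intro x y; exact A.wf_P0' (by rw [br'_apply])
    have h3 := bd_ct A.br' A.alt' (A.wf z) (by intro x; exact hz x x)
    have h4 := der_om (A.br' z) A.wf A.wf_alt
    rw [om_congr _ (γ := 0) (by simp), om_zero] at h3
    · rw [om_congr (actD_alt _ A.wf_alt) (γ := 0) (by simp), om_zero] at h4
      · rw [D, Om]
        linear_combination (norm := noncomm_ring) bd A.br' A.alt' * h1 + h2 * om A.wf A.wf_alt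
          - om A.wf A.wf_alt * h2 + h1 * bd A.br' A.alt' + h3 + h4
      · intro x y
        rw [actD_apply, A.wf_P0 (by rw [br'_apply]), A.wf_P0' (by rw [br'_apply])]; simp
    · intro x y; exact hz x y

lemma Z_Om : Zop * A.Om = A.Om * Zop := by
  apply op_eqOn
  · simp [Om, om_one, Z_one]
  · intro z w hw
    have h1 := LinearMap.congr_fun (om_e A.wf A.wf_alt z) w
    have h2 := LinearMap.congr_fun (om_e A.wf A.wf_alt (PV z)) (Zop w)
    have h3 := LinearMap.congr_fun (Z_e z) w
    have h4 := LinearMap.congr_fun (Z_e z) (A.Om w)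
    have h5 : A.wf (PV z) = A.wf z := by
      refine LinearMap.ext fun z' => ?_
      simp [wf_apply, PV_apply]
    have h6 : ∀ w, Zop (ct (A.wf z) w) = ct (A.wf z) (Zop w) := by
      have : Zop * ct (A.wf z) = ct (A.wf z) * Zop := by
        apply op_eqOn
        · simp [ct_one, Z_one]
        · intro x w hw
          have h1 := LinearMap.congr_fun (ct_e (A.wf z) x) w
          have h2 := LinearMap.congr_fun (ct_e (A.wf z) (PV x)) (Zop w)
          have h3 := LinearMap.congr_fun (Z_e x) w
          have h4 := LinearMap.congr_fun (Z_e x) (ct (A.wf z) w)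
          have h5 : A.wf z (PV x) = A.wf z x := by
            simp [wf_apply, PV_apply]
          simp only [Module.End.mul_apply, LinearMap.add_apply, LinearMap.smul_apply, Module.End.one_apply] at h1 h2 h3 h4 hw ⊢
          rw [← eq_sub_iff_add_eq] at h1 h2
          rw [h1, h3, h2, map_sub, h4, hw, h5, map_smul]
      exact fun w => LinearMap.congr_fun this w
    simp only [Module.End.mul_apply, LinearMap.add_apply] at h1 h2 h3 h4 hw ⊢
    change A.Om _ = e z (A.Om w) + _ at h1
    change A.Om _ = e _ (A.Om _) + _ at h2
    rw [h1, map_add, h4, h3, h2, hw, h5, h6]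

lemma om_smul' {M : Type*} [AddCommGroup M] [Module K M] (β : M →ₗ[K] M →ₗ[K] K) (hβ : ∀ x, β x x = 0)
    {c : K} {h : ∀ x, (c • β) x x = 0} : om (c • β) h = c • om β hβ := by
  symm
  refine om_uniq h ?_ fun x => ?_
  · rw [LinearMap.smul_apply, om_one, smul_zero]
  · rw [LinearMap.smul_apply, ct_smul, smul_mul_assoc, om_e β hβ x, mul_smul_comm, smul_add]

lemma NV_Om : NV * A.Om = A.Om * NV - (2 : K) • A.Om := by
  have h := der_om PV A.wf A.wf_alt
  rw [om_congr (actD_alt _ A.wf_alt) (γ := (-2 : K) • A.wf) (by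
    intro x; rw [LinearMap.smul_apply, LinearMap.smul_apply, A.wf_alt, smul_zero])] at h
  · rw [om_smul' A.wf A.wf_alt] at h
    rw [neg_smul, sub_eq_iff_eq_add] at h
    rw [NV, Om, h]; abel
  · intro x z'
    have e1 : A.wf (PV x) z' = A.wf x z' := by simp only [wf_apply, PV_apply]
    have e2 : A.wf x (PV z') = A.wf x z' := by simp only [wf_apply, PV_apply]
    rw [actD_apply, e1, e2, LinearMap.smul_apply, LinearMap.smul_apply, smul_eq_mul]; ring

lemma NG_Om : NG * A.Om = A.Om * NG := by
  have h := der_om (P0 (1 : Module.End K G)) A.wf A.wf_alt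
  rw [om_congr (actD_alt _ A.wf_alt) (γ := 0) (by simp), om_zero] at h
  · exact sub_eq_zero.1 h
  · intro x y; simp [actD_apply, wf_apply, P0_apply]

lemma Tp_Om {p p' : ℤ} (hp : p' = p - 2) {w : Lam K ((Fin d → K) × G)} (hw : w ∈ Tp p) : A.Om w ∈ Tp p' := by
  have : (Tp p : Submodule K (Lam K ((Fin d → K) × G))) ≤ (Tp p').comap A.Om := by
    refine Tp_le fun q r hh w hw => B_le_Tp (q := q - 2) (r := r) (by omega) ?_
    rw [mem_B] at hw ⊢
    have h1 := LinearMap.congr_fun A.NV_Om w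
    have h2 := LinearMap.congr_fun A.NG_Om w
    have h3 := LinearMap.congr_fun A.Z_Om w
    simp only [Module.End.mul_apply, LinearMap.zero_apply, LinearMap.sub_apply, LinearMap.smul_apply] at h1 h2 h3
    rw [h1, h2, h3, hw.1, hw.2.1, hw.2.2]
    refine ⟨?_, ?_, by simp⟩
    · push_cast; rw [map_smul, sub_smul]
    · rw [map_smul]
  exact this hw

/-- inclusion of `G` -/
def inG : G →ₗ[K] (Fin d → K) × G := LinearMap.inr K _ _
lemma inG_apply (x : G) : inG x = ((0 : Fin d → K), x) := rfl

def J0 : Lam K G →ₗ[K] Lam K ((Fin d → K) × G) := mp inG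

lemma J0_Tp {p : ℕ} (hp : 1 ≤ p) {w : Lam K G} (hw : w ∈ Dg K G p) : (J0 w : Lam K ((Fin d → K) × G)) ∈ Tp (p : ℤ) := by
  refine B_le_Tp (q := 0) (r := p) (by simp) (mem_B.2 ⟨?_, ?_, ?_⟩)
  · have h := mp_der (inG (d := d) (K := K) (G := G)) 0 PV (by intro x; rfl) w
    rw [der_zero] at h
    simp only [LinearMap.zero_apply, map_zero] at h
    rw [NV, J0, ← h]; simp
  · have h := mp_der (inG (d := d) (K := K) (G := G)) 1 (P0 1) (by intro x; rfl) w
    rw [NG, J0, ← h, der_id hw, map_smul]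
  · obtain ⟨p, rfl⟩ : ∃ k, p = k + 1 := ⟨p - 1, by omega⟩
    have : Dg K G (p + 1) ≤ LinearMap.ker (Zop ∘ₗ (J0 : Lam K G →ₗ[K] Lam K ((Fin d → K) × G))) := by
      refine Dg_succ_le fun x w _ => ?_
      have h3 := LinearMap.congr_fun (Z_e (inG (d := d) (K := K) x)) (J0 w)
      simp only [Module.End.mul_apply] at h3
      rw [LinearMap.mem_ker, LinearMap.comp_apply, J0, mp_e]
      rw [J0] at h3
      rw [h3, show PV (inG x) = (0 : (Fin d → K) × G) from rfl, e_zero]; rfl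
    exact this hw

lemma J0_D (w : Lam K G) : A.D (J0 w) = J0 (bd A.br A.alt w) := by
  have : A.D ∘ₗ J0 = J0 ∘ₗ bd A.br A.alt := by
    apply op_eqOn
    · simp [J0, mp_one, D, bd_one]
    · intro x w hw
      have h1 := LinearMap.congr_fun (bd_e A.br A.alt x) w
      have h2 := LinearMap.congr_fun (bd_e A.br' A.alt' (inG x)) (mp inG w)
      have h3 := mp_der (inG (d := d) (K := K) (G := G)) (A.br x) (A.br' (inG x))
        (by intro z; rw [inG_apply, inG_apply, inG_apply, br'_apply]; simp) w
      simp only [Module.End.mul_apply, LinearMap.add_apply, LinearMap.comp_apply, LinearMap.neg_apply, J0, D] at h1 h2 hw ⊢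
      rw [mp_e, h2, hw, h1, map_add, map_neg, mp_e, h3]
  exact LinearMap.congr_fun this w

lemma J0_Om (w : Lam K G) : A.Om (J0 w) = 0 := by
  have : A.Om ∘ₗ J0 = 0 := by
    apply op_eqOn
    · simp [J0, mp_one, Om, om_one]
    · intro x w hw
      have h2 := LinearMap.congr_fun (om_e A.wf A.wf_alt (inG x)) (mp inG w)
      have h3 : A.wf (inG x) = 0 := by
        refine LinearMap.ext fun z' => ?_
        exact A.wf_P0 rfl
      simp only [Module.End.mul_apply, LinearMap.add_apply, LinearMap.comp_apply, LinearMap.zero_apply, J0, Om] at h2 hw ⊢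
      rw [mp_e, h2, hw, h3, ct_zero]; simp
  exact LinearMap.congr_fun this w

/-- evaluation of the `V` part -/
def fV : ((Fin d → K) × G) →ₗ[K] G := LinearMap.coprod A.yV LinearMap.id
lemma fV_apply (z) : A.fV z = A.yV z.1 + z.2 := rfl
def rho : Lam K ((Fin d → K) × G) →ₗ[K] Lam K G := mp A.fV

lemma rho_J0 (w : Lam K G) : A.rho (J0 w) = w := by
  have : A.rho ∘ₗ J0 = LinearMap.id := by
    apply op_eqOn
    · simp [J0, rho, mp_one]
    · intro x w hw
      simp only [LinearMap.comp_apply, LinearMap.id_apply, rho, J0] at hw ⊢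
      rw [mp_e, mp_e, hw, fV_apply, inG_apply]; simp
  exact LinearMap.congr_fun this w

lemma rho_D (w) : bd A.br A.alt (A.rho w) = A.rho (A.D w) + e A.one (A.rho (A.Om w)) := by
  have : bd A.br A.alt ∘ₗ A.rho = A.rho ∘ₗ A.D + e A.one ∘ₗ A.rho ∘ₗ A.Om := by
    apply op_eqOn
    · simp [rho, mp_one, bd_one, Om, om_one, D]
    · intro z w hw
      have h1 := LinearMap.congr_fun (bd_e A.br A.alt (A.fV z)) (A.rho w)
      have h2 := LinearMap.congr_fun (bd_e A.br' A.alt' z) w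
      have h3 := LinearMap.congr_fun (om_e A.wf A.wf_alt z) w
      have h4 := mp_der A.fV (A.br' z + (A.wf z).smulRight ((0 : Fin d → K), A.one)) (A.br (A.fV z)) (by
        intro z'
        simp only [LinearMap.add_apply, LinearMap.smulRight_apply, map_add, map_smul, br'_apply, fV_apply,
          map_zero, zero_add, wf_one, br_yV, pdV_apply]
        have : A.br z.2 (A.yV z'.1) = - A.pdV z'.1 z.2 := by rw [alt_swap A.alt, br_yV]
        rw [this]; simp [pdV_apply]; abel) w
      have h5 := LinearMap.congr_fun (e_anti (K := K) (A.fV z) A.one) (A.rho (A.Om w))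
      rw [der_add, ← der_rank1] at h4
      simp only [Module.End.mul_apply, LinearMap.add_apply, LinearMap.comp_apply, LinearMap.neg_apply,
        LinearMap.zero_apply, map_add] at h1 h2 h3 h4 h5 hw ⊢
      change A.D _ = _ + _ at h2
      change A.Om _ = e z (A.Om w) + _ at h3
      rw [mp_e, fV_apply] at h4
      simp only [map_zero, zero_add] at h4
      change bd A.br A.alt (e (A.fV z) (A.rho w)) = -(e (A.fV z) (bd A.br A.alt (A.rho w))) + _ at h1
      have h6 : ∀ w, A.rho (e z w) = e (A.fV z) (A.rho w) := fun w => mp_e _ _ _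
      rw [h6, h1, h2, h3, map_add, map_add, map_neg, map_add, h6, h6, hw, map_add]
      change A.rho _ + e A.one (A.rho _) = der _ (A.rho w) at h4
      rw [← h4]
      rw [eq_neg_of_add_eq_zero_right h5]
      change - (e (A.fV z) (A.rho (A.D w)) + _) + _ = -e (A.fV z) (A.rho (A.D w)) + _ + _
      abel
  exact LinearMap.congr_fun this w

/-- elements whose adjoint action is compatible with the Heisenberg data -/
def IsInv (x : G) : Prop := ∃ a : Fin d → Fin d → K, (∀ j, A.br x (A.y j) = ∑ i, a i j • A.y i) ∧
  ∀ i, A.br x * A.mu i = A.mu i * A.br x - ∑ j, a i j • A.mu j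

end Heis
end heis4
end CW

namespace CW
section heis5
variable {K : Type*} [CommRing K] {G : Type*} [AddCommGroup G] [Module K G] {d : ℕ}

lemma pj_der (f : Module.End K G) (p : ℕ) (w : Lam K G) : pj p (der f w) = der f (pj p w) := by
  have : (pj p * der f : Op K G) = der f * pj p := by
    refine op_eq_of_Dg fun q w hw => ?_
    simp only [Module.End.mul_apply]
    by_cases h : p = q
    · subst h; rw [pj_same hw, pj_same (der_mem f hw)]
    · rw [pj_ne h hw, pj_ne h (der_mem f hw), map_zero]
  exact LinearMap.congr_fun this w

namespace Heis
variable (A : Heis K G d)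

def Jd : Lam K G →ₗ[K] Lam K ((Fin d → K) × G) := J0 ∘ₗ ∑ p ∈ Finset.Icc 1 d, pj p

lemma Jd_in {p : ℕ} (h1 : 1 ≤ p) (h2 : p ≤ d) {w : Lam K G} (hw : w ∈ Dg K G p) : Jd (d := d) w = J0 w := by
  rw [Jd, LinearMap.comp_apply, LinearMap.sum_apply, Finset.sum_eq_single p, pj_same hw]
  · intro b _ hb; exact pj_ne hb hw
  · intro h; exact absurd (Finset.mem_Icc.2 ⟨h1, h2⟩) h

lemma Jd_out {p : ℕ} (h : ¬ (1 ≤ p ∧ p ≤ d)) {w : Lam K G} (hw : w ∈ Dg K G p) : Jd (d := d) w = 0 := by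
  rw [Jd, LinearMap.comp_apply, LinearMap.sum_apply, Finset.sum_eq_zero, map_zero]
  intro b hb
  refine pj_ne ?_ hw
  rintro rfl
  exact h (Finset.mem_Icc.1 hb)

lemma Jd_Tp {p : ℕ} {w : Lam K G} (hw : w ∈ Dg K G p) : Jd (d := d) w ∈ Tp (p : ℤ) := by
  by_cases h : 1 ≤ p ∧ p ≤ d
  · rw [Jd_in h.1 h.2 hw]; exact J0_Tp h.1 hw
  · rw [Jd_out h hw]; exact zero_mem _

lemma mem_of_pj {N : Type*} [AddCommGroup N] [Module K N] (f : Lam K G →ₗ[K] N) (S : Submodule K N)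
    (h : ∀ p, ∀ w ∈ Dg K G p, f w ∈ S) (w : Lam K G) : f w ∈ S := by
  obtain ⟨n, hn⟩ := sum_pj w
  rw [hn n le_rfl, map_sum]
  exact sum_mem fun p _ => h p _ (pj_mem p w)

lemma Jd_Good [Algebra ℚ K] (w : Lam K G) : Jd (d := d) w ∈ Good A.WW := by
  refine mem_of_pj _ _ (fun p w hw => ?_) w
  by_cases h : 1 ≤ p ∧ p ≤ d
  · exact A.Tp_Good (by exact_mod_cast h.2) (Jd_Tp hw)
  · rw [Jd_out h hw]; exact zero_mem _

lemma WW_D : Commute A.WW A.D := by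
  have h := A.D_sq
  rw [commute_iff_eq, WW]
  linear_combination (norm := noncomm_ring) A.s0 * h - h * A.s0

section inv
variable {A} {x : G} {a : Fin d → Fin d → K}

def aV (a : Fin d → Fin d → K) : Module.End K (Fin d → K) := LinearMap.pi fun i => ∑ j, a i j • LinearMap.proj j
lemma aV_apply (v : Fin d → K) (i) : aV a v i = ∑ j, a i j * v j := by simp [aV, LinearMap.sum_apply]

def lx (A : Heis K G d) (x : G) (a : Fin d → Fin d → K) : Module.End K ((Fin d → K) × G) := LinearMap.prodMap (aV a) (A.br x)
lemma lx_apply (z) : lx A x a z = (aV a z.1, A.br x z.2) := rfl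

lemma yV_aV (h1 : ∀ j, A.br x (A.y j) = ∑ i, a i j • A.y i) (v) : A.yV (aV a v) = A.br x (A.yV v) := by
  simp only [yV_apply, map_sum, map_smul, h1, aV_apply, Finset.sum_smul, Finset.smul_sum, smul_smul]
  rw [Finset.sum_comm]
  refine Finset.sum_congr rfl fun i _ => Finset.sum_congr rfl fun j _ => ?_
  rw [mul_comm]

lemma pdV_aV (h1 : ∀ j, A.br x (A.y j) = ∑ i, a i j • A.y i) (v) (z : G) :
    A.pdV (aV a v) z = A.br x (A.pdV v z) - A.pdV v (A.br x z) := by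
  rw [← br_yV, ← br_yV, yV_aV h1, A.jac x (A.yV v) z]; abel

lemma lx_D (h1 : ∀ j, A.br x (A.y j) = ∑ i, a i j • A.y i) : der (lx A x a) * A.D = A.D * der (lx A x a) := by
  have h := der_bd (lx A x a) A.br' A.alt'
  rw [bd_congr (actE_alt _ A.alt') (γ := 0) (by simp), bd_zero] at h
  · exact sub_eq_zero.1 h
  · intro z z'
    rw [actE_apply]
    simp only [lx_apply, br'_apply]
    ext
    · simp
    · have h2 := A.jac x z.2 z'.2
      simp [pdV_aV h1, h2]; abel

lemma br_x_one : A.br x A.one = 0 := by rw [alt_swap A.alt, A.br_one]; simp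

lemma lx_Om (h1 : ∀ j, A.br x (A.y j) = ∑ i, a i j • A.y i) : der (lx A x a) * A.Om = A.Om * der (lx A x a) := by
  have h := der_om (lx A x a) A.wf A.wf_alt
  rw [om_congr (actD_alt _ A.wf_alt) (γ := 0) (by simp), om_zero] at h
  · exact sub_eq_zero.1 h
  · intro z z'
    rw [actD_apply]
    apply A.tf
    have h2 := A.jac x (A.yV z.1) (A.yV z'.1)
    have h3 := A.wf_one z z'
    rw [sub_smul, neg_smul, wf_one, wf_one, lx_apply, lx_apply, yV_aV h1, yV_aV h1]
    rw [← h3, map_smul, br_x_one, smul_zero] at h2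
    rw [← neg_add', ← h2, neg_zero]

lemma lx_s0 (h1 : ∀ j, A.br x (A.y j) = ∑ i, a i j • A.y i)
    (h2 : ∀ i, A.br x * A.mu i = A.mu i * A.br x - ∑ j, a i j • A.mu j) :
    der (lx A x a) * A.s0 = A.s0 * der (lx A x a) := by
  have hE : ∀ i, der (lx A x a) * E i = E i * der (lx A x a) + ∑ k, a k i • E k := by
    intro i
    rw [E, der_e]
    congr 1
    have : lx A x a (bv i) = ∑ k, a k i • bv k := by
      rw [lx_apply, bv]
      ext k
      · simp [aV_apply, bv, Pi.single_apply, Prod.fst_sum, Finset.sum_apply]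
      · simp [bv, Prod.snd_sum]
    rw [this, e_sum]
    simp only [e_smul, E]
  have hM : ∀ i, der (lx A x a) * A.Mx i = A.Mx i * der (lx A x a) - ∑ k, a i k • A.Mx k := by
    intro i
    have h := der_comm (lx A x a) (P0 (A.mu i))
    have : lx A x a * P0 (A.mu i) - P0 (A.mu i) * lx A x a = - ∑ k, a i k • P0 (A.mu k) := by
      refine LinearMap.ext fun z => ?_
      have := LinearMap.congr_fun (h2 i) z.2
      simp only [Module.End.mul_apply, LinearMap.sub_apply, LinearMap.sum_apply, LinearMap.smul_apply,
        LinearMap.neg_apply, lx_apply, P0_apply] at this ⊢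
      ext
      · simp [Prod.fst_sum]
      · simp [Prod.snd_sum, this]
    rw [this, der_neg, der_sum, sub_eq_iff_eq_add] at h
    simp only [der_smul] at h
    rw [Mx, h, neg_add_eq_sub]
    rfl
  rw [s0, Finset.mul_sum, Finset.sum_mul]
  have h3 : ∀ i, der (lx A x a) * (E i * A.Mx i) = E i * A.Mx i * der (lx A x a) - ∑ k, a i k • (E i * A.Mx k)
      + ∑ k, a k i • (E k * A.Mx i) := by
    intro i
    rw [← mul_assoc, hE, add_mul, mul_assoc, hM, mul_sub, Finset.mul_sum, Finset.sum_mul, mul_assoc]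
    simp only [mul_smul_comm, smul_mul_assoc]
  simp only [h3, Finset.sum_add_distrib, Finset.sum_sub_distrib]
  rw [Finset.sum_comm]
  abel

lemma lx_WW (h1 : ∀ j, A.br x (A.y j) = ∑ i, a i j • A.y i)
    (h2 : ∀ i, A.br x * A.mu i = A.mu i * A.br x - ∑ j, a i j • A.mu j) : Commute A.WW (der (lx A x a)) := by
  have h3 := lx_D h1
  have h4 := lx_s0 h1 h2
  rw [commute_iff_eq, WW]
  linear_combination (norm := noncomm_ring) -h3 * A.s0 - A.D * h4 - h4 * A.D - A.s0 * h3

lemma lx_Jd (w : Lam K G) : Jd (d := d) (der (A.br x) w) = der (lx A x a) (Jd w) := by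
  have h := mp_der (inG (d := d) (K := K) (G := G)) (A.br x) (lx A x a) (by intro z; rw [inG_apply, inG_apply, lx_apply]; simp)
  rw [Jd, LinearMap.comp_apply, LinearMap.comp_apply, J0, ← h, LinearMap.sum_apply, LinearMap.sum_apply, map_sum (der (A.br x))]
  simp only [pj_der]

lemma lx_rho (h1 : ∀ j, A.br x (A.y j) = ∑ i, a i j • A.y i) (w) :
    A.rho (der (lx A x a) w) = der (A.br x) (A.rho w) := by
  refine mp_der A.fV _ _ (fun z => ?_) w
  rw [lx_apply, fV_apply, fV_apply, yV_aV h1, map_add]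
end inv

lemma rho_der1 (w) : A.rho (der 1 w) = der 1 (A.rho w) := mp_der A.fV _ _ (fun z => rfl) w

theorem exists_eta [Algebra ℚ K] : ∃ η : Op K G, (∀ p, ∀ w ∈ Dg K G p, η w ∈ Dg K G (p + 1)) ∧
    (∀ p, 1 ≤ p → p ≤ d → ∀ w ∈ Dg K G p, bd A.br A.alt (η w) + η (bd A.br A.alt w) = w) ∧
    ∀ x, A.IsInv x → der (A.br x) * η = η * der (A.br x) := by
  obtain ⟨g1, g1G, Wg1, g1P⟩ := lift_inv A.WW (Jd (d := d)) A.Jd_Good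
  have g1T : ∀ p : ℕ, ∀ w ∈ Dg K G p, g1 w ∈ Tp (p : ℤ) := by
    intro p w hw
    obtain ⟨P, hP⟩ := g1P w
    rw [hP]
    exact aeval_mem (fun x hx => A.Tp_WW hx) P (Jd_Tp hw)
  have g10 : ∀ p : ℕ, ∀ w ∈ Dg K G p, ¬ (1 ≤ p ∧ p ≤ d) → g1 w = 0 := by
    intro p w hw h
    obtain ⟨P, hP⟩ := g1P w
    rw [hP, Jd_out h hw, map_zero]
  have f2T : ∀ p : ℕ, ∀ w ∈ Dg K G p, (A.Om ∘ₗ A.s0 ∘ₗ g1) w ∈ Tp ((p : ℤ) - 1) := by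
    intro p w hw
    exact A.Tp_Om (p := (p : ℤ) + 1) (by ring) (A.Tp_s0 rfl (g1T p w hw))
  have f2G : ∀ w, (A.Om ∘ₗ A.s0 ∘ₗ g1) w ∈ Good A.WW := by
    refine mem_of_pj _ _ fun p w hw => ?_
    by_cases h : 1 ≤ p ∧ p ≤ d
    · exact A.Tp_Good (by have := h.2; omega) (f2T p w hw)
    · rw [LinearMap.comp_apply, LinearMap.comp_apply, g10 p w hw h, map_zero, map_zero]; exact zero_mem _
  obtain ⟨g2, g2G, Wg2, g2P⟩ := lift_inv A.WW (A.Om ∘ₗ A.s0 ∘ₗ g1) f2G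
  have g2T : ∀ p : ℕ, ∀ w ∈ Dg K G p, g2 w ∈ Tp ((p : ℤ) - 1) := by
    intro p w hw
    obtain ⟨P, hP⟩ := g2P w
    rw [hP]
    exact aeval_mem (fun x hx => A.Tp_WW hx) P (f2T p w hw)
  simp only [LinearMap.comp_apply] at Wg2 f2G
  have hWW : ∀ w, A.D (A.s0 w) = A.WW w - A.s0 (A.D w) := by
    intro w; rw [WW]; simp only [LinearMap.add_apply, Module.End.mul_apply]; abel
  have hWD : ∀ w, A.WW (A.D w) = A.D (A.WW w) := fun w => LinearMap.congr_fun A.WW_D.eq w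
  have hDO : ∀ w, A.D (A.Om w) = A.Om (A.D w) := fun w => LinearMap.congr_fun A.D_Om w
  refine ⟨A.rho ∘ₗ A.s0 ∘ₗ g1 + e A.one ∘ₗ A.rho ∘ₗ A.s0 ∘ₗ g2, ?_, ?_, ?_⟩
  · intro p w hw
    have hr : ∀ (r : ℕ) u, u ∈ Tp (r : ℤ) → A.rho u ∈ Dg K G r := by
      intro r u hu
      apply Dg_of_eig
      rw [← rho_der1, Tp_der hu, map_smul]; push_cast; rfl
    refine add_mem ?_ ?_
    · exact hr _ _ (A.Tp_s0 (by push_cast; rfl) (g1T p w hw))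
    · exact e_mem _ (hr p _ (A.Tp_s0 (by ring) (g2T p w hw)))
  · intro p hp1 hp2 w hw
    set bb := bd A.br A.alt with hbd
    have hJ : Jd (d := d) (bb w) = A.D (Jd w) := by
      rw [Jd_in hp1 hp2 hw, J0_D]
      rcases Nat.lt_or_ge 1 p with h | h
      · obtain ⟨q, rfl⟩ : ∃ q, p = q + 1 := ⟨p - 1, by omega⟩
        exact Jd_in (p := q) (by omega) (by omega) (bd_mem _ _ hw)
      · obtain rfl : p = 1 := by omega
        rw [hbd, bd_one_deg _ _ hw]; simp
    have ha : A.D (g1 w) = g1 (bb w) := by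
      refine Good_inj (Good_stable A.WW_D (g1G w)) (g1G _) ?_
      rw [hWD, Wg1, Wg1, hJ]
    have hb : A.D (A.s0 (g1 w)) = J0 w - A.s0 (g1 (bb w)) := by
      rw [hWW, Wg1, Jd_in hp1 hp2 hw, ha]
    have hc : A.D (A.Om (A.s0 (g1 w))) = - A.Om (A.s0 (g1 (bb w))) := by
      rw [hDO, hb, map_sub, J0_Om, zero_sub]
    have hd : A.D (g2 w) = - g2 (bb w) := by
      refine Good_inj (Good_stable A.WW_D (g2G w)) (neg_mem (g2G _)) ?_
      rw [hWD, Wg2, map_neg, Wg2, hc]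
    have he : A.D (A.s0 (g2 w)) = A.Om (A.s0 (g1 w)) + A.s0 (g2 (bb w)) := by
      rw [hWW, Wg2, hd, map_neg, sub_neg_eq_add]
    have h1 := LinearMap.congr_fun (bd_e A.br A.alt A.one) (A.rho (A.s0 (g2 w)))
    have h2 := fun u => LinearMap.congr_fun (e_sq (K := K) A.one) u
    simp only [Module.End.mul_apply, LinearMap.add_apply, LinearMap.neg_apply, A.br_one, der_zero,
      LinearMap.zero_apply, add_zero, LinearMap.comp_apply, map_add] at h1 h2 ⊢
    rw [h1, rho_D, rho_D, hb, he]
    simp only [map_sub, map_add, rho_J0, h2]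
    abel
  · rintro x ⟨a, h1, h2⟩
    have hC := lx_WW h1 h2
    have hWl : ∀ w, A.WW (der (lx A x a) w) = der (lx A x a) (A.WW w) := fun w => LinearMap.congr_fun hC.eq w
    have hsl : ∀ w, A.s0 (der (lx A x a) w) = der (lx A x a) (A.s0 w) := fun w => (LinearMap.congr_fun (lx_s0 h1 h2) w).symm
    have hOl : ∀ w, A.Om (der (lx A x a) w) = der (lx A x a) (A.Om w) := fun w => (LinearMap.congr_fun (lx_Om h1) w).symm
    have ha : ∀ w, g1 (der (A.br x) w) = der (lx A x a) (g1 w) := by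
      intro w
      refine Good_inj (g1G _) (Good_stable hC (g1G w)) ?_
      rw [hWl, Wg1, Wg1, lx_Jd]
    have hb : ∀ w, g2 (der (A.br x) w) = der (lx A x a) (g2 w) := by
      intro w
      refine Good_inj (g2G _) (Good_stable hC (g2G w)) ?_
      rw [hWl, Wg2, Wg2, ha, hsl, hOl]
    refine LinearMap.ext fun w => ?_
    have h3 := fun u => LinearMap.congr_fun (der_e (A.br x) A.one) u
    simp only [Module.End.mul_apply, LinearMap.add_apply, LinearMap.comp_apply, map_add, br_x_one, e_zero,
      LinearMap.zero_apply, add_zero] at h3 ⊢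
    rw [ha, hb, hsl, hsl, lx_rho h1, lx_rho h1, h3]

end Heis
end heis5
end CW

namespace CW
section frame
open TensorProduct

/-- reductive pair with a frame and a projection -/
structure Fr (K : Type*) [CommRing K] (G : Type*) [AddCommGroup G] [Module K G] (ι : Type*) [Fintype ι] where
  br : G →ₗ[K] Module.End K G
  alt : ∀ x, br x x = 0
  jac : Jac br
  hs : Submodule K G
  hb : ι → G
  c : ι → Module.Dual K G
  hb_mem : ∀ a, hb a ∈ hs
  frame : ∀ x ∈ hs, ∑ a, c a x • hb a = x
  pr : Module.End K G
  pr_mem : ∀ x, pr x ∈ hs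
  pr_id : ∀ x ∈ hs, pr x = x
  pr_eq : ∀ x ∈ hs, ∀ y, pr (br x y) = br x (pr y)

namespace Fr
variable {K : Type*} [CommRing K] {G : Type*} [AddCommGroup G] [Module K G] {ι : Type*} [Fintype ι]
variable (A : Fr K G ι)

lemma br_mem {x y : G} (hx : x ∈ A.hs) (hy : y ∈ A.hs) : A.br x y ∈ A.hs := by
  have := A.pr_eq x hx y
  rw [A.pr_id y hy] at this
  rw [← this]; exact A.pr_mem _

/-- components of the projection -/
def th (a : ι) : Module.Dual K G := A.c a ∘ₗ A.pr
lemma th_apply (a : ι) (x : G) : A.th a x = A.c a (A.pr x) := rfl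

lemma th_sum {N : Type*} [AddCommGroup N] [Module K N] (F : G →ₗ[K] N) (x : G) :
    ∑ a, A.th a x • F (A.hb a) = F (A.pr x) := by
  simp only [th_apply, ← map_smul, ← map_sum, A.frame _ (A.pr_mem x)]
lemma c_sum {N : Type*} [AddCommGroup N] [Module K N] (F : G →ₗ[K] N) {x : G} (hx : x ∈ A.hs) :
    ∑ a, A.c a x • F (A.hb a) = F x := by
  simp only [← map_smul, ← map_sum, A.frame _ hx]

/-- the boundary -/
def dd : Op K G := bd A.br A.alt

variable {S : Type*} [AddCommGroup S] [Module K S]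

/-- coefficients tensor exterior algebra -/
def ST (K G S : Type*) [CommRing K] [AddCommGroup G] [Module K G] [AddCommGroup S] [Module K S] := S ⊗[K] Lam K G
instance : AddCommGroup (ST K G S) := inferInstanceAs (AddCommGroup (S ⊗[K] Lam K G))
instance : Module K (ST K G S) := inferInstanceAs (Module K (S ⊗[K] Lam K G))

def tm : S →ₗ[K] Lam K G →ₗ[K] ST K G S := TensorProduct.mk K S (Lam K G)
lemma tm_ext {N : Type*} [AddCommGroup N] [Module K N] {Z W : ST K G S →ₗ[K] N} (h : ∀ s w, Z (tm s w) = W (tm s w)) :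
    Z = W := TensorProduct.ext' h

def sl0 (f : Module.End K S) : Module.End K (ST K G S) := LinearMap.rTensor (Lam K G) f
def sr0 (f : Op K G) : Module.End K (ST K G S) := LinearMap.lTensor S f
lemma sl0_t (f : Module.End K S) (s : S) (w : Lam K G) : sl0 f (tm s w) = tm (f s) w := rfl
lemma sr0_t (f : Op K G) (s : S) (w : Lam K G) : sr0 f (tm s w) = tm s (f w) := rfl
def sl : Module.End K S →ₐ[K] Module.End K (ST K G S) :=
  AlgHom.ofLinearMap ⟨⟨sl0, fun f g => tm_ext fun s w => by simp [sl0_t]⟩, fun k f => tm_ext fun s w => by simp [sl0_t]⟩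
    (tm_ext fun s w => by simp [sl0_t]) (fun f g => tm_ext fun s w => by simp [sl0_t])
def sr : Op K G →ₐ[K] Module.End K (ST K G S) :=
  AlgHom.ofLinearMap ⟨⟨sr0, fun f g => tm_ext fun s w => by simp [sr0_t]⟩, fun k f => tm_ext fun s w => by simp [sr0_t]⟩
    (tm_ext fun s w => by simp [sr0_t]) (fun f g => tm_ext fun s w => by simp [sr0_t])
lemma sl_t (f : Module.End K S) (s : S) (w : Lam K G) : sl f (tm s w) = tm (f s) w := rfl
lemma sr_t (f : Op K G) (s : S) (w : Lam K G) : sr f (tm s w) = tm s (f w) := rfl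
lemma sl_sr (f : Module.End K S) (g : Op K G) : sl f * sr g = sr g * sl f := tm_ext fun s w => rfl

def eS (x : G) : Module.End K (ST K G S) := sr (e x)

lemma st_eqOn {N : Type*} [AddCommGroup N] [Module K N] {Z W : ST K G S →ₗ[K] N} (h1 : ∀ s, Z (tm s 1) = W (tm s 1))
    (he : ∀ x z, Z z = W z → Z (eS x z) = W (eS x z)) : Z = W := by
  refine tm_ext fun s w => ?_
  have : Z ∘ₗ (tm s) = W ∘ₗ (tm s) := by
    apply op_eqOn
    · exact h1 s
    · intro x w hw
      exact he x (tm s w) hw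
  exact LinearMap.congr_fun this w

lemma st_comm0 {Z : Module.End K (ST K G S)} (h1 : ∀ s, Z (tm s 1) = 0) (h : ∀ x, Z * eS x = eS x * Z) : Z = 0 := by
  apply st_eqOn
  · exact h1
  · intro x z hz
    rw [← Module.End.mul_apply, h, Module.End.mul_apply, hz]; simp
lemma st_anti0 {Z : Module.End K (ST K G S)} (h1 : ∀ s, Z (tm s 1) = 0) (h : ∀ x, Z * eS x + eS x * Z = 0) : Z = 0 := by
  apply st_eqOn
  · exact h1
  · intro x z hz
    rw [← Module.End.mul_apply, eq_neg_of_add_eq_zero_left (h x), LinearMap.neg_apply, Module.End.mul_apply, hz]; simp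

/-- contraction with coefficients -/
def ctS (F : G →ₗ[K] Module.End K S) : Module.End K (ST K G S) := ∑ a, sl (F (A.hb a)) * sr (ct (A.th a))

lemma ctS_one (F : G →ₗ[K] Module.End K S) (s : S) : A.ctS F (tm s 1) = 0 := by
  simp [ctS, LinearMap.sum_apply, sl_t, sr_t, ct_one]

lemma ctS_e (F : G →ₗ[K] Module.End K S) (x : G) : A.ctS F * eS x + eS x * A.ctS F = sl (F (A.pr x)) := by
  rw [← A.th_sum F x, ctS, Finset.sum_mul, Finset.mul_sum, ← Finset.sum_add_distrib, map_sum]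
  refine Finset.sum_congr rfl fun a _ => ?_
  have h := congrArg (sr (S := S)) (ct_e (A.th a) x)
  have h2 := sl_sr (F (A.hb a)) (e x)
  rw [map_add, map_mul, map_mul, map_smul, map_one] at h
  rw [map_smul, eS]
  rw [mul_assoc, ← mul_assoc (sr (e x)), ← h2, mul_assoc, ← mul_add, h, mul_smul_comm, mul_one]

lemma ctS_uniq {F : G →ₗ[K] Module.End K S} {Z : Module.End K (ST K G S)} (h1 : ∀ s, Z (tm s 1) = 0)
    (h : ∀ x, Z * eS x + eS x * Z = sl (F (A.pr x))) : Z = A.ctS F := by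
  rw [← sub_eq_zero]
  apply st_anti0
  · intro s; rw [LinearMap.sub_apply, h1, ctS_one, sub_zero]
  · intro x
    have h2 := A.ctS_e F x
    linear_combination (norm := noncomm_ring) h x - h2

lemma sl_e (f : Module.End K S) (x : G) : sl f * eS x = eS x * sl f := sl_sr _ _

lemma sl_ctS {F F' : G →ₗ[K] Module.End K S} {f : Module.End K S} (h : ∀ x ∈ A.hs, f * F x - F x * f = F' x) :
    sl f * A.ctS F - A.ctS F * sl f = A.ctS F' := by
  apply ctS_uniq
  · intro s; simp [ctS_one, sl_t]
  · intro x
    have h2 := A.ctS_e F x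
    have h3 := sl_e (K := K) (G := G) f x
    rw [← h _ (A.pr_mem x), map_sub, map_mul, map_mul, ← h2]
    linear_combination (norm := noncomm_ring) -h3 * A.ctS F - A.ctS F * h3

lemma ctS_anti {F F' : G →ₗ[K] Module.End K S} (h : ∀ x ∈ A.hs, ∀ y ∈ A.hs, F x * F' y = F' y * F x) :
    A.ctS F * A.ctS F' + A.ctS F' * A.ctS F = 0 := by
  apply st_comm0
  · intro s; simp [ctS_one]
  · intro x
    have h1 := A.ctS_e F x
    have h2 := A.ctS_e F' x
    have h3 := A.sl_ctS (f := F (A.pr x)) (F := F') (F' := 0)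
      (by intro y hy; rw [h _ (A.pr_mem x) _ hy, sub_self]; rfl)
    have h4 := A.sl_ctS (f := F' (A.pr x)) (F := F) (F' := 0)
      (by intro y hy; rw [h _ hy _ (A.pr_mem x), sub_self]; rfl)
    have h5 : A.ctS (0 : G →ₗ[K] Module.End K S) = 0 := by simp [ctS]
    rw [h5] at h3 h4
    linear_combination (norm := noncomm_ring) A.ctS F * h2 - h1 * A.ctS F' + A.ctS F' * h1 - h2 * A.ctS F - h3 - h4

lemma L_ctS {x : G} (hx : x ∈ A.hs) (F : G →ₗ[K] Module.End K S) :
    sr (der (A.br x)) * A.ctS F - A.ctS F * sr (der (A.br x)) = - A.ctS (F ∘ₗ A.br x) := by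
  rw [← sub_eq_zero, sub_neg_eq_add]
  apply st_anti0
  · intro s; simp [ctS_one, sr_t, der_one]
  · intro y
    have h1 := A.ctS_e F y
    have h2 := A.ctS_e F (A.br x y)
    have h3 := A.ctS_e (F ∘ₗ A.br x) y
    have h4 := congrArg (sr (S := S)) (der_e (A.br x) y)
    have h5 := sl_sr (F (A.pr y)) (der (A.br x))
    rw [map_add, map_mul, map_mul] at h4
    rw [LinearMap.comp_apply, ← A.pr_eq x hx] at h3
    simp only [eS] at h1 h2 h3 ⊢
    linear_combination (norm := noncomm_ring) sr (der (A.br x)) * h1 - h1 * sr (der (A.br x)) - A.ctS F * h4 - h4 * A.ctS F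
      + h3 - h2 - h5

end Fr
end frame
end CW

namespace CW
section frame2

/-- symmetric coefficient data -/
structure Co {K : Type*} [CommRing K] {G : Type*} [AddCommGroup G] [Module K G] {ι : Type*} [Fintype ι]
    (A : Fr K G ι) (S : Type*) [AddCommGroup S] [Module K S] where
  X : G →ₗ[K] Module.End K S
  ro : G →ₗ[K] Module.End K S
  XX : ∀ x y, X x * X y = X y * X x
  roX : ∀ x ∈ A.hs, ∀ y ∈ A.hs, ro x * X y - X y * ro x = X (A.br x y)
  roro : ∀ x ∈ A.hs, ∀ y ∈ A.hs, ro x * ro y - ro y * ro x = ro (A.br x y)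
  one : S
  ro_one : ∀ x, ro x one = 0

namespace Co
variable {K : Type*} [CommRing K] {G : Type*} [AddCommGroup G] [Module K G] {ι : Type*} [Fintype ι]
variable {A : Fr K G ι} {S : Type*} [AddCommGroup S] [Module K S] (B : Co A S)
open Fr

/-- tautological connection -/
def T : Module.End K (ST K G S) := A.ctS B.X
/-- action term -/
def R : Module.End K (ST K G S) := A.ctS B.ro
def W : Module.End K (ST K G S) := B.T * B.R + B.R * B.T

lemma T_sq : B.T * B.T = 0 := by
  rw [T]
  apply st_comm0
  · intro s; simp [ctS_one]
  · intro x
    have := A.ctS_e B.X x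
    have h3 := A.sl_ctS (f := B.X (A.pr x)) (F := B.X) (F' := 0) (by intro y _; rw [B.XX, sub_self]; rfl)
    have h5 : A.ctS (0 : G →ₗ[K] Module.End K S) = 0 := by simp [ctS]
    rw [h5] at h3
    linear_combination (norm := noncomm_ring) A.ctS B.X * this - this * A.ctS B.X - h3

lemma XT (y : G) : sl (B.X y) * B.T = B.T * sl (B.X y) := by
  have h3 := A.sl_ctS (f := B.X y) (F := B.X) (F' := 0) (by intro y _; rw [B.XX, sub_self]; rfl)
  have h5 : A.ctS (0 : G →ₗ[K] Module.End K S) = 0 := by simp [ctS]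
  rw [h5] at h3
  exact sub_eq_zero.1 h3

/-- `[X(x), R]` -/
lemma XR {x : G} (hx : x ∈ A.hs) : sl (B.X x) * B.R - B.R * sl (B.X x) = A.ctS (B.X ∘ₗ A.br x) := by
  apply A.sl_ctS
  intro y hy
  rw [LinearMap.comp_apply, alt_swap A.alt x y, map_neg, ← B.roX y hy x hx]; abel

lemma roT {x : G} (hx : x ∈ A.hs) : sl (B.ro x) * B.T - B.T * sl (B.ro x) = A.ctS (B.X ∘ₗ A.br x) := by
  apply A.sl_ctS
  intro y hy
  rw [LinearMap.comp_apply, B.roX x hx y hy]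

lemma roR {x : G} (hx : x ∈ A.hs) : sl (B.ro x) * B.R - B.R * sl (B.ro x) = A.ctS (B.ro ∘ₗ A.br x) := by
  apply A.sl_ctS
  intro y hy
  rw [LinearMap.comp_apply, B.roro x hx y hy]

lemma T_e (x : G) : B.T * eS x + eS x * B.T = sl (B.X (A.pr x)) := A.ctS_e _ _
lemma R_e (x : G) : B.R * eS x + eS x * B.R = sl (B.ro (A.pr x)) := A.ctS_e _ _

lemma W_e (x : G) : B.W * eS x - eS x * B.W = - (2 : K) • A.ctS (B.X ∘ₗ A.br (A.pr x)) := by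
  have h1 := B.T_e x
  have h2 := B.R_e x
  have h3 := B.XR (A.pr_mem x)
  have h4 := B.roT (A.pr_mem x)
  rw [W, neg_smul, two_smul]
  linear_combination (norm := noncomm_ring) B.T * h2 - h1 * B.R + B.R * h1 - h2 * B.T - h3 - h4

lemma WT : B.W * B.T = B.T * B.W := by
  have h := B.T_sq
  rw [W]
  linear_combination (norm := noncomm_ring) B.R * h - h * B.R

lemma XW (y : G) : sl (B.X y) * B.W = B.W * sl (B.X y) := by
  rw [← sub_eq_zero]
  apply st_comm0
  · intro s; simp [W, T, R, ctS_one, sl_t]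
  · intro x
    have h1 := B.W_e x
    have h2 := sl_e (K := K) (B.X y) x
    have h3 := A.sl_ctS (f := B.X y) (F := B.X ∘ₗ A.br (A.pr x)) (F' := 0)
      (by intro z hz; rw [LinearMap.comp_apply, B.XX, sub_self]; rfl)
    have h5 : A.ctS (0 : G →ₗ[K] Module.End K S) = 0 := by simp [ctS]
    rw [h5] at h3
    have h4 : sl (B.X y) * (- (2 : K) • A.ctS (B.X ∘ₗ A.br (A.pr x))) = (- (2 : K) • A.ctS (B.X ∘ₗ A.br (A.pr x))) * sl (B.X y) := by
      rw [mul_smul_comm, smul_mul_assoc, sub_eq_zero.1 h3]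
    linear_combination (norm := noncomm_ring) sl (B.X y) * h1 - h1 * sl (B.X y) + h2 * B.W - B.W * h2 + h4

lemma WR : B.W * B.R = B.R * B.W := by
  rw [← sub_eq_zero]
  apply st_anti0
  · intro s; simp [W, T, R, ctS_one]
  · intro x
    have hx := A.pr_mem x
    set x' := A.pr x with hx'
    have hW := B.W_e x
    have h2 := B.R_e x
    have h3 := B.roT hx
    have h4 := B.roR hx
    rw [← hx'] at hW h2
    rw [neg_smul, two_smul] at hW
    have key : A.ctS (B.X ∘ₗ A.br x') * B.R + B.R * A.ctS (B.X ∘ₗ A.br x') =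
        B.T * A.ctS (B.ro ∘ₗ A.br x') + A.ctS (B.ro ∘ₗ A.br x') * B.T := by
      rw [← sub_eq_zero]
      apply st_comm0
      · intro s; simp [T, R, ctS_one]
      · intro y
        have hy := A.pr_mem y
        have e1 := A.ctS_e (B.X ∘ₗ A.br x') y
        have e2 := A.ctS_e (B.ro ∘ₗ A.br x') y
        have e3 := B.R_e y
        have e4 := B.T_e y
        set y' := A.pr y
        have hxy : A.br x' y' ∈ A.hs := A.br_mem hx hy
        have f1 := B.XR hxy
        have f2 := B.roT hxy
        have f3 := A.sl_ctS (f := B.ro y') (F := B.X ∘ₗ A.br x') (F' := B.X ∘ₗ A.br y' ∘ₗ A.br x') (by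
          intro z hz; simp only [LinearMap.comp_apply]; rw [B.roX y' hy _ (A.br_mem hx hz)])
        have f4 := A.sl_ctS (f := B.X y') (F := B.ro ∘ₗ A.br x') (F' := B.X ∘ₗ A.br y' ∘ₗ A.br x') (by
          intro z hz
          simp only [LinearMap.comp_apply]
          rw [alt_swap A.alt y', map_neg, ← B.roX _ (A.br_mem hx hz) y' hy]; abel)
        simp only [LinearMap.comp_apply] at e1 e2
        linear_combination (norm := noncomm_ring)
          A.ctS (B.X ∘ₗ A.br x') * e3 - e1 * B.R + B.R * e1 - e3 * A.ctS (B.X ∘ₗ A.br x')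
          - (B.T * e2 - e4 * A.ctS (B.ro ∘ₗ A.br x') + A.ctS (B.ro ∘ₗ A.br x') * e4 - e2 * B.T) - f1 + f2 - f3 + f4
    have hW2 : sl (B.ro x') * B.W - B.W * sl (B.ro x') = A.ctS (B.X ∘ₗ A.br x') * B.R + B.R * A.ctS (B.X ∘ₗ A.br x')
        + (B.T * A.ctS (B.ro ∘ₗ A.br x') + A.ctS (B.ro ∘ₗ A.br x') * B.T) := by
      rw [W]
      linear_combination (norm := noncomm_ring) h3 * B.R + B.T * h4 + h4 * B.T + B.R * h3
    linear_combination (norm := noncomm_ring) B.W * h2 - h2 * B.W - hW2 - B.R * hW - hW * B.R + key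

end Co
end frame2
end CW

namespace CW
section frame3

namespace Fr
variable {K : Type*} [CommRing K] {G : Type*} [AddCommGroup G] [Module K G] {ι : Type*} [Fintype ι]
variable (A : Fr K G ι) {S : Type*} [AddCommGroup S] [Module K S]

/-- contraction with a twist -/
def kt (F : G →ₗ[K] Module.End K S) (φ : Module.End K G) : Module.End K (ST K G S) :=
  ∑ a, sl (F (A.hb a)) * sr (ct (A.th a ∘ₗ φ))

lemma kt_one (F : G →ₗ[K] Module.End K S) (φ : Module.End K G) (s : S) : A.kt F φ (tm s 1) = 0 := by
  simp [kt, LinearMap.sum_apply, sl_t, sr_t, ct_one]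

lemma slsr_ct (f : Module.End K S) (φ : Module.Dual K G) (x : G) :
    sl f * sr (ct φ) * eS x + eS x * (sl f * sr (ct φ)) = φ x • sl f := by
  have h := congrArg (sr (S := S)) (ct_e φ x)
  have h2 := sl_sr f (e x)
  rw [map_add, map_mul, map_mul, map_smul, map_one] at h
  rw [eS]
  rw [mul_assoc, ← mul_assoc (sr (e x)), ← h2, mul_assoc, ← mul_add, h, mul_smul_comm, mul_one]

lemma kt_e (F : G →ₗ[K] Module.End K S) (φ : Module.End K G) (x : G) :
    A.kt F φ * eS x + eS x * A.kt F φ = sl (F (A.pr (φ x))) := by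
  rw [← A.th_sum F (φ x), kt, Finset.sum_mul, Finset.mul_sum, ← Finset.sum_add_distrib, map_sum]
  refine Finset.sum_congr rfl fun a _ => ?_
  rw [slsr_ct, map_smul]; rfl

lemma kt_uniq {F : G →ₗ[K] Module.End K S} {φ : Module.End K G} {Z : Module.End K (ST K G S)} (h1 : ∀ s, Z (tm s 1) = 0)
    (h : ∀ x, Z * eS x + eS x * Z = sl (F (A.pr (φ x)))) : Z = A.kt F φ := by
  rw [← sub_eq_zero]
  apply st_anti0
  · intro s; rw [LinearMap.sub_apply, h1, kt_one, sub_zero]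
  · intro x
    have h2 := A.kt_e F φ x
    linear_combination (norm := noncomm_ring) h x - h2

lemma sl_kt {F F' : G →ₗ[K] Module.End K S} {φ : Module.End K G} {f : Module.End K S} (h : ∀ x ∈ A.hs, f * F x - F x * f = F' x) :
    sl f * A.kt F φ - A.kt F φ * sl f = A.kt F' φ := by
  apply kt_uniq
  · intro s; simp [kt_one, sl_t]
  · intro x
    have h2 := A.kt_e F φ x
    have h3 := sl_e (K := K) (G := G) f x
    rw [← h _ (A.pr_mem _), map_sub, map_mul, map_mul, ← h2]
    linear_combination (norm := noncomm_ring) -h3 * A.kt F φ - A.kt F φ * h3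

lemma pbr_alt (A : Fr K G ι) (φ : Module.Dual K G) (x : G) :
    ((LinearMap.llcomp K G G K φ) ∘ₗ A.br) x x = 0 := by
  simp [A.alt]

/-- two-fold contraction by the bracket -/
def EE (F : G →ₗ[K] Module.End K S) : Module.End K (ST K G S) :=
  ∑ a, sl (F (A.hb a)) * sr (om ((LinearMap.llcomp K G G K (A.th a)) ∘ₗ A.br) (A.pbr_alt (A.th a)))

lemma EE_one (F : G →ₗ[K] Module.End K S) (s : S) : A.EE F (tm s 1) = 0 := by
  simp [EE, LinearMap.sum_apply, sl_t, sr_t, om_one]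

lemma slsr_om (f : Module.End K S) (β : G →ₗ[K] Module.Dual K G) (hβ : ∀ x, β x x = 0) (x : G) :
    sl f * sr (om β hβ) * eS x - eS x * (sl f * sr (om β hβ)) = sl f * sr (ct (β x)) := by
  have h := congrArg (sr (S := S)) (om_e β hβ x)
  have h2 := sl_sr f (e x)
  rw [map_add, map_mul, map_mul] at h
  rw [eS]
  linear_combination (norm := noncomm_ring) sl f * h + h2 * sr (om β hβ)

lemma EE_e (F : G →ₗ[K] Module.End K S) (x : G) :
    A.EE F * eS x - eS x * A.EE F = A.kt F (A.br x) := by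
  rw [EE, kt, Finset.sum_mul, Finset.mul_sum, ← Finset.sum_sub_distrib]
  refine Finset.sum_congr rfl fun a _ => ?_
  rw [slsr_om]
  rfl

lemma EE_uniq {F : G →ₗ[K] Module.End K S} {Z : Module.End K (ST K G S)} (h1 : ∀ s, Z (tm s 1) = 0)
    (h : ∀ x, Z * eS x - eS x * Z = A.kt F (A.br x)) : Z = A.EE F := by
  rw [← sub_eq_zero]
  apply st_comm0
  · intro s; rw [LinearMap.sub_apply, h1, EE_one, sub_zero]
  · intro x
    have h2 := A.EE_e F x
    linear_combination (norm := noncomm_ring) h x - h2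

lemma sl_EE {F F' : G →ₗ[K] Module.End K S} {f : Module.End K S} (h : ∀ x ∈ A.hs, f * F x - F x * f = F' x) :
    sl f * A.EE F - A.EE F * sl f = A.EE F' := by
  apply EE_uniq
  · intro s; simp [EE_one, sl_t]
  · intro x
    have h2 := A.EE_e F x
    have h3 := sl_e (K := K) (G := G) f x
    rw [← A.sl_kt h, ← h2]
    linear_combination (norm := noncomm_ring) h3 * A.EE F - A.EE F * h3

/-- `{∂, ι}` -/
lemma dd_ctS (F : G →ₗ[K] Module.End K S) :
    A.ctS F * sr A.dd + sr A.dd * A.ctS F = A.EE F := by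
  rw [ctS, EE, Finset.sum_mul, Finset.mul_sum, ← Finset.sum_add_distrib]
  refine Finset.sum_congr rfl fun a _ => ?_
  have h := congrArg (sr (S := S)) (bd_ct A.br A.alt (A.th a) (A.pbr_alt (A.th a)))
  rw [map_add, map_mul, map_mul] at h
  have h2 := sl_sr (F (A.hb a)) A.dd
  change sr A.dd * _ + _ * sr A.dd = _ at h
  linear_combination (norm := noncomm_ring) sl (F (A.hb a)) * h - h2 * sr (ct (A.th a))

end Fr

namespace Co
variable {K : Type*} [CommRing K] {G : Type*} [AddCommGroup G] [Module K G] {ι : Type*} [Fintype ι]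
variable {A : Fr K G ι} {S : Type*} [AddCommGroup S] [Module K S] (B : Co A S)
open Fr

lemma key1 (φ : Module.End K G) :
    B.T * A.kt B.ro φ + A.kt B.ro φ * B.T = B.R * A.kt B.X φ + A.kt B.X φ * B.R := by
  rw [← sub_eq_zero]
  apply st_comm0
  · intro s; simp [T, R, ctS_one, kt_one]
  · intro y
    have hy := A.pr_mem y
    have hz := A.pr_mem (φ y)
    have e1 := A.kt_e B.X φ y
    have e2 := A.kt_e B.ro φ y
    have e3 := B.R_e y
    have e4 := B.T_e y
    have f1 := B.XR hz
    have f2 := B.roT hz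
    have f3 := A.sl_kt (φ := φ) (f := B.ro (A.pr y)) (F := B.X) (F' := B.X ∘ₗ A.br (A.pr y)) (by
      intro z hz; simp only [LinearMap.comp_apply]; rw [B.roX _ hy _ hz])
    have f4 := A.sl_kt (φ := φ) (f := B.X (A.pr y)) (F := B.ro) (F' := B.X ∘ₗ A.br (A.pr y)) (by
      intro z hz
      simp only [LinearMap.comp_apply]
      rw [alt_swap A.alt, map_neg, ← B.roX _ hz _ hy]; abel)
    linear_combination (norm := noncomm_ring)
      (B.T * e2 - e4 * A.kt B.ro φ + A.kt B.ro φ * e4 - e2 * B.T)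
      - (B.R * e1 - e3 * A.kt B.X φ + A.kt B.X φ * e3 - e1 * B.R) + f1 - f2 + f3 - f4

lemma key2 : A.EE B.ro * B.T - B.T * A.EE B.ro = A.EE B.X * B.R - B.R * A.EE B.X := by
  rw [← sub_eq_zero]
  apply st_anti0
  · intro s; simp [T, R, ctS_one, EE_one]
  · intro y
    have hy := A.pr_mem y
    have e1 := A.EE_e B.X y
    have e2 := A.EE_e B.ro y
    have e3 := B.R_e y
    have e4 := B.T_e y
    have k := B.key1 (A.br y)
    have f3 := A.sl_EE (f := B.ro (A.pr y)) (F := B.X) (F' := B.X ∘ₗ A.br (A.pr y)) (by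
      intro z hz; simp only [LinearMap.comp_apply]; rw [B.roX _ hy _ hz])
    have f4 := A.sl_EE (f := B.X (A.pr y)) (F := B.ro) (F' := B.X ∘ₗ A.br (A.pr y)) (by
      intro z hz
      simp only [LinearMap.comp_apply]
      rw [alt_swap A.alt, map_neg, ← B.roX _ hz _ hy]; abel)
    linear_combination (norm := noncomm_ring)
      (A.EE B.ro * e4 - e2 * B.T - e4 * A.EE B.ro - B.T * e2)
      - (A.EE B.X * e3 - e1 * B.R - e3 * A.EE B.X - B.R * e1) - k + f3 - f4

/-- twisted differential -/
def De (A : Fr K G ι) (S : Type*) [AddCommGroup S] [Module K S] (u : G) : Module.End K (ST K G S) := sr A.dd - eS u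

lemma De_sq (u : G) : De A S u * De A S u = - sr (der (A.br u)) := by
  have h1 := congrArg (sr (S := S)) (bd_sq A.alt A.jac)
  have h2 := congrArg (sr (S := S)) (bd_e A.br A.alt u)
  have h3 := congrArg (sr (S := S)) (e_sq (K := K) u)
  rw [map_mul, map_zero] at h1 h3
  rw [map_add, map_neg, map_mul, map_mul] at h2
  change sr A.dd * sr A.dd = _ at h1
  change sr A.dd * _ = - (_ * sr A.dd) + _ at h2
  rw [De, eS]
  linear_combination (norm := noncomm_ring) h1 - h2 + h3

lemma ctS_De (F : G →ₗ[K] Module.End K S) {u : G} (hu : u ∈ A.hs) :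
    A.ctS F * De A S u + De A S u * A.ctS F = A.EE F - sl (F u) := by
  have h1 := A.dd_ctS F
  have h2 := A.ctS_e F u
  rw [A.pr_id u hu] at h2
  rw [De]
  linear_combination (norm := noncomm_ring) h1 - h2

/-- linear coefficient -/
def FF (u : G) : Module.End K (ST K G S) := A.EE B.X - sl (B.X u)

lemma TDe {u : G} (hu : u ∈ A.hs) : B.T * De A S u + De A S u * B.T = B.FF u := ctS_De B.X hu

lemma FT {u : G} (hu : u ∈ A.hs) : B.FF u * B.T = B.T * B.FF u := by
  have h := B.T_sq
  rw [← B.TDe hu]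
  linear_combination (norm := noncomm_ring) De A S u * h - h * De A S u

lemma t1 {u : G} (hu : u ∈ A.hs) : B.FF u * De A S u + sl (B.X u) * B.R = De A S u * B.FF u + B.R * sl (B.X u) := by
  have h1 := B.XR hu
  have h2 := De_sq (A := A) (S := S) u
  have h3 := A.L_ctS hu B.X
  change _ * B.T - B.T * _ = _ at h3
  rw [← B.TDe hu]
  linear_combination (norm := noncomm_ring) h1 + B.T * h2 - h2 * B.T + h3

lemma t2 {u : G} (hu : u ∈ A.hs) : 2 * (B.FF u * B.R - B.R * B.FF u) + (B.W * De A S u - De A S u * B.W) = 0 := by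
  have h1 : B.R * De A S u + De A S u * B.R = A.EE B.ro - sl (B.ro u) := ctS_De B.ro hu
  have h2 := B.TDe hu
  have h3 : (A.EE B.ro - sl (B.ro u)) * B.T - B.T * (A.EE B.ro - sl (B.ro u)) = B.FF u * B.R - B.R * B.FF u := by
    have := B.key2
    have g1 := B.XR hu
    have g2 := B.roT hu
    rw [FF]
    linear_combination (norm := noncomm_ring) this + g1 - g2
  rw [W]
  linear_combination (norm := noncomm_ring) - h2 * B.R + B.R * h2 - h1 * B.T + B.T * h1 - h3

end Co
end frame3
end CW

namespace CW
section homot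
open Polynomial

/-- the quadratic path -/
def BP {E : Type*} [Ring E] (x f w : E) : E[X] := Polynomial.C x + Polynomial.C f * Polynomial.X + Polynomial.C w * Polynomial.X ^ 2

lemma BP_coeff {E : Type*} [Ring E] (x f w : E) (k : ℕ) :
    (BP x f w).coeff k = if k = 0 then x else if k = 1 then f else if k = 2 then w else 0 := by
  rw [BP]
  simp only [Polynomial.coeff_add, Polynomial.coeff_C, Polynomial.coeff_C_mul, Polynomial.coeff_X, Polynomial.coeff_X_pow]
  rcases k with _ | _ | _ | k <;> simp

lemma homot {E : Type*} [Ring E] {x f w D R T : E} (hxD : x * D = D * x) (h1 : f * D + x * R = D * f + R * x)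
    (h2 : f * R + w * D = R * f + D * w) (h3 : w * R = R * w) (hxT : x * T = T * x) (hfT : f * T = T * f)
    (hwT : w * T = T * w) (hd : T * D + D * T = f) (hw : T * R + R * T = w + w) (j : ℕ)
    {V : Type*} [AddCommGroup V] (tf : ∀ m : ℕ, ∀ k : V, (m + 1) • k = 0 → k = 0) (Λ : E →+ V)
    (hD : ∀ Q, Λ (D * Q) = 0) (hR : ∀ Q, Λ (R * Q) = 0) (hR' : ∀ Q, Λ (Q * R) = 0)
    (hT : ∀ k, Λ (((BP x f w) ^ (j - 1)).coeff k * T * D) = 0) :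
    Λ (x ^ j) = Λ ((x + f + w) ^ j) := by
  have hBT : Commute (BP x f w) (Polynomial.C T) := by
    have g1 := congrArg Polynomial.C hxT
    have g2 := congrArg Polynomial.C hfT
    have g3 := congrArg Polynomial.C hwT
    simp only [map_mul] at g1 g2 g3
    have x1 := X_mul_C T
    rw [Commute, SemiconjBy, BP]
    linear_combination (norm := noncomm_ring) g1 + g2 * Polynomial.X + g3 * Polynomial.X ^ 2 + Polynomial.C f * x1 + Polynomial.C w * Polynomial.X * x1 + Polynomial.C w * x1 * Polynomial.X
  have hBN : Commute (BP x f w) (Polynomial.C D + Polynomial.C R * Polynomial.X) := by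
    have g0 := congrArg Polynomial.C hxD
    have g1 := congrArg Polynomial.C h1
    have g2 := congrArg Polynomial.C h2
    have g3 := congrArg Polynomial.C h3
    simp only [map_mul, map_add] at g0 g1 g2 g3
    have x1 := X_mul_C D
    have x2 := X_mul_C R
    have x3 := X_mul_C x
    have x4 := X_mul_C f
    have x5 := X_mul_C w
    rw [Commute, SemiconjBy, BP]
    linear_combination (norm := noncomm_ring) g0 + g1 * Polynomial.X + g2 * Polynomial.X ^ 2 + g3 * Polynomial.X ^ 3 + Polynomial.C f * x1 + Polynomial.C w * Polynomial.X * x1 + Polynomial.C w * x1 * Polynomial.X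
      + Polynomial.C f * x2 * Polynomial.X + Polynomial.C w * Polynomial.X * x2 * Polynomial.X + Polynomial.C w * x2 * Polynomial.X * Polynomial.X - Polynomial.C R * x3 - Polynomial.C R * x4 * Polynomial.X - Polynomial.C R * x5 * Polynomial.X ^ 2
  have hder : derivative (BP x f w) = Polynomial.C T * (Polynomial.C D + Polynomial.C R * Polynomial.X) + (Polynomial.C D + Polynomial.C R * Polynomial.X) * Polynomial.C T := by
    have g1 := congrArg Polynomial.C hd
    have g2 := congrArg Polynomial.C hw
    simp only [map_mul, map_add] at g1 g2
    have x1 := X_mul_C T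
    have x2 : derivative (BP x f w) = Polynomial.C f + (Polynomial.C w + Polynomial.C w) * Polynomial.X := by
      rw [BP]
      simp only [derivative_add, Polynomial.derivative_C, Polynomial.derivative_mul, Polynomial.derivative_X, Polynomial.derivative_X_pow, zero_mul, mul_one, zero_add]
      norm_num
      have e2 : (Polynomial.C (2 : E)) = 1 + 1 := by rw [← one_add_one_eq_two, map_add, map_one]
      rw [e2]; noncomm_ring
    rw [x2]
    linear_combination (norm := noncomm_ring) -g1 - g2 * Polynomial.X - Polynomial.C R * x1
  have hpow : ∀ i, derivative (BP x f w ^ (i + 1)) = (i + 1) • (BP x f w ^ i * derivative (BP x f w)) := by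
    have hc : Commute (BP x f w) (derivative (BP x f w)) := by
      rw [hder]; exact (hBT.mul_right hBN).add_right (hBN.mul_right hBT)
    intro i
    induction i with
    | zero => simp
    | succ i ih =>
      rw [pow_succ, Polynomial.derivative_mul, ih, smul_mul_assoc, mul_assoc, ← hc.eq, ← mul_assoc, ← pow_succ, ← succ_nsmul]
  rcases j with _ | j
  · simp
  simp only [Nat.add_sub_cancel] at hT
  have hz : ∀ k, Λ ((BP x f w ^ (j + 1)).coeff (k + 1)) = 0 := by
    intro k
    apply tf k
    have e1 := Polynomial.coeff_derivative (BP x f w ^ (j + 1)) k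
    have e2 : ((k : E) + 1) = ((k + 1 : ℕ) : E) := by push_cast; rfl
    rw [e2, ← nsmul_eq_mul', hpow, hder] at e1
    rw [← map_nsmul, ← e1, Polynomial.coeff_smul, map_nsmul]
    suffices hs : Λ ((BP x f w ^ j * (Polynomial.C T * (Polynomial.C D + Polynomial.C R * Polynomial.X) + (Polynomial.C D + Polynomial.C R * Polynomial.X) * Polynomial.C T)).coeff k) = 0 by
      rw [hs, smul_zero]
    have e3 : BP x f w ^ j * (Polynomial.C T * (Polynomial.C D + Polynomial.C R * Polynomial.X) + (Polynomial.C D + Polynomial.C R * Polynomial.X) * Polynomial.C T) =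
        (BP x f w ^ j * Polynomial.C T) * (Polynomial.C D + Polynomial.C R * Polynomial.X) + (Polynomial.C D + Polynomial.C R * Polynomial.X) * (BP x f w ^ j * Polynomial.C T) := by
      rw [mul_add, mul_assoc, ← mul_assoc (BP x f w ^ j) (Polynomial.C D + Polynomial.C R * Polynomial.X), (hBN.pow_left j).eq, mul_assoc]
    rw [e3, Polynomial.coeff_add, map_add]
    have e4 : Λ ((BP x f w ^ j * Polynomial.C T * (Polynomial.C D + Polynomial.C R * Polynomial.X)).coeff k) = 0 := by
      rw [mul_add, Polynomial.coeff_add, map_add, Polynomial.coeff_mul_C, Polynomial.coeff_mul_C, hT, zero_add, ← mul_assoc]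
      rcases k with _ | k
      · rw [Polynomial.coeff_mul_X_zero, map_zero]
      · rw [Polynomial.coeff_mul_X, Polynomial.coeff_mul_C, hR']
    have e5 : Λ (((Polynomial.C D + Polynomial.C R * Polynomial.X) * (BP x f w ^ j * Polynomial.C T)).coeff k) = 0 := by
      rw [add_mul, Polynomial.coeff_add, map_add, Polynomial.coeff_C_mul, hD, zero_add, mul_assoc, Polynomial.coeff_C_mul, hR]
    rw [e4, e5, add_zero]
  have c0 : ∀ i, (BP x f w ^ i).coeff 0 = x ^ i := by
    intro i
    induction i with
    | zero => simp
    | succ i ih => rw [pow_succ, mul_coeff_zero, ih, BP_coeff, if_pos rfl, pow_succ]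
  let φ := Polynomial.eval₂RingHom' (RingHom.id E) (1 : E) (fun a => Commute.one_right _)
  have hφ : φ (BP x f w) = x + f + w := by
    rw [BP]
    simp only [map_add, map_mul, map_pow]
    simp [φ]
  have hφ2 : ∀ Q : E[X], φ Q = ∑ i ∈ Finset.range (Q.natDegree + 1), Q.coeff i := by
    intro Q
    change Polynomial.eval₂ _ _ Q = _
    rw [Polynomial.eval₂_eq_sum_range]
    simp
  rw [← hφ, ← map_pow, hφ2, Finset.sum_range_succ', map_add, map_sum, Finset.sum_eq_zero (fun k _ => hz k), zero_add, c0]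

end homot

section frame4
namespace Fr
variable {K : Type*} [CommRing K] {G : Type*} [AddCommGroup G] [Module K G] {ι : Type*} [Fintype ι]
variable (A : Fr K G ι) {S : Type*} [AddCommGroup S] [Module K S]

/-- curvature -/
def curv : G →ₗ[K] Module.End K G := LinearMap.compl₂ (A.br ∘ₗ A.pr) A.pr - LinearMap.compr₂ A.br A.pr
lemma curv_apply (x y : G) : A.curv x y = A.br (A.pr x) (A.pr y) - A.pr (A.br x y) := rfl
lemma curv_mem (x y : G) : A.curv x y ∈ A.hs := by
  rw [curv_apply]
  exact Submodule.sub_mem _ (A.br_mem (A.pr_mem _) (A.pr_mem _)) (A.pr_mem _)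
lemma curv_alt (x : G) : A.curv x x = 0 := by simp [curv_apply, A.alt]
lemma cc_alt (a : ι) (x : G) : ((LinearMap.llcomp K G G K (A.c a)) ∘ₗ A.curv) x x = 0 := by
  simp [A.curv_alt]
/-- components of the curvature as operators -/
def co (a : ι) : Op K G := om ((LinearMap.llcomp K G G K (A.c a)) ∘ₗ A.curv) (A.cc_alt a)

/-- filtration -/
def FS (K G S : Type*) [CommRing K] [AddCommGroup G] [Module K G] [AddCommGroup S] [Module K S] (p : ℕ) :
    Submodule K (ST K G S) := Submodule.span K {z | ∃ s w q, p ≤ q ∧ w ∈ Dg K G q ∧ z = tm s w}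
lemma tm_FS {p q : ℕ} (h : p ≤ q) (s : S) {w : Lam K G} (hw : w ∈ Dg K G q) : tm s w ∈ FS K G S p :=
  Submodule.subset_span ⟨s, w, q, h, hw, rfl⟩
lemma FS_map {p r : ℕ} {N : Type*} [AddCommGroup N] [Module K N] {Z : ST K G S →ₗ[K] N} {V : Submodule K N}
    (h : ∀ s q w, p ≤ q → w ∈ Dg K G q → Z (tm s w) ∈ V) {z} (hz : z ∈ FS K G S p) : Z z ∈ V := by
  have : FS K G S p ≤ V.comap Z := by
    rw [FS, Submodule.span_le]
    rintro _ ⟨s, w, q, hq, hw, rfl⟩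
    exact h s q w hq hw
  exact this hz

lemma sl_FS (f : Module.End K S) {p : ℕ} {z} (hz : z ∈ FS K G S p) : sl f z ∈ FS K G S p := by
  refine FS_map (r := p) (Z := sl f) (V := FS K G S p) (fun s q w hq hw => ?_) hz
  rw [sl_t]; exact tm_FS hq _ hw

lemma ctS_FS (F : G →ₗ[K] Module.End K S) {p : ℕ} {z} (hz : z ∈ FS K G S (p + 1)) : A.ctS F z ∈ FS K G S p := by
  rw [ctS, LinearMap.sum_apply]
  refine Submodule.sum_mem _ fun a _ => ?_
  rw [Module.End.mul_apply]
  apply sl_FS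
  refine FS_map (r := p) (Z := sr (ct (A.th a))) (V := FS K G S p) (fun s q w hq hw => ?_) hz
  rw [sr_t]
  obtain ⟨q, rfl⟩ : ∃ q', q = q' + 1 := ⟨q - 1, by omega⟩
  exact tm_FS (by omega) _ (ct_mem _ hw)

lemma EE_FS (F : G →ₗ[K] Module.End K S) {p : ℕ} {z} (hz : z ∈ FS K G S (p + 2)) : A.EE F z ∈ FS K G S p := by
  rw [EE, LinearMap.sum_apply]
  refine Submodule.sum_mem _ fun a _ => ?_
  rw [Module.End.mul_apply]
  apply sl_FS
  refine FS_map (r := p) (Z := sr (om _ (A.pbr_alt (A.th a)))) (V := FS K G S p) (fun s q w hq hw => ?_) hz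
  rw [sr_t]
  obtain ⟨q, rfl⟩ : ∃ q', q = q' + 2 := ⟨q - 2, by omega⟩
  exact tm_FS (by omega) _ (om_mem _ _ hw)

lemma FS_mono {p q : ℕ} (h : p ≤ q) : FS K G S q ≤ FS K G S p := by
  rw [FS, FS]
  apply Submodule.span_mono
  rintro _ ⟨s, w, r, hr, hw, rfl⟩
  exact ⟨s, w, r, h.trans hr, hw, rfl⟩

/-- evaluation functional -/
def ev (f : Module.Dual K S) : Module.Dual K (ST K G S) :=
  TensorProduct.lift ((LinearMap.mul K K).compl₁₂ f eps0)
lemma ev_t (f : Module.Dual K S) (s : S) (w : Lam K G) : ev f (tm s w) = f s * eps0 w := rfl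

lemma ev_FS (f : Module.Dual K S) {p : ℕ} {z : ST K G S} (hz : z ∈ FS K G S (p + 1)) : ev f z = 0 := by
  have := FS_map (r := 0) (Z := ev f) (V := ⊥) (fun s q w hq hw => ?_) hz
  · exact this
  · obtain ⟨q, rfl⟩ : ∃ q', q = q' + 1 := ⟨q - 1, by omega⟩
    rw [Submodule.mem_bot, ev_t, eps0_pos hw, mul_zero]

lemma ev_e (f : Module.Dual K S) (x : G) (z : ST K G S) : ev f (eS x z) = 0 := by
  have : ev f ∘ₗ eS x = 0 := tm_ext fun s w => by
    rw [LinearMap.comp_apply, eS, sr_t, ev_t, eps0_e, mul_zero]; rfl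
  exact LinearMap.congr_fun this z

lemma eps0_bd (β : G →ₗ[K] Module.End K G) (hβ) (w : Lam K G) : eps0 (bd β hβ w) = 0 := by
  have : eps0 ∘ₗ bd β hβ = 0 := by
    apply op_eqOn
    · simp [bd_one]
    · intro x w h
      have := LinearMap.congr_fun (bd_e β hβ x) w
      simp only [Module.End.mul_apply, LinearMap.add_apply, LinearMap.neg_apply] at this
      rw [LinearMap.comp_apply, this, map_add, map_neg, eps0_e, neg_zero, zero_add, LinearMap.zero_apply]
      have h2 : eps0 ∘ₗ der (β x) = 0 := by
        apply op_eqOn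
        · simp [der_one]
        · intro y w h
          have := LinearMap.congr_fun (der_e (β x) y) w
          simp only [Module.End.mul_apply, LinearMap.add_apply] at this
          rw [LinearMap.comp_apply, this, map_add, eps0_e, eps0_e, LinearMap.zero_apply, add_zero]
      exact LinearMap.congr_fun h2 w
  exact LinearMap.congr_fun this w

lemma ev_dd (f : Module.Dual K S) (z : ST K G S) : ev f (sr A.dd z) = 0 := by
  have : ev f ∘ₗ sr A.dd = 0 := tm_ext fun s w => by
    rw [LinearMap.comp_apply, sr_t, ev_t, dd, eps0_bd, mul_zero]; rfl
  exact LinearMap.congr_fun this z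

end Fr

namespace Co
variable {K : Type*} [CommRing K] {G : Type*} [AddCommGroup G] [Module K G] {ι : Type*} [Fintype ι]
variable {A : Fr K G ι} {S : Type*} [AddCommGroup S] [Module K S] (B : Co A S)
open Fr

def CC : Module.End K (ST K G S) := ∑ a, sl (B.X (A.hb a)) * sr (A.co a)

lemma CC_one (s : S) : B.CC (tm s 1) = 0 := by
  simp [CC, LinearMap.sum_apply, sl_t, sr_t, co, om_one]

lemma CC_e (x : G) : B.CC * eS x - eS x * B.CC = A.ctS (B.X ∘ₗ A.br (A.pr x)) - A.kt B.X (A.br x) := by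
  have h : B.CC * eS x - eS x * B.CC = ∑ a, sl (B.X (A.hb a)) * sr (ct (A.c a ∘ₗ A.curv x)) := by
    rw [CC, Finset.sum_mul, Finset.mul_sum, ← Finset.sum_sub_distrib]
    refine Finset.sum_congr rfl fun a _ => ?_
    rw [co, slsr_om]
    rfl
  rw [h, ← sub_eq_zero]
  apply st_anti0
  · intro s; simp [LinearMap.sum_apply, sl_t, sr_t, ct_one, kt_one, ctS_one]
  · intro y
    have e1 := A.kt_e B.X (A.br x) y
    have e2 := A.ctS_e (B.X ∘ₗ A.br (A.pr x)) y
    have e3 : (∑ a, sl (B.X (A.hb a)) * sr (ct (A.c a ∘ₗ A.curv x))) * eS y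
      + eS y * (∑ a, sl (B.X (A.hb a)) * sr (ct (A.c a ∘ₗ A.curv x))) = sl (B.X (A.curv x y)) := by
      rw [← A.c_sum B.X (A.curv_mem x y), Finset.sum_mul, Finset.mul_sum, ← Finset.sum_add_distrib, map_sum]
      refine Finset.sum_congr rfl fun a _ => ?_
      rw [slsr_ct, map_smul]; rfl
    rw [curv_apply, map_sub, map_sub] at e3
    rw [LinearMap.comp_apply] at e2
    linear_combination (norm := noncomm_ring) e3 + e1 - e2

lemma CC_eq : A.EE B.X + A.EE B.X + B.W + (B.CC + B.CC) = 0 := by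
  apply st_comm0
  · intro s; simp [EE_one, CC_one, W, T, R, ctS_one]
  · intro x
    have h1 := B.CC_e x
    have h2 := B.W_e x
    have h3 := A.EE_e B.X x
    rw [neg_smul, two_smul] at h2
    linear_combination (norm := noncomm_ring) h1 + h1 + h2 + h3 + h3

lemma R_one (w : Lam K G) : B.R (tm B.one w) = 0 := by
  simp [R, ctS, LinearMap.sum_apply, sl_t, sr_t, B.ro_one]

lemma ev_R (f : Module.Dual K S) (hf : ∀ x ∈ A.hs, ∀ s, f (B.ro x s) = 0) (z : ST K G S) : ev f (B.R z) = 0 := by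
  have : ev f ∘ₗ B.R = 0 := tm_ext fun s w => by
    rw [LinearMap.comp_apply, R, ctS, LinearMap.sum_apply, map_sum, LinearMap.zero_apply]
    refine Finset.sum_eq_zero fun a _ => ?_
    rw [Module.End.mul_apply, sr_t, sl_t, ev_t, hf _ (A.hb_mem a), zero_mul]
  exact LinearMap.congr_fun this z

lemma half_half {V : Type*} [AddCommGroup V] [Module K V] [Algebra ℚ K] (v : V) :
    algebraMap ℚ K (1/2) • v + algebraMap ℚ K (1/2) • v = v := by
  rw [← add_smul, ← map_add]; norm_num

theorem homotopy [Algebra ℚ K] (f : Module.Dual K S) (hf : ∀ x ∈ A.hs, ∀ s, f (B.ro x s) = 0) {u : G} (hu : u ∈ A.hs)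
    {j : ℕ} {ζ z : Lam K G} (hz : z ∈ Dg K G (2 * j)) (hζ : A.dd ζ = e u ζ - e u z) :
    ev f (tm ((B.X u ^ j) B.one) ζ) = (-1) ^ j * ev f ((B.CC ^ j) (tm B.one ζ)) := by
  rcases Nat.eq_zero_or_pos j with hj | hj
  · subst hj; simp
  let w : Module.End K (ST K G S) := algebraMap ℚ K (1/2) • B.W
  have hw : B.W = w + w := (half_half B.W).symm
  have hinj : ∀ {v v' : Module.End K (ST K G S)}, v + v = v' + v' → v = v' := by
    intro v v' h
    have := congrArg (fun t => algebraMap ℚ K (1/2) • t) h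
    simp only [smul_add, half_half] at this
    exact this
  have hsum : sl (B.X u) + B.FF u + w = - B.CC := by
    apply hinj
    have := B.CC_eq
    rw [hw] at this
    rw [FF]
    linear_combination (norm := noncomm_ring) this
  have hΔ : De A S u (tm B.one ζ) = - tm B.one (e u z) := by
    rw [De, LinearMap.sub_apply, sr_t, hζ, eS, sr_t, map_sub]; abel
  let Λ : Module.End K (ST K G S) →+ K :=
    { toFun := fun Q => ev f (Q (tm B.one ζ)), map_zero' := by simp, map_add' := by intro a b; simp }
  have hΛ : ∀ Q, Λ Q = ev f (Q (tm B.one ζ)) := fun Q => rfl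
  have main := homot (x := sl (B.X u)) (f := B.FF u) (w := w) (D := De A S u) (R := B.R) (T := B.T) ?_ (B.t1 hu)
    ?_ ?_ (B.XT u) (B.FT hu) ?_ (B.TDe hu) hw j ?_ Λ ?_ ?_ ?_ ?_
  · rw [hsum, hΛ, hΛ, ← map_pow, sl_t, neg_pow, Module.End.mul_apply] at main
    rw [main]
    have : ∀ z, ((-1 : Module.End K (ST K G S)) ^ j) z = (-1 : K) ^ j • z := by
      intro z
      rcases Nat.even_or_odd j with h | h
      · simp [h.neg_one_pow]
      · simp [h.neg_one_pow]
    rw [this, map_smul, smul_eq_mul]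
  · rw [De, mul_sub, sub_mul, sl_e, sl_sr]
  · apply hinj
    have := B.t2 hu
    rw [hw] at this
    linear_combination (norm := noncomm_ring) this
  · apply hinj
    have := B.WR
    rw [hw] at this
    linear_combination (norm := noncomm_ring) this
  · apply hinj
    have := B.WT
    rw [hw] at this
    linear_combination (norm := noncomm_ring) this
  · intro m k h
    have h2 : ((m + 1 : ℕ) : K) * k = 0 := by rw [← nsmul_eq_mul]; exact h
    exact (unit_nat (K := K) (Nat.succ_ne_zero m)).mul_right_eq_zero.1 h2
  · intro Q
    rw [hΛ, Module.End.mul_apply, De, LinearMap.sub_apply, map_sub, A.ev_dd, ev_e, sub_zero]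
  · intro Q
    rw [hΛ, Module.End.mul_apply, B.ev_R f hf]
  · intro Q
    rw [hΛ, Module.End.mul_apply, B.R_one, map_zero, map_zero]
  · intro k
    rw [hΛ, Module.End.mul_apply, Module.End.mul_apply, hΔ, map_neg, map_neg, map_neg, neg_eq_zero]
    rcases j with _ | j
    · omega
    simp only [Nat.add_sub_cancel]
    have hB : ∀ i p k z, z ∈ FS K G S (p + 2 * i) → ((BP (sl (B.X u)) (B.FF u) w) ^ i).coeff k z ∈ FS K G S p := by
      intro i
      induction i with
      | zero =>
        intro p k z hz
        rw [pow_zero, Polynomial.coeff_one]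
        split_ifs
        · exact hz
        · exact zero_mem _
      | succ i ih =>
        intro p k z hz
        rw [pow_succ, Polynomial.coeff_mul, LinearMap.sum_apply]
        refine Submodule.sum_mem _ fun ab _ => ?_
        rw [Module.End.mul_apply]
        apply ih
        have hz1 : z ∈ FS K G S (p + 2 * i + 2) := hz
        have hz2 : z ∈ FS K G S (p + 2 * i) := FS_mono (by omega) hz
        rw [BP_coeff]
        split_ifs
        · exact sl_FS _ hz2
        · rw [FF, LinearMap.sub_apply]
          exact Submodule.sub_mem _ (A.EE_FS _ hz1) (sl_FS _ hz2)
        · change algebraMap ℚ K (1/2) • (B.T (B.R z) + B.R (B.T z)) ∈ _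
          exact Submodule.smul_mem _ _ (Submodule.add_mem _ (A.ctS_FS _ (A.ctS_FS _ hz1)) (A.ctS_FS _ (A.ctS_FS _ hz1)))
        · exact zero_mem _
    apply ev_FS (p := 0)
    apply hB
    apply A.ctS_FS
    exact tm_FS (by omega) _ (e_mem u hz)

end Co
end frame4
end CW

namespace CW
section frame5
namespace Co
variable {K : Type*} [CommRing K] {G : Type*} [AddCommGroup G] [Module K G] {ι : Type*} [Fintype ι]
variable {A : Fr K G ι} {S : Type*} [AddCommGroup S] [Module K S] (B : Co A S)
open Fr

/-- the functional on the exterior algebra -/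
def phi (f : Module.Dual K S) (j : ℕ) : Module.Dual K (Lam K G) := ev f ∘ₗ (B.CC ^ j) ∘ₗ tm B.one
lemma phi_apply (f : Module.Dual K S) (j : ℕ) (w : Lam K G) : B.phi f j w = ev f ((B.CC ^ j) (tm B.one w)) := rfl

lemma CC_D [Algebra ℚ K] : Commute B.CC (sr A.dd + B.R) := by
  have h0 : (0 : G) ∈ A.hs := zero_mem _
  have hD : De A S 0 = sr A.dd := by rw [De, eS, e_zero, map_zero, sub_zero]
  have hF : B.FF 0 = A.EE B.X := by rw [FF, map_zero, map_zero, sub_zero]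
  have h1 := B.t1 h0
  have h2 := B.t2 h0
  rw [hF, hD] at h1 h2
  rw [map_zero, map_zero, zero_mul, mul_zero, add_zero, add_zero] at h1
  have h3 := B.WR
  have h4 := B.CC_eq
  have h5 : (B.CC * (sr A.dd + B.R) - (sr A.dd + B.R) * B.CC) + (B.CC * (sr A.dd + B.R) - (sr A.dd + B.R) * B.CC) = 0 := by
    linear_combination (norm := noncomm_ring) h4 * (sr A.dd + B.R) - (sr A.dd + B.R) * h4 - 2 * h1 - h2 - h3
  have h6 := congrArg (fun t => algebraMap ℚ K (1/2) • t) h5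
  simp only [smul_add, half_half, smul_zero] at h6
  exact sub_eq_zero.1 h6

lemma phi_dd [Algebra ℚ K] (f : Module.Dual K S) (hf : ∀ x ∈ A.hs, ∀ s, f (B.ro x s) = 0) (j : ℕ) (w : Lam K G) :
    B.phi f j (A.dd w) = 0 := by
  have h1 : tm B.one (A.dd w) = (sr A.dd + B.R : Module.End K (ST K G S)) (tm B.one w) := by
    rw [LinearMap.add_apply, sr_t, B.R_one, add_zero]
  rw [phi_apply, h1, ← Module.End.mul_apply, (B.CC_D.pow_left j).eq, Module.End.mul_apply, LinearMap.add_apply, map_add,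
    A.ev_dd, B.ev_R f hf, add_zero]

lemma phi_e (f : Module.Dual K S) (j : ℕ) {x : G} (hx : x ∈ A.hs) (w : Lam K G) :
    B.phi f j (e x w) = 0 := by
  have h0 : A.ctS (B.X ∘ₗ A.br x) = A.kt B.X (A.br x) := by
    apply kt_uniq
    · intro s; exact ctS_one _ _ _
    · intro y; rw [ctS_e, LinearMap.comp_apply, A.pr_eq x hx]
  have h1 := B.CC_e x
  rw [A.pr_id x hx, h0, sub_self] at h1
  have h2 : Commute B.CC (eS x) := sub_eq_zero.1 h1
  have h3 : tm B.one (e x w) = eS x (tm B.one w) := rfl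
  rw [phi_apply, h3, ← Module.End.mul_apply, (h2.pow_left j).eq, Module.End.mul_apply, ev_e]

lemma phi_L [Algebra ℚ K] (f : Module.Dual K S) (hf : ∀ x ∈ A.hs, ∀ s, f (B.ro x s) = 0) (j : ℕ) {x : G} (hx : x ∈ A.hs) (w : Lam K G) :
    B.phi f j (der (A.br x) w) = 0 := by
  have h := LinearMap.congr_fun (bd_e A.br A.alt x) w
  have h2 : der (A.br x) w = A.dd (e x w) + e x (A.dd w) := by
    simp only [Module.End.mul_apply, LinearMap.add_apply, LinearMap.neg_apply] at h
    change A.dd (e x w) = - (e x (A.dd w)) + _ at h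
    rw [h]; abel
  rw [h2, map_add, B.phi_dd f hf, B.phi_e f j hx, add_zero]

lemma CC_t (s : S) (w : Lam K G) : B.CC (tm s w) = ∑ a, tm (B.X (A.hb a) s) (A.co a w) := by
  rw [CC, LinearMap.sum_apply]
  rfl

lemma ev_CC_ne (f : Module.Dual K S) (j : ℕ) : ∀ (q : ℕ) (s : S) (w : Lam K G), w ∈ Dg K G q → q ≠ 2 * j →
    ev f ((B.CC ^ j) (tm s w)) = 0 := by
  induction j with
  | zero =>
    intro q s w hw hq
    obtain ⟨q, rfl⟩ : ∃ q', q = q' + 1 := ⟨q - 1, by omega⟩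
    rw [pow_zero, Module.End.one_apply, ev_t, eps0_pos hw, mul_zero]
  | succ j ih =>
    intro q s w hw hq
    rw [pow_succ, Module.End.mul_apply, CC_t, map_sum, map_sum]
    refine Finset.sum_eq_zero fun a _ => ?_
    rcases q with _ | _ | q
    · rw [co, om_zero_deg _ _ hw]; simp
    · rw [co, om_one_deg _ _ hw]; simp
    · exact ih q _ _ (om_mem _ _ hw) (by omega)

lemma phi_ne (f : Module.Dual K S) (j : ℕ) {q : ℕ} {w : Lam K G} (hw : w ∈ Dg K G q) (hq : q ≠ 2 * j) : B.phi f j w = 0 :=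
  B.ev_CC_ne f j q _ w hw hq

/-- injectivity, abstract form -/
theorem phi_inj [Algebra ℚ K] (f : Module.Dual K S) (hf : ∀ x ∈ A.hs, ∀ s, f (B.ro x s) = 0) {u : G} (hu : u ∈ A.hs)
    {η : Op K G} {d : ℕ} (hη1 : ∀ p, ∀ w ∈ Dg K G p, η w ∈ Dg K G (p+1))
    (hη2 : ∀ p, 1 ≤ p → p ≤ d → ∀ w ∈ Dg K G p, A.dd (η w) + η (A.dd w) = w)
    (hη3 : der (A.br u) * η = η * der (A.br u)) {j : ℕ} (hj : 2 * j ≤ d)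
    {b : Module.Dual K (Lam K G)} (hb : ∀ w, b (e u w) = 0) (hφ : ∀ w ∈ Dg K G (2 * j), 0 < j → B.phi f j w = b (A.dd w)) :
    0 < j → f ((B.X u ^ j) B.one) = 0 := by
  intro hj0
  let ζ : ℕ → Lam K G := fun k => ((η * e u) ^ k : Op K G) 1
  have hs : ∀ k, ζ (k + 1) = η (e u (ζ k)) := fun k => by
    simp only [ζ, pow_succ', Module.End.mul_apply]
  have h0 : ζ 0 = 1 := by simp [ζ]
  have hdeg : ∀ k, ζ k ∈ Dg K G (2 * k) := by
    intro k
    induction k with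
    | zero => rw [h0]; exact one_mem
    | succ k ih => rw [hs]; exact hη1 _ _ (e_mem u ih)
  have hL : ∀ k, der (A.br u) (ζ k) = 0 := by
    intro k
    induction k with
    | zero => rw [h0, der_one]
    | succ k ih =>
      have e1 := LinearMap.congr_fun hη3 (e u (ζ k))
      have e2 := LinearMap.congr_fun (der_e (A.br u) u) (ζ k)
      simp only [Module.End.mul_apply, LinearMap.add_apply] at e1 e2
      rw [hs, e1, e2, ih, map_zero, zero_add, A.alt, e_zero, LinearMap.zero_apply, map_zero]
  have hddE : ∀ w, A.dd (e u w) = - e u (A.dd w) + der (A.br u) w := fun w => LinearMap.congr_fun (bd_e A.br A.alt u) w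
  have hee : ∀ w, e u (e u w) = 0 := fun w => LinearMap.congr_fun (e_sq (K := K) u) w
  have hdd0 : A.dd (ζ 0) = 0 := by rw [h0]; exact bd_one _ _
  have hdd : ∀ k, k + 1 ≤ j → A.dd (ζ (k + 1)) = e u (ζ k) := by
    intro k
    induction k with
    | zero =>
      intro hk
      have := hη2 1 le_rfl (by omega) (e u (ζ 0)) (e_mem (p := 0) u (hdeg 0))
      rw [hddE, hL, hdd0] at this
      rw [hs]
      simpa using this
    | succ k ih =>
      intro hk
      have := hη2 (2 * (k + 1) + 1) (by omega) (by omega) (e u (ζ (k + 1))) (e_mem u (hdeg _))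
      rw [hddE, hL, ih (by omega), hee] at this
      rw [hs]
      simpa using this
  have hsum : A.dd (∑ k ∈ Finset.range (j + 1), ζ k) = e u (∑ k ∈ Finset.range (j + 1), ζ k) - e u (ζ j) := by
    rw [map_sum, map_sum, Finset.sum_range_succ', Finset.sum_range_succ, hdd0, add_zero, add_sub_cancel_right]
    exact Finset.sum_congr rfl fun k hk => hdd k (by have := Finset.mem_range.1 hk; omega)
  have main := B.homotopy f hf hu (hdeg j) hsum
  rw [ev_t, map_sum, Finset.sum_eq_single 0, h0, eps0_one, mul_one] at main
  · rw [main, ← phi_apply, map_sum, Finset.sum_eq_single j]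
    · rw [hφ _ (hdeg j) hj0]
      obtain ⟨i, rfl⟩ : ∃ i, j = i + 1 := ⟨j - 1, by omega⟩
      rw [hdd i le_rfl, hb, mul_zero]
    · intro k _ hk
      exact B.phi_ne f j (hdeg k) (by omega)
    · intro h; simp at h
  · intro k _ hk
    obtain ⟨i, rfl⟩ : ∃ i, k = i + 1 := ⟨k - 1, by omega⟩
    exact eps0_pos (hdeg (i + 1))
  · intro h; simp at h

end Co
end frame5
end CW

namespace CW
section poly
open MvPolynomial
variable {K : Type*} [CommRing K] {G : Type*} [AddCommGroup G] [Module K G] {ι : Type*} [Fintype ι]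

lemma perm_of_single {j : ℕ} {a b : Fin j → ι} (h : ∑ t, Finsupp.single (a t) 1 = ∑ t, Finsupp.single (b t) (1 : ℕ)) :
    ∃ σ : Equiv.Perm (Fin j), a = b ∘ σ := by
  classical
  have hc : ∀ c, Nonempty ({t // a t = c} ≃ {t // b t = c}) := by
    intro c
    rw [← Fintype.card_eq, Fintype.card_subtype, Fintype.card_subtype, Finset.card_filter, Finset.card_filter]
    have := congrArg (fun f => f c) h
    simpa [Finsupp.finsetSum_apply, Finsupp.single_apply] using this
  refine ⟨Equiv.ofFiberEquiv (fun c => (hc c).some), ?_⟩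
  funext t
  exact (Equiv.ofFiberEquiv_map (fun c => (hc c).some) t).symm

/-- linear forms -/
def lin : (ι → K) →ₗ[K] MvPolynomial ι K := ∑ a, (LinearMap.proj a).smulRight (X a)
lemma lin_apply (q : ι → K) : lin q = ∑ a, q a • (X a : MvPolynomial ι K) := by simp [lin, LinearMap.sum_apply]
lemma lin_single [DecidableEq ι] (a : ι) : lin (Pi.single a (1 : K)) = X a := by
  rw [lin_apply, Finset.sum_eq_single a]
  · simp
  · intro b _ hb; simp [hb]
  · simp

lemma prod_X_eq {m : ℕ} (a : Fin m → ι) : (∏ t, X (a t) : MvPolynomial ι K) = monomial (∑ t, Finsupp.single (a t) 1) 1 := by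
  rw [monomial_sum_one]; rfl

lemma poly_ext {N : Type*} [AddCommGroup N] [Module K N] {g g' : MvPolynomial ι K →ₗ[K] N}
    (h : ∀ (m : ℕ) (a : Fin m → ι), g (∏ t, X (a t)) = g' (∏ t, X (a t))) : g = g' := by
  have hV : ∀ p : MvPolynomial ι K, p ∈ Submodule.span K {p | ∃ (m : ℕ) (a : Fin m → ι), p = ∏ t, X (a t)} := by
    intro p
    induction p using MvPolynomial.induction_on with
    | C k =>
      rw [← mul_one (C k), ← smul_eq_C_mul]
      exact Submodule.smul_mem _ _ (Submodule.subset_span ⟨0, Fin.elim0, by simp⟩)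
    | add p q hp hq => exact Submodule.add_mem _ hp hq
    | mul_X p i hp =>
      have : Submodule.span K {p : MvPolynomial ι K | ∃ (m : ℕ) (a : Fin m → ι), p = ∏ t, X (a t)} ≤
          (Submodule.span K {p | ∃ (m : ℕ) (a : Fin m → ι), p = ∏ t, X (a t)}).comap (LinearMap.mulRight K (X i)) := by
        rw [Submodule.span_le]
        rintro _ ⟨m, a, rfl⟩
        refine Submodule.subset_span ⟨m + 1, Fin.cons i a, ?_⟩
        rw [Fin.prod_univ_succ]
        simp [mul_comm]
      exact this hp
  refine LinearMap.ext fun p => ?_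
  have : Submodule.span K {p : MvPolynomial ι K | ∃ (m : ℕ) (a : Fin m → ι), p = ∏ t, X (a t)} ≤ LinearMap.eqLocus g g' := by
    rw [Submodule.span_le]
    rintro _ ⟨m, a, rfl⟩
    exact h m a
  exact this (hV p)

lemma deriv_prod (D : Derivation K (MvPolynomial ι K) (MvPolynomial ι K)) {m : ℕ} (f : Fin m → MvPolynomial ι K)
    (s : Finset (Fin m)) : D (∏ t ∈ s, f t) = ∑ t ∈ s, ∏ i ∈ s, Function.update f t (D (f t)) i := by
  classical
  induction s using Finset.induction_on with
  | empty => simp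
  | insert i s hi ih =>
    rw [Finset.prod_insert hi, Derivation.leibniz, ih, Finset.sum_insert hi, Finset.prod_insert hi, Function.update_self,
      smul_eq_mul, smul_eq_mul, add_comm, mul_comm]
    congr 1
    · congr 1
      refine Finset.prod_congr rfl fun t ht => ?_
      rw [Function.update_of_ne (by rintro rfl; exact hi ht)]
    · rw [Finset.mul_sum]
      refine Finset.sum_congr rfl fun t ht => ?_
      rw [Finset.prod_insert hi, Function.update_of_ne (by rintro rfl; exact hi ht)]

open Classical in
/-- functional attached to a symmetric form -/
def Ph (hb : ι → G) {j : ℕ} (P : MultilinearMap K (fun _ : Fin j => G) K) : Module.Dual K (MvPolynomial ι K) :=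
  (basisMonomials ι K).constr K (fun m => if h : ∃ a : Fin j → ι, ∑ t, Finsupp.single (a t) 1 = m then P (hb ∘ h.choose) else 0)

lemma Ph_X (hb : ι → G) {j : ℕ} (P : MultilinearMap K (fun _ : Fin j => G) K)
    (hP : ∀ (w : Fin j → G) (σ : Equiv.Perm (Fin j)), P (w ∘ σ) = P w) (a : Fin j → ι) :
    Ph hb P (∏ t, X (a t)) = P (hb ∘ a) := by
  classical
  rw [prod_X_eq]
  change Ph hb P (basisMonomials ι K _) = _
  rw [Ph, Module.Basis.constr_basis]
  have h : ∃ b : Fin j → ι, ∑ t, Finsupp.single (b t) 1 = ∑ t, Finsupp.single (a t) 1 := ⟨a, rfl⟩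
  rw [dif_pos h]
  obtain ⟨σ, hσ⟩ := perm_of_single h.choose_spec
  rw [hσ, ← Function.comp_assoc, hP]

lemma Ph_ne (hb : ι → G) {j : ℕ} (P : MultilinearMap K (fun _ : Fin j => G) K)
    {m : ℕ} (hm : m ≠ j) (a : Fin m → ι) :
    Ph hb P (∏ t, X (a t)) = 0 := by
  classical
  rw [prod_X_eq]
  change Ph hb P (basisMonomials ι K _) = _
  rw [Ph, Module.Basis.constr_basis]
  rw [dif_neg]
  rintro ⟨b, hb⟩
  apply hm
  have h2 := congrArg Finsupp.degree hb
  simpa using h2.symm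

lemma prod_lin {m : ℕ} (q : Fin m → ι → K) : ∏ t, lin (q t) = ∑ r : Fin m → ι, (∏ t, q t (r t)) • ∏ t, (X (r t) : MvPolynomial ι K) := by
  classical
  simp only [lin_apply]
  rw [Finset.prod_univ_sum, Fintype.piFinset_univ]
  refine Finset.sum_congr rfl fun r _ => ?_
  rw [Finset.prod_smul]

lemma Ph_lin (hb : ι → G) {j : ℕ} (P : MultilinearMap K (fun _ : Fin j => G) K)
    (hP : ∀ (w : Fin j → G) (σ : Equiv.Perm (Fin j)), P (w ∘ σ) = P w) (q : Fin j → ι → K) :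
    Ph hb P (∏ t, lin (q t)) = P (fun t => ∑ a, q t a • hb a) := by
  classical
  rw [prod_lin, map_sum, MultilinearMap.map_sum]
  refine Finset.sum_congr rfl fun r _ => ?_
  rw [map_smul, Ph_X hb P hP, MultilinearMap.map_smul_univ]; rfl

lemma Ph_lin_ne (hb : ι → G) {j : ℕ} (P : MultilinearMap K (fun _ : Fin j => G) K)
    {m : ℕ} (hm : m ≠ j) (q : Fin m → ι → K) :
    Ph hb P (∏ t, lin (q t)) = 0 := by
  rw [prod_lin, map_sum]
  refine Finset.sum_eq_zero fun r _ => ?_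
  rw [map_smul, Ph_ne hb P hm, smul_zero]

namespace Fr
variable (A : Fr K G ι)
/-- the tautological linear form -/
def ell : G →ₗ[K] MvPolynomial ι K := lin ∘ₗ LinearMap.pi A.c
lemma ell_apply (x : G) : A.ell x = lin (fun a => A.c a x) := rfl
lemma ell_sum (x : G) : A.ell x = ∑ a, A.c a x • X a := by rw [ell_apply, lin_apply]

def roD : G →ₗ[K] Derivation K (MvPolynomial ι K) (MvPolynomial ι K) where
  toFun x := mkDerivation K (fun b => A.ell (A.br x (A.hb b)))
  map_add' x y := by apply derivation_ext; intro i; simp [mkDerivation_X]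
  map_smul' k x := by apply derivation_ext; intro i; simp [mkDerivation_X]
lemma roD_X (x : G) (b : ι) : A.roD x (X b) = A.ell (A.br x (A.hb b)) := mkDerivation_X _ _ _
lemma roD_ell (x : G) {y : G} (hy : y ∈ A.hs) : A.roD x (A.ell y) = A.ell (A.br x y) := by
  rw [A.ell_sum y, map_sum]
  simp only [Derivation.map_smul, roD_X]
  exact A.c_sum (A.ell ∘ₗ A.br x) hy

/-- polynomial coefficients -/
def pco : Co A (MvPolynomial ι K) where
  X := LinearMap.mul K _ ∘ₗ A.ell
  ro := { toFun := fun x => (A.roD x).toLinearMap, map_add' := by intro x y; rw [map_add]; rfl, map_smul' := by intro k x; rw [map_smul]; rfl }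
  XX x y := by refine LinearMap.ext fun p => ?_; simp [mul_left_comm]
  roX x hx y hy := by
    refine LinearMap.ext fun p => ?_
    simp [roD_ell A x hy]; ring
  roro x hx y hy := by
    have h : ⁅A.roD x, A.roD y⁆ = A.roD (A.br x y) := by
      apply derivation_ext
      intro i
      rw [Derivation.commutator_apply, roD_X, roD_X, roD_X, roD_ell _ _ (A.br_mem hy (A.hb_mem i)), roD_ell _ _ (A.br_mem hx (A.hb_mem i)), A.jac]
      simp
    refine LinearMap.ext fun p => ?_
    have := congrArg (fun D => D p) h
    simpa [Derivation.commutator_apply] using this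
  one := 1
  ro_one x := by simp

lemma pco_X (x : G) (p : MvPolynomial ι K) : A.pco.X x p = A.ell x * p := rfl

/-- invariant symmetric forms -/
structure Inv (j : ℕ) (P : MultilinearMap K (fun _ : Fin j => G) K) : Prop where
  symm : ∀ (w : Fin j → G) (σ : Equiv.Perm (Fin j)), P (w ∘ σ) = P w
  inv : ∀ x ∈ A.hs, ∀ w : Fin j → G, (∀ r, w r ∈ A.hs) → ∑ r, P (Function.update w r (A.br x (w r))) = 0

variable {A} {j : ℕ} {P : MultilinearMap K (fun _ : Fin j => G) K}

lemma Inv.ell (hP : Inv A j P) (w : Fin j → G) (hw : ∀ r, w r ∈ A.hs) : Ph A.hb P (∏ t, A.ell (w t)) = P w := by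
  simp only [ell_apply]
  rw [Ph_lin A.hb P hP.symm]
  congr 1; funext t; exact A.frame _ (hw t)

lemma Inv.ro (hP : Inv A j P) (x : G) (hx : x ∈ A.hs) (p : MvPolynomial ι K) : Ph A.hb P (A.pco.ro x p) = 0 := by
  classical
  have : Ph A.hb P ∘ₗ A.pco.ro x = 0 := by
    apply poly_ext
    intro m a
    have h1 : A.pco.ro x (∏ t, X (a t)) = ∑ t, ∏ i, lin (Function.update (fun i => Pi.single (a i) 1) t (fun b => A.c b (A.br x (A.hb (a t)))) i) := by
      change A.roD x _ = _
      rw [deriv_prod]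
      refine Finset.sum_congr rfl fun t _ => ?_
      refine Finset.prod_congr rfl fun i _ => ?_
      rcases eq_or_ne i t with rfl | h
      · simp only [Function.update_self, roD_X]; rfl
      · simp only [Function.update_of_ne h, lin_single]
    rw [LinearMap.comp_apply, h1, map_sum, LinearMap.zero_apply]
    by_cases hm : m = j
    · subst hm
      rw [← hP.inv x hx (A.hb ∘ a) (fun r => A.hb_mem _)]
      refine Finset.sum_congr rfl fun t _ => ?_
      rw [Ph_lin A.hb P hP.symm]
      congr 1; funext i
      rcases eq_or_ne i t with rfl | h
      · simp only [Function.update_self]; exact A.frame _ (A.br_mem hx (A.hb_mem _))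
      · simp only [Function.update_of_ne h, Function.comp_apply]
        rw [Finset.sum_eq_single (a i)]
        · simp
        · intro b _ hb; simp [hb]
        · simp
    · exact Finset.sum_eq_zero fun t _ => Ph_lin_ne A.hb P hm _
  exact LinearMap.congr_fun this p

end Fr
end poly
end CW

namespace CW
section comb
variable {K : Type*} [CommRing K] {G : Type*} [AddCommGroup G] [Module K G]

lemma cons_sA {α : Type*} {p : ℕ} (x : α) (v : Fin (p+1) → α) (k : Fin (p+1)) :
    (Fin.cons x v : Fin (p+2) → α) ∘ k.succ.succAbove = Fin.cons x (v ∘ k.succAbove) := by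
  funext t
  refine Fin.cases ?_ (fun t => ?_) t
  · simp
  · simp

lemma cons_sA0 {α : Type*} {p : ℕ} (x : α) (v : Fin p → α) :
    (Fin.cons x v : Fin (p+1) → α) ∘ (0 : Fin (p+1)).succAbove = v := by
  funext t; simp

lemma ct_mw (f : Module.Dual K G) : ∀ {p : ℕ} (v : Fin (p+1) → G),
    ct f (mw (p+1) v) = ∑ i : Fin (p+1), ((-1:K)^i.1 * f (v i)) • mw p (v ∘ i.succAbove) := by
  have key : ∀ (x : G) (m : Lam K G), ct f (e x m) = f x • m - e x (ct f m) := by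
    intro x m
    have := LinearMap.congr_fun (ct_e f x) m
    simp only [Module.End.mul_apply, LinearMap.add_apply, LinearMap.smul_apply, Module.End.one_apply] at this
    rw [← this]; abel
  intro p
  induction p with
  | zero =>
    intro v
    rw [mw_succ, key, mw_zero, ct_one]
    simp [mw_zero]
  | succ p ih =>
    intro v
    obtain ⟨x, v, rfl⟩ : ∃ x v', v = Fin.cons x v' := ⟨v 0, Fin.tail v, (Fin.cons_self_tail v).symm⟩
    conv_rhs => rw [Fin.sum_univ_succ, cons_sA0]
    rw [mw_cons, key, ih]
    simp only [cons_sA, mw_cons, Fin.cons_zero, Fin.cons_succ, Fin.val_zero, pow_zero, one_mul, Fin.val_succ, map_sum, map_smul]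
    rw [sub_eq_add_neg, ← Finset.sum_neg_distrib]
    congr 1
    refine Finset.sum_congr rfl fun i _ => ?_
    rw [pow_succ, ← neg_smul]; congr 1; ring

lemma om_mw (β : G →ₗ[K] Module.Dual K G) (hβ) : ∀ {p : ℕ} (v : Fin (p+1) → G),
    om β hβ (mw (p+1) v) + om β hβ (mw (p+1) v) = ∑ i : Fin (p+1), (-1:K)^i.1 • ct (β (v i)) (mw p (v ∘ i.succAbove)) := by
  have key : ∀ (x : G) (m : Lam K G), om β hβ (e x m) = e x (om β hβ m) + ct (β x) m := by
    intro x m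
    have := LinearMap.congr_fun (om_e β hβ x) m
    simpa using this
  have key2 : ∀ (f : Module.Dual K G) (x : G) (m : Lam K G), ct f (e x m) = f x • m - e x (ct f m) := by
    intro f x m
    have := LinearMap.congr_fun (ct_e f x) m
    simp only [Module.End.mul_apply, LinearMap.add_apply, LinearMap.smul_apply, Module.End.one_apply] at this
    rw [← this]; abel
  intro p
  induction p with
  | zero =>
    intro v
    rw [mw_succ, key, mw_zero, ct_one, om_one]
    simp [mw_zero, ct_one]
  | succ p ih =>
    intro v
    obtain ⟨x, v, rfl⟩ : ∃ x v', v = Fin.cons x v' := ⟨v 0, Fin.tail v, (Fin.cons_self_tail v).symm⟩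
    rw [mw_cons, key]
    have h1 : ∀ a b : Lam K G, a + b + (a + b) = (a + a) + b + b := by intros; abel
    conv_rhs => rw [Fin.sum_univ_succ, cons_sA0]
    rw [h1, ← map_add, ih]
    simp only [cons_sA, mw_cons, Fin.cons_zero, Fin.cons_succ, Fin.val_zero, pow_zero, one_smul, Fin.val_succ, key2]
    rw [add_comm]
    congr 1
    rw [ct_mw, map_sum, ← Finset.sum_add_distrib]
    refine Finset.sum_congr rfl fun i _ => ?_
    rw [map_smul, alt_swap hβ (v i) x, pow_succ]
    module

lemma om_mw2 (β : G →ₗ[K] Module.Dual K G) (hβ) {p : ℕ} (v : Fin (p+2) → G) :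
    om β hβ (mw (p+2) v) + om β hβ (mw (p+2) v) = ∑ i : Fin (p+2), ∑ l : Fin (p+1), ((-1:K)^i.1 * (-1)^l.1 * β (v i) (v (i.succAbove l))) • mw p (v ∘ i.succAbove ∘ l.succAbove) := by
  rw [om_mw]
  refine Finset.sum_congr rfl fun i _ => ?_
  rw [ct_mw, Finset.smul_sum]
  refine Finset.sum_congr rfl fun l _ => ?_
  rw [smul_smul, mul_assoc]; rfl

/-- alternating sum -/
def Alt {α N : Type*} [AddCommGroup N] (p : ℕ) (F : (Fin p → α) → N) (v : Fin p → α) : N :=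
  ∑ σ : Equiv.Perm (Fin p), (Equiv.Perm.sign σ : ℤ) • F (v ∘ σ)

/-- insertion of a value at zero -/
def insPerm {p : ℕ} (q : Fin (p+1) × Equiv.Perm (Fin p)) : Equiv.Perm (Fin (p+1)) :=
  q.1.cycleRange.symm * Equiv.Perm.decomposeFin.symm (0, q.2)

lemma insPerm_zero {p : ℕ} (q : Fin (p+1) × Equiv.Perm (Fin p)) : insPerm q 0 = q.1 := by
  simp [insPerm]
lemma insPerm_succ {p : ℕ} (q : Fin (p+1) × Equiv.Perm (Fin p)) (t : Fin p) : insPerm q t.succ = q.1.succAbove (q.2 t) := by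
  simp [insPerm]
lemma insPerm_sign {p : ℕ} (q : Fin (p+1) × Equiv.Perm (Fin p)) : (Equiv.Perm.sign (insPerm q) : ℤ) = (-1)^q.1.1 * (Equiv.Perm.sign q.2 : ℤ) := by
  rw [insPerm, Equiv.Perm.sign_mul, Equiv.Perm.decomposeFin.symm_sign, Equiv.Perm.sign_symm, Fin.sign_cycleRange]
  simp
lemma insPerm_bij {p : ℕ} : Function.Bijective (insPerm (p := p)) := by
  rw [Fintype.bijective_iff_injective_and_card]
  constructor
  · rintro ⟨i, τ⟩ ⟨i', τ'⟩ h
    have h0 := congrArg (fun σ => σ 0) h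
    simp only [insPerm_zero] at h0
    subst h0
    congr 1
    ext1 t
    have h1 := congrArg (fun σ => σ t.succ) h
    simp only [insPerm_succ] at h1
    exact Fin.succAbove_right_injective h1
  · simp [Fintype.card_perm, Nat.factorial_succ]

lemma Alt_succ {α N : Type*} [AddCommGroup N] {p : ℕ} (F : (Fin (p+1) → α) → N) (v : Fin (p+1) → α) :
    Alt (p+1) F v = ∑ i : Fin (p+1), (-1 : ℤ)^i.1 • Alt p (fun u => F (Fin.cons (v i) u)) (v ∘ i.succAbove) := by
  rw [Alt, ← Function.Bijective.sum_comp insPerm_bij (fun σ => (Equiv.Perm.sign σ : ℤ) • F (v ∘ σ)), Fintype.sum_prod_type]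
  refine Finset.sum_congr rfl fun i _ => ?_
  rw [Alt, Finset.smul_sum]
  refine Finset.sum_congr rfl fun τ _ => ?_
  rw [insPerm_sign, smul_smul]
  congr 2
  funext t
  refine Fin.cases ?_ (fun t => ?_) t
  · simp [insPerm_zero]
  · simp [insPerm_succ]

/-- even index -/
def i0 {j : ℕ} (t : Fin j) : Fin (2*j) := ⟨2*t.1, by have := t.2; omega⟩
/-- odd index -/
def i1 {j : ℕ} (t : Fin j) : Fin (2*j) := ⟨2*t.1+1, by have := t.2; omega⟩

open Fr in
lemma CC_mw {ι : Type*} [Fintype ι] (A : Fr K G ι) (f : Module.Dual K (MvPolynomial ι K)) (j : ℕ) :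
    ∀ (v : Fin (2*j) → G) (s : MvPolynomial ι K),
    (2:K)^j * ev f ((A.pco.CC ^ j) (tm s (mw (2*j) v))) =
      Alt (2*j) (fun u => f ((∏ t, A.ell (A.curv (u (i0 t)) (u (i1 t)))) * s)) v := by
  induction j with
  | zero =>
    intro v s
    rw [Alt]
    change _ * ev f (tm s (mw 0 v)) = _
    rw [mw_zero, ev_t, eps0_one]
    simp
  | succ j ih =>
    intro v s
    have h1 : A.pco.CC (tm s (mw (2*j+2) v)) + A.pco.CC (tm s (mw (2*j+2) v)) =
        ∑ i : Fin (2*j+2), ∑ l : Fin (2*j+1), ((-1:K)^i.1 * (-1)^l.1) • tm (A.ell (A.curv (v i) (v (i.succAbove l))) * s) (mw (2*j) (v ∘ i.succAbove ∘ l.succAbove)) := by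
      rw [Co.CC_t, ← Finset.sum_add_distrib]
      have h2 : ∀ a, tm (A.pco.X (A.hb a) s) (A.co a (mw (2*j+2) v)) + tm (A.pco.X (A.hb a) s) (A.co a (mw (2*j+2) v)) =
          ∑ i : Fin (2*j+2), ∑ l : Fin (2*j+1), ((-1:K)^i.1 * (-1)^l.1) • tm ((A.c a (A.curv (v i) (v (i.succAbove l))) • A.ell (A.hb a)) * s) (mw (2*j) (v ∘ i.succAbove ∘ l.succAbove)) := by
        intro a
        rw [← map_add, co, om_mw2, map_sum]
        refine Finset.sum_congr rfl fun i _ => ?_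
        rw [map_sum]
        refine Finset.sum_congr rfl fun l _ => ?_
        rw [map_smul, mul_smul, pco_X, smul_mul_assoc, map_smul, LinearMap.smul_apply]
        rfl
      simp only [h2]
      rw [Finset.sum_comm]
      refine Finset.sum_congr rfl fun i _ => ?_
      rw [Finset.sum_comm]
      refine Finset.sum_congr rfl fun l _ => ?_
      rw [← Finset.smul_sum]
      congr 1
      rw [← A.c_sum A.ell (A.curv_mem (v i) (v (i.succAbove l))), Finset.sum_mul, map_sum, LinearMap.sum_apply]
    have h3 : (2:K)^(j+1) * ev f ((A.pco.CC ^ (j+1)) (tm s (mw (2*(j+1)) v))) =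
        2^j * ev f ((A.pco.CC ^ j) (A.pco.CC (tm s (mw (2*j+2) v)) + A.pco.CC (tm s (mw (2*j+2) v)))) := by
      rw [pow_succ A.pco.CC, Module.End.mul_apply, map_add, map_add, pow_succ]
      change _ * ev f ((A.pco.CC ^ j) (A.pco.CC (tm s (mw (2*j+2) v)))) = _
      ring
    rw [h3, h1, map_sum, map_sum, Finset.mul_sum]
    change _ = Alt (2*j+1+1) _ v
    rw [Alt_succ]
    refine Finset.sum_congr rfl fun i _ => ?_
    rw [Alt_succ, map_sum, map_sum, Finset.mul_sum, Finset.smul_sum]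
    refine Finset.sum_congr rfl fun l _ => ?_
    rw [map_smul, map_smul, smul_eq_mul, mul_left_comm, ih]
    simp only [← Int.cast_smul_eq_zsmul K, smul_eq_mul, mul_assoc]
    push_cast
    congr 2
    simp only [Function.comp_assoc]
    congr 1
    funext u
    congr 1
    rw [Fin.prod_univ_succ, mul_comm (A.ell _) (∏ i, _), mul_assoc]
    rfl
end comb
end CW

namespace CW
section comb3
variable {K : Type*} [CommRing K] {G : Type*} [AddCommGroup G] [Module K G]

lemma der_e' (f : Module.End K G) (x : G) (m : Lam K G) : der f (e x m) = e x (der f m) + e (f x) m := by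
  have := LinearMap.congr_fun (der_e f x) m
  simpa using this
lemma e_anti' (x y : G) (m : Lam K G) : e x (e y m) = - e y (e x m) := by
  have := LinearMap.congr_fun (e_anti (K := K) x y) m
  simp only [Module.End.mul_apply, LinearMap.add_apply, LinearMap.zero_apply] at this
  exact eq_neg_of_add_eq_zero_left this

lemma der_mw (f : Module.End K G) {p : ℕ} (v : Fin p → G) :
    der f (mw p v) = ∑ i, mw p (Function.update v i (f (v i))) := by
  induction p with
  | zero => simp [mw_zero, der_one]
  | succ p ih =>
    obtain ⟨x, v, rfl⟩ : ∃ x v', v = Fin.cons x v' := ⟨v 0, Fin.tail v, (Fin.cons_self_tail v).symm⟩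
    rw [mw_cons, der_e', Fin.sum_univ_succ, ih, map_sum, add_comm]
    congr 1
    · rw [Fin.update_cons_zero, mw_cons]; rfl
    · refine Finset.sum_congr rfl fun i _ => ?_
      rw [Fin.cons_succ, ← Fin.cons_update, mw_cons]

lemma der_mw2 (f : Module.End K G) {p : ℕ} (v : Fin (p+1) → G) :
    der f (mw (p+1) v) = ∑ i : Fin (p+1), (-1:K)^i.1 • e (f (v i)) (mw p (v ∘ i.succAbove)) := by
  induction p with
  | zero =>
    rw [mw_succ, der_e', mw_zero, der_one]
    simp [mw_zero]
  | succ p ih =>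
    obtain ⟨x, v, rfl⟩ : ∃ x v', v = Fin.cons x v' := ⟨v 0, Fin.tail v, (Fin.cons_self_tail v).symm⟩
    conv_rhs => rw [Fin.sum_univ_succ, cons_sA0]
    rw [mw_cons, der_e', ih, map_sum, add_comm]
    simp only [cons_sA, mw_cons, Fin.cons_zero, Fin.cons_succ, Fin.val_zero, pow_zero, one_smul, Fin.val_succ]
    congr 1
    refine Finset.sum_congr rfl fun i _ => ?_
    rw [map_smul, e_anti' (f (v i)) x, pow_succ]
    module

/-- remaining entries -/
def rs {α : Type*} {p : ℕ} (v : Fin (p+2) → α) (i l : Fin (p+2)) : Fin p → α := fun m =>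
  if m.1 < i.1 then v ⟨m.1, by omega⟩ else if m.1 + 1 < l.1 then v ⟨m.1+1, by omega⟩ else v ⟨m.1+2, by omega⟩

lemma rs_zero {α : Type*} {p : ℕ} (x : α) (v : Fin (p+1) → α) (l : Fin (p+1)) :
    rs (Fin.cons x v) 0 l.succ = v ∘ l.succAbove := by
  funext m
  simp only [rs, Fin.val_zero, not_lt_zero, if_false, Fin.val_succ, Function.comp_apply, add_lt_add_iff_right]
  split_ifs with h
  · rw [Fin.succAbove_of_castSucc_lt _ _ (by simpa [Fin.lt_def] using h)]; rfl
  · rw [Fin.succAbove_of_le_castSucc _ _ (by simpa [Fin.le_def] using h)]; rfl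

lemma rs_succ {α : Type*} {p : ℕ} (x : α) (v : Fin (p+2) → α) (i l : Fin (p+2)) :
    rs (Fin.cons x v) i.succ l.succ = Fin.cons x (rs v i l) := by
  funext m
  refine Fin.cases ?_ (fun m => ?_) m
  · simp [rs]
  · simp only [rs, Fin.val_succ, Fin.cons_succ, add_lt_add_iff_right]
    split_ifs <;> rfl

lemma bd_mw (β : G →ₗ[K] Module.End K G) (hβ) {p : ℕ} (v : Fin (p+2) → G) :
    bd β hβ (mw (p+2) v) = - ∑ i : Fin (p+2), ∑ l : Fin (p+2), if i < l then (-1:K)^(i.1+l.1) • e (β (v i) (v l)) (mw p (rs v i l)) else 0 := by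
  have key : ∀ (x : G) (m : Lam K G), bd β hβ (e x m) = - e x (bd β hβ m) + der (β x) m := by
    intro x m
    have := LinearMap.congr_fun (bd_e β hβ x) m
    simpa using this
  have gen : ∀ (p : ℕ) (v : Fin (p+2) → G) (x : G) (v' : Fin (p+1) → G), v = Fin.cons x v' →
      - ∑ i : Fin (p+2), ∑ l : Fin (p+2), (if i < l then (-1:K)^(i.1+l.1) • e (β (v i) (v l)) (mw p (rs v i l)) else 0) =
      der (β x) (mw (p+1) v') - ∑ i : Fin (p+1), ∑ l : Fin (p+1), (if i < l then (-1:K)^(i.1+l.1) • e (β (v' i) (v' l)) (mw p (rs v i.succ l.succ)) else 0) := by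
    rintro p v x v' rfl
    rw [Fin.sum_univ_succ, neg_add, sub_eq_add_neg]
    congr 1
    · rw [Fin.sum_univ_succ, if_neg (lt_irrefl _), zero_add, der_mw2, ← Finset.sum_neg_distrib]
      refine Finset.sum_congr rfl fun l _ => ?_
      rw [if_pos (Fin.succ_pos l), rs_zero, Fin.cons_zero, Fin.cons_succ]
      simp [pow_succ]
    · congr 1
      refine Finset.sum_congr rfl fun i _ => ?_
      rw [Fin.sum_univ_succ, if_neg (Fin.not_lt_zero _), zero_add]
      refine Finset.sum_congr rfl fun l _ => ?_
      simp only [Fin.succ_lt_succ_iff, Fin.cons_succ, Fin.val_succ]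
      split_ifs
      · congr 1; ring
      · rfl
  induction p with
  | zero =>
    obtain ⟨x, v, rfl⟩ : ∃ x v', v = Fin.cons x v' := ⟨v 0, Fin.tail v, (Fin.cons_self_tail v).symm⟩
    rw [gen 0 _ x v rfl, mw_cons, key, bd_one_deg β hβ (mw_mem _)]
    simp
  | succ p ih =>
    obtain ⟨x, v, rfl⟩ : ∃ x v', v = Fin.cons x v' := ⟨v 0, Fin.tail v, (Fin.cons_self_tail v).symm⟩
    rw [gen _ _ x v rfl, mw_cons, key, ih, map_neg, neg_neg, add_comm, sub_eq_add_neg]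
    congr 1
    simp only [map_sum, ← Finset.sum_neg_distrib, rs_succ]
    refine Finset.sum_congr rfl fun i _ => Finset.sum_congr rfl fun l _ => ?_
    split_ifs
    · rw [map_smul, mw_cons, e_anti' x, smul_neg]
    · simp

/-- invariance under the swaps inside pairs -/
lemma sym_pairs {K : Type*} [CommRing K] (j : ℕ) (g : Equiv.Perm (Fin (2*j)) → K)
    (hg : ∀ σ (t : Fin j), g (σ * Equiv.swap (i0 t) (i1 t)) = g σ) :
    ∑ σ, g σ = 2^j * ∑ σ : Equiv.Perm (Fin (2*j)), if ∀ t : Fin j, σ (i0 t) < σ (i1 t) then g σ else 0 := by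
  have gen : ∀ T : Finset (Fin j), ∑ σ, g σ = 2^T.card * ∑ σ : Equiv.Perm (Fin (2*j)), if ∀ t ∈ T, σ (i0 t) < σ (i1 t) then g σ else 0 := by
    intro T
    induction T using Finset.induction_on with
    | empty => simp
    | insert t T ht ih =>
      rw [ih, Finset.card_insert_of_notMem ht, pow_succ, mul_assoc]
      congr 1
      have hi : ∀ σ : Equiv.Perm (Fin (2*j)), (∀ s ∈ insert t T, σ (i0 s) < σ (i1 s)) ↔ σ (i0 t) < σ (i1 t) ∧ ∀ s ∈ T, σ (i0 s) < σ (i1 s) := by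
        intro σ; simp only [Finset.mem_insert, forall_eq_or_imp]
      have h1 : ∀ σ : Equiv.Perm (Fin (2*j)), (if ∀ t ∈ T, σ (i0 t) < σ (i1 t) then g σ else 0) =
          (if ∀ s ∈ insert t T, σ (i0 s) < σ (i1 s) then g σ else 0) + (if (∀ t ∈ T, σ (i0 t) < σ (i1 t)) ∧ σ (i1 t) < σ (i0 t) then g σ else 0) := by
        intro σ
        have hne : σ (i0 t) ≠ σ (i1 t) := by
          intro h; have := σ.injective h; simp [i0, i1] at this
        rw [if_congr (hi σ) rfl rfl]
        by_cases hT : ∀ t ∈ T, σ (i0 t) < σ (i1 t)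
        · rcases lt_or_gt_of_ne hne with h | h
          · rw [if_pos hT, if_pos ⟨h, hT⟩, if_neg (fun h' => lt_asymm h h'.2), add_zero]
          · rw [if_pos hT, if_neg (fun h' => lt_asymm h h'.1), if_pos ⟨hT, h⟩, zero_add]
        · rw [if_neg hT, if_neg (fun h' => hT h'.2), if_neg (fun h' => hT h'.1), zero_add]
      rw [Finset.sum_congr rfl fun σ _ => h1 σ, Finset.sum_add_distrib, two_mul (∑ σ : Equiv.Perm (Fin (2*j)), _)]
      congr 1
      rw [← Equiv.sum_comp (Equiv.mulRight (Equiv.swap (i0 t) (i1 t)))]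
      refine Finset.sum_congr rfl fun σ _ => ?_
      simp only [Equiv.coe_mulRight, hg, Equiv.Perm.mul_apply, Equiv.swap_apply_left, Equiv.swap_apply_right, hi]
      refine if_congr ?_ rfl rfl
      rw [and_comm]
      refine and_congr Iff.rfl ?_
      refine forall_congr' fun s => forall_congr' fun hs => ?_
      have hst : s ≠ t := by rintro rfl; exact ht hs
      have hst' : s.1 ≠ t.1 := fun h => hst (Fin.ext h)
      rw [Equiv.swap_apply_of_ne_of_ne, Equiv.swap_apply_of_ne_of_ne] <;>
      · simp only [i0, i1, ne_eq, Fin.mk.injEq]; omega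
  have := gen Finset.univ
  simpa using this

/-- the Chern-Weil functional evaluated on decomposable elements -/
lemma phi_mw [Algebra ℚ K] {ι : Type*} [Fintype ι] {A : Fr K G ι} {j : ℕ} {P : MultilinearMap K (fun _ : Fin j => G) K} (hP : Fr.Inv A j P)
    (v : Fin (2*j) → G) :
    A.pco.phi (Ph A.hb P) j (mw (2*j) v) =
      ∑ σ : Equiv.Perm (Fin (2*j)), if ∀ t : Fin j, σ (i0 t) < σ (i1 t) then
        (Equiv.Perm.sign σ : ℤ) • P (fun t => A.curv (v (σ (i0 t))) (v (σ (i1 t)))) else 0 := by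
  have h1 := CC_mw A (Ph A.hb P) j v 1
  have h2 : IsUnit ((2:K)^j) := by
    have : IsUnit (2:K) := by
      have := (IsUnit.mk0 (2:ℚ) two_ne_zero).map (algebraMap ℚ K)
      rwa [map_ofNat] at this
    exact this.pow j
  apply h2.mul_left_cancel
  rw [Co.phi_apply]
  refine h1.trans ?_
  rw [← sym_pairs j (fun σ => (Equiv.Perm.sign σ : ℤ) • P (fun t => A.curv (v (σ (i0 t))) (v (σ (i1 t)))))]
  · rw [Alt]
    refine Finset.sum_congr rfl fun σ _ => ?_
    rw [mul_one, hP.ell _ (fun r => A.curv_mem _ _)]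
    rfl
  · intro σ t
    have hne : (i0 t : Fin (2*j)) ≠ i1 t := by simp [i0, i1]
    rw [Equiv.Perm.sign_mul, Equiv.Perm.sign_swap hne]
    have : (fun t' => A.curv (v ((σ * Equiv.swap (i0 t) (i1 t)) (i0 t'))) (v ((σ * Equiv.swap (i0 t) (i1 t)) (i1 t')))) =
        Function.update (fun t' => A.curv (v (σ (i0 t'))) (v (σ (i1 t')))) t ((-1 : K) • A.curv (v (σ (i0 t))) (v (σ (i1 t)))) := by
      funext s
      rcases eq_or_ne s t with rfl | hst
      · rw [Function.update_self]
        simp only [Equiv.Perm.mul_apply, Equiv.swap_apply_left, Equiv.swap_apply_right]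
        rw [alt_swap A.curv_alt]; simp
      · rw [Function.update_of_ne hst]
        have hst' : s.1 ≠ t.1 := fun h => hst (Fin.ext h)
        simp only [Equiv.Perm.mul_apply]
        rw [Equiv.swap_apply_of_ne_of_ne, Equiv.swap_apply_of_ne_of_ne] <;>
        · simp only [i0, i1, ne_eq, Fin.mk.injEq]; omega
    rw [this, MultilinearMap.map_update_smul, Function.update_eq_self]
    simp
end comb3
end CW

namespace CW
section surj1
namespace Fr
variable {K : Type*} [CommRing K] {G : Type*} [AddCommGroup G] [Module K G] {ι : Type*} [Fintype ι]
variable (A : Fr K G ι)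

lemma op_tw0 {Z : Op K G} (h1 : Z 1 = 0) (he : ∀ x, ∃ Y : Op K G, Z * e x = Y * Z) : Z = 0 := by
  apply op_eqOn
  · simpa using h1
  · intro x w hw
    obtain ⟨Y, hY⟩ := he x
    have := LinearMap.congr_fun hY w
    simp only [Module.End.mul_apply] at this
    rw [this, hw]; simp

/-- complementary projection -/
def qr : Module.End K G := 1 - A.pr
lemma qr_apply (x : G) : A.qr x = x - A.pr x := rfl
lemma pr_pr (x : G) : A.pr (A.pr x) = A.pr x := A.pr_id _ (A.pr_mem x)
lemma pr_qr (x : G) : A.pr (A.qr x) = 0 := by rw [qr_apply, map_sub, pr_pr, sub_self]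
lemma qr_qr (x : G) : A.qr (A.qr x) = A.qr x := by rw [qr_apply, pr_qr, sub_zero]
/-- projection on horizontal chains -/
def Pi : Op K G := mp A.qr
lemma Pi_one : A.Pi 1 = 1 := mp_one _
lemma Pi_e (x : G) : A.Pi * e x = e (A.qr x) * A.Pi := LinearMap.ext fun w => mp_e _ _ _
lemma Pi_e0 {x : G} (hx : x ∈ A.hs) : A.Pi * e x = 0 := by
  rw [Pi_e, qr_apply, A.pr_id x hx, sub_self, e_zero, zero_mul]
lemma Pi_mem {p : ℕ} {w : Lam K G} (hw : w ∈ Dg K G p) : A.Pi w ∈ Dg K G p := mp_mem _ hw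
lemma Pi_L {x : G} (hx : x ∈ A.hs) : A.Pi * der (A.br x) = der (A.br x) * A.Pi := by
  refine LinearMap.ext fun w => mp_der _ _ _ (fun y => ?_) w
  rw [qr_apply, qr_apply, map_sub, A.pr_eq x hx]

lemma curv_h {x : G} (hx : x ∈ A.hs) (y : G) : A.curv x y = 0 := by
  rw [curv_apply, A.pr_id x hx, A.pr_eq x hx, sub_self]
lemma curv_h' {y : G} (hy : y ∈ A.hs) (x : G) : A.curv x y = 0 := by
  rw [alt_swap A.curv_alt, A.curv_h hy, neg_zero]
lemma curv_qr (x y : G) : A.curv (A.qr x) y = A.curv x y := by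
  rw [qr_apply, map_sub, LinearMap.sub_apply, A.curv_h (A.pr_mem x), sub_zero]
lemma curv_qr' (x y : G) : A.curv x (A.qr y) = A.curv x y := by
  rw [qr_apply, map_sub, A.curv_h' (A.pr_mem y), sub_zero]
lemma curv_eqv {x : G} (hx : x ∈ A.hs) (y z : G) : A.br x (A.curv y z) = A.curv (A.br x y) z + A.curv y (A.br x z) := by
  simp only [curv_apply, map_sub, A.pr_eq x hx]
  rw [← A.pr_eq x hx, A.jac x (A.pr y) (A.pr z), A.jac x y z, map_add]
  abel

/-- contraction with a curvature component -/
def kx (a : ι) (x : G) : Module.Dual K G := A.c a ∘ₗ A.curv x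
lemma kx_qr (a : ι) (x : G) : A.kx a (A.qr x) = A.kx a x := by
  refine LinearMap.ext fun y => ?_
  simp only [kx, LinearMap.comp_apply, curv_qr]
lemma co_e (a : ι) (x : G) : A.co a * e x = e x * A.co a + ct (A.kx a x) := om_e _ _ _
lemma co_one (a : ι) : A.co a 1 = 0 := om_one _ _
lemma co_e_h (a : ι) {x : G} (hx : x ∈ A.hs) : A.co a * e x = e x * A.co a := by
  have : A.kx a x = 0 := by
    refine LinearMap.ext fun y => ?_
    simp [kx, A.curv_h hx]
  rw [co_e, this, ct_zero, add_zero]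

lemma Pi_ct {φ : Module.Dual K G} (h : ∀ y, φ (A.qr y) = φ y) : A.Pi * ct φ = ct φ * A.Pi := by
  rw [← sub_eq_zero]
  apply op_tw0
  · simp [ct_one, Pi_one]
  · intro y
    refine ⟨- e (A.qr y), ?_⟩
    have h1 := A.Pi_e y
    have h2 := ct_e φ y
    have h3 := ct_e φ (A.qr y)
    rw [h] at h3
    have h4 : A.Pi * (φ y • (1 : Op K G)) = (φ y • (1 : Op K G)) * A.Pi := by simp
    linear_combination (norm := noncomm_ring) A.Pi * h2 - h1 * ct φ - ct φ * h1 - h3 * A.Pi + h4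

lemma Pi_co (a : ι) : A.Pi * A.co a = A.co a * A.Pi := by
  rw [← sub_eq_zero]
  apply op_tw0
  · simp [co_one, Pi_one]
  · intro x
    refine ⟨e (A.qr x), ?_⟩
    have h1 := A.Pi_e x
    have h2 := A.co_e a x
    have h3 := A.co_e a (A.qr x)
    rw [kx_qr] at h3
    have h4 := A.Pi_ct (φ := A.kx a x) (fun y => by simp [kx, curv_qr'])
    linear_combination (norm := noncomm_ring) A.Pi * h2 + h1 * A.co a - A.co a * h1 - h3 * A.Pi + h4

lemma om_Pi {β : G →ₗ[K] Module.Dual K G} (hβ) (h : ∀ x y, β (A.qr x) (A.qr y) = 0) : om β hβ * A.Pi = 0 := by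
  apply op_tw0
  · simp [om_one, Pi_one]
  · intro x
    refine ⟨e (A.qr x), ?_⟩
    have h1 := A.Pi_e x
    have h2 := om_e β hβ (A.qr x)
    have h3 : ct (β (A.qr x)) * A.Pi = 0 := by
      apply op_tw0
      · simp [ct_one, Pi_one]
      · intro y
        refine ⟨- e (A.qr y), ?_⟩
        have h1 := A.Pi_e y
        have h2 := ct_e (β (A.qr x)) (A.qr y)
        rw [h, zero_smul] at h2
        linear_combination (norm := noncomm_ring) ct (β (A.qr x)) * h1 + h2 * A.Pi
    linear_combination (norm := noncomm_ring) om β hβ * h1 + h2 * A.Pi + h3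

lemma co_dd (a : ι) : A.co a * A.dd * A.Pi = A.dd * A.co a * A.Pi := by
  rw [← sub_eq_zero]
  apply op_tw0
  · have : A.dd 1 = 0 := bd_one _ _
    simp [co_one, Pi_one, this]
  · intro x
    refine ⟨- e (A.qr x), ?_⟩
    have h1 := A.Pi_e x
    have h2 := A.co_e a (A.qr x)
    have h3 : A.dd * e (A.qr x) = - (e (A.qr x) * A.dd) + der (A.br (A.qr x)) := bd_e _ _ _
    have h : ∀ z, ((LinearMap.llcomp K G G K (A.kx a (A.qr x))) ∘ₗ A.br) z z = 0 := fun z => by simp [A.alt]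
    have h4 := bd_ct A.br A.alt (A.kx a (A.qr x)) h
    have h5 := der_om (A.br (A.qr x)) ((LinearMap.llcomp K G G K (A.c a)) ∘ₗ A.curv) (A.cc_alt a)
    have h6 : (A.dd * ct (A.kx a (A.qr x)) + ct (A.kx a (A.qr x)) * A.dd + (der (A.br (A.qr x)) * A.co a - A.co a * der (A.br (A.qr x)))) * A.Pi = 0 := by
      have h7 : A.dd * ct (A.kx a (A.qr x)) + ct (A.kx a (A.qr x)) * A.dd + (der (A.br (A.qr x)) * A.co a - A.co a * der (A.br (A.qr x))) =
        om ((LinearMap.llcomp K G G K (A.kx a (A.qr x))) ∘ₗ A.br + actD (A.br (A.qr x)) ((LinearMap.llcomp K G G K (A.c a)) ∘ₗ A.curv))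
          (fun z => by rw [LinearMap.add_apply, LinearMap.add_apply, h, actD_alt _ (A.cc_alt a), add_zero]) := by
        rw [co, dd, h4, h5]
        apply om_uniq
        · simp [om_one]
        · intro z
          rw [add_mul, om_e, om_e, LinearMap.add_apply, ct_add]
          noncomm_ring
      rw [h7]
      apply om_Pi
      intro y z
      rw [LinearMap.add_apply, LinearMap.add_apply, actD_apply]
      simp only [LinearMap.comp_apply, LinearMap.llcomp_apply, kx]
      have hk : ∀ u v w : G, A.curv (A.qr u) (A.br (A.qr v) (A.qr w)) = - A.pr (A.br (A.qr u) (A.br (A.qr v) (A.qr w))) := by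
        intro u v w
        rw [curv_apply, pr_qr]; simp
      rw [alt_swap A.curv_alt (A.br (A.qr x) (A.qr y)), hk, hk, hk, A.jac (A.qr x) (A.qr y), alt_swap A.alt (A.br (A.qr x) (A.qr y))]
      simp only [map_neg, map_add, neg_neg]
      abel
    linear_combination (norm := noncomm_ring) (A.co a * A.dd - A.dd * A.co a) * h1 + A.co a * h3 * A.Pi - A.dd * h2 * A.Pi - h2 * A.dd * A.Pi - h3 * A.co a * A.Pi - h6

lemma L_co {x : G} (hx : x ∈ A.hs) (a : ι) : der (A.br x) * A.co a = A.co a * der (A.br x) - ∑ b, A.c a (A.br x (A.hb b)) • A.co b := by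
  have h5 := der_om (A.br x) ((LinearMap.llcomp K G G K (A.c a)) ∘ₗ A.curv) (A.cc_alt a)
  have h6 : - ∑ b, A.c a (A.br x (A.hb b)) • A.co b = om (actD (A.br x) ((LinearMap.llcomp K G G K (A.c a)) ∘ₗ A.curv)) (actD_alt _ (A.cc_alt a)) := by
    apply om_uniq
    · simp [LinearMap.sum_apply, co_one]
    · intro y
      rw [neg_mul, mul_neg, Finset.sum_mul, Finset.mul_sum]
      have : ct ((actD (A.br x)) ((LinearMap.llcomp K G G K (A.c a)) ∘ₗ A.curv) y) = - ∑ b, A.c a (A.br x (A.hb b)) • ct (A.kx b y) := by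
        simp only [← ct_smul, ← ct_sum, ← ct_neg]
        congr 1
        refine LinearMap.ext fun z => ?_
        rw [actD_apply]
        simp only [LinearMap.comp_apply, LinearMap.llcomp_apply, kx, LinearMap.neg_apply, LinearMap.sum_apply, LinearMap.smul_apply, smul_eq_mul]
        have e1 := A.c_sum (A.c a ∘ₗ A.br x) (A.curv_mem y z)
        simp only [LinearMap.comp_apply, smul_eq_mul, A.curv_eqv hx, map_add] at e1
        rw [Finset.sum_congr rfl fun b _ => mul_comm _ _, e1]
        abel
      rw [this, ← neg_add, ← Finset.sum_add_distrib]
      congr 1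
      refine Finset.sum_congr rfl fun b _ => ?_
      rw [smul_mul_assoc, co_e, smul_add, mul_smul_comm]
  rw [← h6] at h5
  change der (A.br x) * A.co a - A.co a * der (A.br x) = _ at h5
  rw [sub_eq_add_neg, ← h5]; abel

lemma LemA : A.Pi * A.dd = A.dd * A.Pi + ∑ a, der (A.br (A.hb a)) * A.Pi * ct (A.th a) + ∑ a, e (A.hb a) * A.co a * A.Pi := by
  rw [← sub_eq_zero]
  have hd1 : A.dd 1 = 0 := bd_one _ _
  apply op_tw0
  · simp [Pi_one, hd1, LinearMap.sum_apply, ct_one, co_one]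
  · intro x
    refine ⟨- e (A.qr x), ?_⟩
    have key : A.Pi * der (A.br x) - der (A.br x) * A.Pi + (∑ a, e (A.br (A.hb a) (A.qr x)) * A.Pi * ct (A.th a))
        - ∑ a, e (A.hb a) * ct (A.kx a x) * A.Pi = 0 := by
      apply op_tw0
      · simp [Pi_one, der_one, LinearMap.sum_apply, ct_one]
      · intro y
        refine ⟨e (A.qr y), ?_⟩
        have h1 := A.Pi_e y
        have h2 := der_e (A.br x) y
        have h3 := der_e (A.br x) (A.qr y)
        have h4 := A.Pi_e (A.br x y)
        have h5 : (∑ a, e (A.br (A.hb a) (A.qr x)) * A.Pi * ct (A.th a)) * e y = e (A.qr y) * (∑ a, e (A.br (A.hb a) (A.qr x)) * A.Pi * ct (A.th a)) + e (A.br (A.pr y) (A.qr x)) * A.Pi := by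
          have := A.th_sum (N := Op K G) (LinearMap.mulRight K A.Pi ∘ₗ eL ∘ₗ A.br.flip (A.qr x)) y
          change ∑ a, A.th a y • (e (A.br (A.hb a) (A.qr x)) * A.Pi) = e (A.br (A.pr y) (A.qr x)) * A.Pi at this
          rw [← this, Finset.sum_mul, Finset.mul_sum, ← Finset.sum_add_distrib]
          refine Finset.sum_congr rfl fun a _ => ?_
          have i1 := ct_e (A.th a) y
          have i2 := e_anti (K := K) (A.br (A.hb a) (A.qr x)) (A.qr y)
          have i4 : (e (A.br (A.hb a) (A.qr x)) * A.Pi) * (A.th a y • (1 : Op K G)) = A.th a y • (e (A.br (A.hb a) (A.qr x)) * A.Pi) := by simp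
          linear_combination (norm := noncomm_ring) (e (A.br (A.hb a) (A.qr x)) * A.Pi) * i1 + i4 - e (A.br (A.hb a) (A.qr x)) * h1 * ct (A.th a) - i2 * A.Pi * ct (A.th a)
        have h6 : (∑ a, e (A.hb a) * ct (A.kx a x) * A.Pi) * e y = e (A.qr y) * (∑ a, e (A.hb a) * ct (A.kx a x) * A.Pi) + e (A.curv x y) * A.Pi := by
          have := A.c_sum (N := Op K G) (LinearMap.mulRight K A.Pi ∘ₗ eL) (A.curv_mem x y)
          change ∑ a, A.c a (A.curv x y) • (e (A.hb a) * A.Pi) = e (A.curv x y) * A.Pi at this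
          rw [← this, Finset.sum_mul, Finset.mul_sum, ← Finset.sum_add_distrib]
          refine Finset.sum_congr rfl fun a _ => ?_
          have i1 := ct_e (A.kx a x) (A.qr y)
          have i2 := e_anti (K := K) (A.hb a) (A.qr y)
          have i3 : (A.kx a x) (A.qr y) = A.c a (A.curv x y) := by simp [kx, curv_qr']
          rw [i3] at i1
          have i4 : e (A.hb a) * (A.c a (A.curv x y) • (1 : Op K G)) * A.Pi = A.c a (A.curv x y) • (e (A.hb a) * A.Pi) := by simp
          linear_combination (norm := noncomm_ring) e (A.hb a) * ct (A.kx a x) * h1 + e (A.hb a) * i1 * A.Pi + i4 - i2 * ct (A.kx a x) * A.Pi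
        have h7 : (e (A.qr (A.br x y)) - e (A.br x (A.qr y)) + e (A.br (A.pr y) (A.qr x)) - e (A.curv x y) : Op K G) = 0 := by
          rw [← e_sub, ← e_add, ← e_sub]
          have : A.qr (A.br x y) - A.br x (A.qr y) + A.br (A.pr y) (A.qr x) - A.curv x y = 0 := by
            simp only [curv_apply, qr_apply, map_sub]
            rw [alt_swap A.alt (A.pr y) x, alt_swap A.alt (A.pr y) (A.pr x)]
            abel
          rw [this, e_zero]
        linear_combination (norm := noncomm_ring) A.Pi * h2 + h1 * der (A.br x) + h4 - der (A.br x) * h1 - h3 * A.Pi + h5 - h6 + h7 * A.Pi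
    have h1 := A.Pi_e x
    have h2 : A.dd * e x = - (e x * A.dd) + der (A.br x) := bd_e _ _ _
    have h3 : A.dd * e (A.qr x) = - (e (A.qr x) * A.dd) + der (A.br (A.qr x)) := bd_e _ _ _
    have h4 : (∑ a, der (A.br (A.hb a)) * A.Pi * ct (A.th a)) * e x = - e (A.qr x) * (∑ a, der (A.br (A.hb a)) * A.Pi * ct (A.th a))
        - (∑ a, e (A.br (A.hb a) (A.qr x)) * A.Pi * ct (A.th a)) + der (A.br (A.pr x)) * A.Pi := by
      have := A.th_sum (N := Op K G) (LinearMap.mulRight K A.Pi ∘ₗ derL ∘ₗ A.br) x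
      change ∑ a, A.th a x • (der (A.br (A.hb a)) * A.Pi) = der (A.br (A.pr x)) * A.Pi at this
      rw [← this, Finset.sum_mul, Finset.mul_sum, ← Finset.sum_sub_distrib, ← Finset.sum_add_distrib]
      refine Finset.sum_congr rfl fun a _ => ?_
      have i1 := ct_e (A.th a) x
      have i2 := der_e (A.br (A.hb a)) (A.qr x)
      have i4 : (der (A.br (A.hb a)) * A.Pi) * (A.th a x • (1 : Op K G)) = A.th a x • (der (A.br (A.hb a)) * A.Pi) := by simp
      linear_combination (norm := noncomm_ring) der (A.br (A.hb a)) * A.Pi * i1 + i4 - der (A.br (A.hb a)) * h1 * ct (A.th a) - i2 * A.Pi * ct (A.th a)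
    have h5 : (∑ a, e (A.hb a) * A.co a * A.Pi) * e x = - e (A.qr x) * (∑ a, e (A.hb a) * A.co a * A.Pi) + ∑ a, e (A.hb a) * ct (A.kx a x) * A.Pi := by
      rw [Finset.sum_mul, Finset.mul_sum, ← Finset.sum_add_distrib]
      refine Finset.sum_congr rfl fun a _ => ?_
      have i1 := A.co_e a (A.qr x)
      rw [kx_qr] at i1
      have i2 := e_anti (K := K) (A.hb a) (A.qr x)
      linear_combination (norm := noncomm_ring) e (A.hb a) * A.co a * h1 + e (A.hb a) * i1 * A.Pi + i2 * A.co a * A.Pi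
    have h6 : (der (A.br x) : Op K G) = der (A.br (A.qr x)) + der (A.br (A.pr x)) := by
      rw [← der_add, ← map_add, qr_apply, sub_add_cancel]
    linear_combination (norm := noncomm_ring) A.Pi * h2 - h1 * A.dd - A.dd * h1 - h3 * A.Pi - h4 - h5 + key + h6 * A.Pi

lemma fPi {f : Module.Dual K (Lam K G)} (hf : ∀ x ∈ A.hs, ∀ w, f (e x w) = 0) (w : Lam K G) : f (A.Pi w) = f w := by
  induction w using op_ind generalizing f with
  | h1 => rw [Pi_one]
  | hs c w ih => rw [map_smul, map_smul, map_smul, ih hf]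
  | ha w w' h h' => rw [map_add, map_add, map_add, h hf, h' hf]
  | he x w ih =>
    have h1 := LinearMap.congr_fun (A.Pi_e x) w
    simp only [Module.End.mul_apply] at h1
    have h2 := @ih (f ∘ₗ e (A.qr x)) (fun y hy w => by
      rw [LinearMap.comp_apply, e_anti', map_neg, hf y hy, neg_zero])
    rw [LinearMap.comp_apply, LinearMap.comp_apply] at h2
    rw [h1, h2, qr_apply, e_sub, LinearMap.sub_apply, map_sub, hf _ (A.pr_mem x), sub_zero]
end Fr
end surj1
end CW

namespace CW
section surj2
namespace Fr
variable {K : Type*} [CommRing K] {G : Type*} [AddCommGroup G] [Module K G] {ι : Type*} [Fintype ι]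
variable (A : Fr K G ι)

/-- super operator built from wedge and curvature -/
def ES : Module.End K (Op K G) := ∑ a, LinearMap.mulLeft K (e (A.hb a)) * LinearMap.mulRight K (A.co a)
lemma ES_apply (Z : Op K G) : A.ES Z = ∑ a, e (A.hb a) * Z * A.co a := by
  simp [ES, LinearMap.sum_apply, mul_assoc]
/-- super operator built from the action and curvature -/
def LS : Module.End K (Op K G) := ∑ a, LinearMap.mulLeft K (der (A.br (A.hb a))) * LinearMap.mulRight K (A.co a)
lemma LS_apply (Z : Op K G) : A.LS Z = ∑ a, der (A.br (A.hb a)) * Z * A.co a := by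
  simp [LS, LinearMap.sum_apply, mul_assoc]
/-- super operator for the zig-zag -/
def HS (η : Op K G) : Module.End K (Op K G) := LinearMap.mulLeft K η * A.ES
lemma HS_apply (η Z : Op K G) : A.HS η Z = η * A.ES Z := rfl
lemma HS_sum (η Z : Op K G) : A.HS η Z = ∑ a, η * e (A.hb a) * Z * A.co a := by
  rw [HS_apply, ES_apply, Finset.mul_sum]; simp only [mul_assoc]
lemma co_co (a b : ι) : A.co a * A.co b = A.co b * A.co a := om_om _ _ _ _

lemma two0 [Algebra ℚ K] {V : Type*} [AddCommGroup V] [Module K V] {v : V} (h : v + v = 0) : v = 0 := by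
  rw [← Co.half_half (K := K) v, ← smul_add, h, smul_zero]

lemma ES_ES [Algebra ℚ K] (Z : Op K G) : A.ES (A.ES Z) = 0 := by
  apply two0 (K := K)
  have h : A.ES (A.ES Z) = ∑ a, ∑ b, e (A.hb a) * e (A.hb b) * Z * (A.co b * A.co a) := by
    simp only [ES_apply, Finset.mul_sum, Finset.sum_mul, mul_assoc]
  have h2 := h
  rw [Finset.sum_comm] at h2
  nth_rewrite 1 [h]
  rw [h2, ← Finset.sum_add_distrib]
  refine Finset.sum_eq_zero fun a _ => ?_
  rw [← Finset.sum_add_distrib]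
  refine Finset.sum_eq_zero fun b _ => ?_
  have i2 := e_anti (K := K) (A.hb a) (A.hb b)
  have i3 := A.co_co a b
  linear_combination (norm := noncomm_ring) i2 * Z * A.co b * A.co a + e (A.hb b) * e (A.hb a) * Z * i3

lemma L_brac (x y : G) : (der (A.br x) * e y : Op K G) = e y * der (A.br x) + e (A.br x y) := by
  have := der_e (A.br x) y
  linear_combination (norm := noncomm_ring) this

lemma LS_ES [Algebra ℚ K] (Z : Op K G) : A.LS (A.ES Z) = A.ES (A.LS Z) := by
  rw [← sub_eq_zero]
  apply two0 (K := K)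
  have h1 : A.LS (A.ES Z) = ∑ a, ∑ b, der (A.br (A.hb a)) * e (A.hb b) * Z * (A.co b * A.co a) := by
    simp only [ES_apply, LS_apply, Finset.mul_sum, Finset.sum_mul, mul_assoc]
  have h2 : A.ES (A.LS Z) = ∑ a, ∑ b, e (A.hb b) * der (A.br (A.hb a)) * Z * (A.co a * A.co b) := by
    rw [Finset.sum_comm]
    simp only [ES_apply, LS_apply, Finset.mul_sum, Finset.sum_mul, mul_assoc]
  have h : A.LS (A.ES Z) - A.ES (A.LS Z) = ∑ a, ∑ b, e (A.br (A.hb a) (A.hb b)) * Z * (A.co a * A.co b) := by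
    rw [h1, h2, ← Finset.sum_sub_distrib]
    refine Finset.sum_congr rfl fun a _ => ?_
    rw [← Finset.sum_sub_distrib]
    refine Finset.sum_congr rfl fun b _ => ?_
    rw [A.co_co b a, L_brac]; noncomm_ring
  have h' := h
  rw [Finset.sum_comm] at h'
  nth_rewrite 1 [h]
  rw [h', ← Finset.sum_add_distrib]
  refine Finset.sum_eq_zero fun a _ => ?_
  rw [← Finset.sum_add_distrib]
  refine Finset.sum_eq_zero fun b _ => ?_
  rw [A.co_co b a, alt_swap A.alt (A.hb b), e_neg]; noncomm_ring

lemma dd_ES (Z : Op K G) : A.dd * A.ES Z = - A.ES (A.dd * Z) + A.LS Z := by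
  rw [ES_apply, ES_apply, LS_apply, Finset.mul_sum, ← Finset.sum_neg_distrib, ← Finset.sum_add_distrib]
  refine Finset.sum_congr rfl fun a _ => ?_
  have h3 : A.dd * e (A.hb a) = - (e (A.hb a) * A.dd) + der (A.br (A.hb a)) := bd_e _ _ _
  linear_combination (norm := noncomm_ring) h3 * Z * A.co a

section eta
variable {A} {η : Op K G}
variable (hη3 : ∀ x ∈ A.hs, der (A.br x) * η = η * der (A.br x))

lemma LS_eta (hη3 : ∀ x ∈ A.hs, der (A.br x) * η = η * der (A.br x)) (Z : Op K G) : A.LS (η * Z) = η * A.LS Z := by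
  rw [LS_apply, LS_apply, Finset.mul_sum]
  refine Finset.sum_congr rfl fun a _ => ?_
  have := hη3 _ (A.hb_mem a)
  linear_combination (norm := noncomm_ring) this * Z * A.co a

lemma LS_HS [Algebra ℚ K] (hη3 : ∀ x ∈ A.hs, der (A.br x) * η = η * der (A.br x)) (k : ℕ) (Z : Op K G) :
    ((A.HS η ^ k : Module.End K (Op K G))) (A.LS Z) = A.LS ((A.HS η ^ k : Module.End K (Op K G)) Z) := by
  induction k with
  | zero => simp
  | succ k ih => rw [pow_succ', Module.End.mul_apply, Module.End.mul_apply, ih, HS_apply, HS_apply, LS_eta hη3, LS_ES]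

/-- pure degree functionals -/
def Pure (m : ℕ) (c : Module.Dual K (Lam K G)) : Prop := ∀ q, q ≠ m → ∀ w ∈ Dg K G q, c w = 0

lemma dd_mem (A : Fr K G ι) {p : ℕ} {w : Lam K G} (hw : w ∈ Dg K G (p + 1)) : A.dd w ∈ Dg K G p := bd_mem _ _ hw
lemma rho0 {d : ℕ} (hη1 : ∀ p, ∀ w ∈ Dg K G p, η w ∈ Dg K G (p+1))
    (hη2 : ∀ p, 1 ≤ p → p ≤ d → ∀ w ∈ Dg K G p, A.dd (η w) + η (A.dd w) = w) {m : ℕ} {c : Module.Dual K (Lam K G)}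
    (hc : Pure m c) (h1 : 1 ≤ m) (h2 : m ≤ d) (w : Lam K G) : c ((1 - A.dd * η - η * A.dd : Op K G) w) = 0 := by
  have : c ∘ₗ (1 - A.dd * η - η * A.dd : Op K G) = 0 := by
    apply op_eq_of_Dg
    intro q w hw
    simp only [LinearMap.comp_apply, LinearMap.sub_apply, Module.End.mul_apply, Module.End.one_apply, LinearMap.zero_apply]
    by_cases hq : q = m
    · subst hq
      have := hη2 q h1 h2 w hw
      rw [sub_sub, this, sub_self, map_zero]
    · rw [map_sub, map_sub, hc q hq w hw, hc q hq _ (A.dd_mem (hη1 q w hw))]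
      rcases q with _ | q
      · rw [show A.dd w = 0 from bd_zero_deg _ _ hw]; simp
      · rw [hc _ hq _ (hη1 q _ (A.dd_mem hw))]; simp
  exact LinearMap.congr_fun this w

lemma pure_eta (hη1 : ∀ p, ∀ w ∈ Dg K G p, η w ∈ Dg K G (p+1)) {m : ℕ} {c : Module.Dual K (Lam K G)}
    (hc : Pure (m + 2) c) (x : G) : Pure m (c ∘ₗ (η * e x : Op K G)) := by
  intro q hq w hw
  exact hc (q + 2) (by omega) _ (hη1 _ _ (e_mem x hw))

lemma rhoR {d : ℕ} (hη1 : ∀ p, ∀ w ∈ Dg K G p, η w ∈ Dg K G (p+1))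
    (hη2 : ∀ p, 1 ≤ p → p ≤ d → ∀ w ∈ Dg K G p, A.dd (η w) + η (A.dd w) = w) (k : ℕ) : ∀ {m : ℕ} {c : Module.Dual K (Lam K G)}
    (hc : Pure (m + 2 * k) c) (h1 : 1 ≤ m) (h2 : m ≤ d) (Z : Op K G) (w : Lam K G),
    c (((A.HS η ^ k : Module.End K (Op K G)) ((1 - A.dd * η - η * A.dd) * Z)) w) = 0 := by
  induction k with
  | zero => intro m c hc h1 h2 Z w; exact rho0 hη1 hη2 hc h1 h2 _
  | succ k ih =>
    intro m c hc h1 h2 Z w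
    rw [pow_succ', Module.End.mul_apply, HS_sum, LinearMap.sum_apply, map_sum]
    refine Finset.sum_eq_zero fun a _ => ?_
    exact ih (pure_eta hη1 hc (A.hb a)) h1 h2 Z (A.co a w)

end eta
end Fr
end surj2
end CW

namespace CW
section surj3
namespace Fr
variable {K : Type*} [CommRing K] {G : Type*} [AddCommGroup G] [Module K G] {ι : Type*} [Fintype ι]

/-- equivariant contracting homotopy in degrees 1 to d -/
structure Zig (A : Fr K G ι) (η : Op K G) (d : ℕ) : Prop where
  deg : ∀ p, ∀ w ∈ Dg K G p, η w ∈ Dg K G (p+1)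
  hom : ∀ p, 1 ≤ p → p ≤ d → ∀ w ∈ Dg K G p, A.dd (η w) + η (A.dd w) = w
  eqv : ∀ x ∈ A.hs, der (A.br x) * η = η * der (A.br x)

/-- relative cocycles as functionals -/
structure RelC (A : Fr K G ι) (m : ℕ) (c : Module.Dual K (Lam K G)) : Prop where
  pure : Pure m c
  he : ∀ x ∈ A.hs, ∀ w, c (e x w) = 0
  hL : ∀ x ∈ A.hs, ∀ w, c (der (A.br x) w) = 0

variable {A : Fr K G ι} {η : Op K G} {d : ℕ} (Zg : Zig A η d) {m j : ℕ} {c : Module.Dual K (Lam K G)}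

/-- iterate of the zig-zag -/
def HP (A : Fr K G ι) (η : Op K G) (k : ℕ) : Module.End K (Op K G) := A.HS η ^ k
lemma HP_zero (Z : Op K G) : HP A η 0 Z = Z := rfl
lemma HP_succ (k : ℕ) (Z : Op K G) : HP A η (k + 1) Z = A.HS η (HP A η k Z) := by
  rw [HP, pow_succ', Module.End.mul_apply]; rfl
lemma HP_succ' (k : ℕ) (Z : Op K G) : HP A η (k + 1) Z = HP A η k (A.HS η Z) := by
  rw [HP, pow_succ, Module.End.mul_apply]; rfl

lemma RelC.ES (hc : RelC A m c) (Z : Op K G) (w : Lam K G) : c (A.ES Z w) = 0 := by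
  rw [ES_apply, LinearMap.sum_apply, map_sum]
  exact Finset.sum_eq_zero fun a _ => hc.he _ (A.hb_mem a) _
lemma RelC.LS (hc : RelC A m c) (Z : Op K G) (w : Lam K G) : c (A.LS Z w) = 0 := by
  rw [LS_apply, LinearMap.sum_apply, map_sum]
  exact Finset.sum_eq_zero fun a _ => hc.hL _ (A.hb_mem a) _

lemma claim1 [Algebra ℚ K] (Zg : Zig A η d) (hj : 2 * j ≤ d) (hc : RelC A (2 * j) c) (hd : ∀ w, c (A.dd w) = 0) :
    ∀ (k : ℕ) (hk : k ≤ j) (W : Op K G) (w : Lam K G), c (HP A η k (A.dd * W) w) = 0 := by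
  intro k
  induction k with
  | zero => intro _ W w; exact hd _
  | succ k ih =>
    intro hk W w
    have h1 : A.HS η (A.dd * W) = - A.ES W + (1 - A.dd * η - η * A.dd) * A.ES W + A.dd * A.HS η W + A.LS (η * W) := by
      rw [LS_eta Zg.eqv, HS_apply, HS_apply]
      have := A.dd_ES W
      linear_combination (norm := noncomm_ring) η * this
    rw [HP_succ', h1]
    simp only [map_add, map_neg, LinearMap.add_apply, LinearMap.neg_apply]
    have e1 : c (HP A η k (A.ES W) w) = 0 := by
      rcases k with _ | k
      · exact hc.ES _ _
      · rw [HP_succ', HS_apply, ES_ES]; simp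
    have e2 : c (HP A η k ((1 - A.dd * η - η * A.dd) * A.ES W) w) = 0 :=
      rhoR (m := 2 * j - 2 * k) Zg.deg Zg.hom k (by rw [Nat.sub_add_cancel (by omega)]; exact hc.pure) (by omega) (by omega) _ _
    have e4 : c (HP A η k (A.LS (η * W)) w) = 0 := by
      rw [HP, LS_HS Zg.eqv]; exact hc.LS _ _
    rw [e1, e2, ih (by omega), e4]; simp

lemma claim2 [Algebra ℚ K] (Zg : Zig A η d) (hj : 2 * j ≤ d) (hc : RelC A (2 * j) c) (hd : ∀ w, c (A.dd w) = 0)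
    {k : ℕ} (hk : k < j) (W : Op K G) (w : Lam K G) : c (HP A η k (η * A.dd * W) w) = c (HP A η k W w) := by
  have h1 : η * A.dd * W = W - A.dd * (η * W) - (1 - A.dd * η - η * A.dd) * W := by noncomm_ring
  have e2 : c (HP A η k ((1 - A.dd * η - η * A.dd) * W) w) = 0 :=
      rhoR (m := 2 * j - 2 * k) Zg.deg Zg.hom k (by rw [Nat.sub_add_cancel (by omega)]; exact hc.pure) (by omega) (by omega) _ _
  rw [h1]
  simp only [map_sub, LinearMap.sub_apply]
  rw [claim1 Zg hj hc hd k hk.le, e2, sub_zero, sub_zero]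

lemma HP_L (Zg : Zig A η d) {x : G} (hx : x ∈ A.hs) (Z : Op K G) (hZ : der (A.br x) * Z = Z * der (A.br x)) (k : ℕ) :
    der (A.br x) * HP A η k Z = HP A η k Z * der (A.br x) := by
  induction k with
  | zero => exact hZ
  | succ k ih =>
    rw [HP_succ, HS_apply, ES_apply, ← mul_assoc, Zg.eqv x hx, mul_assoc, mul_assoc]
    congr 1
    generalize HP A η k Z = Y at ih
    rw [Finset.mul_sum, Finset.sum_mul]
    have h1 : ∀ a, der (A.br x) * (e (A.hb a) * Y * A.co a) = e (A.hb a) * Y * A.co a * der (A.br x) + e (A.br x (A.hb a)) * Y * A.co a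
        - ∑ b, A.c a (A.br x (A.hb b)) • (e (A.hb a) * Y * A.co b) := by
      intro a
      have i1 := A.L_brac x (A.hb a)
      have i2 := A.L_co hx a
      have i3 : ∑ b, A.c a (A.br x (A.hb b)) • (e (A.hb a) * Y * A.co b) = e (A.hb a) * Y * ∑ b, A.c a (A.br x (A.hb b)) • A.co b := by
        rw [Finset.mul_sum]; simp only [mul_smul_comm]
      rw [i3]
      linear_combination (norm := noncomm_ring) i1 * Y * A.co a + e (A.hb a) * ih * A.co a + e (A.hb a) * Y * i2
    rw [Finset.sum_congr rfl fun a _ => h1 a, Finset.sum_sub_distrib, Finset.sum_add_distrib, Finset.sum_comm, add_sub_assoc, add_eq_left, sub_eq_zero]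
    refine Finset.sum_congr rfl fun b _ => ?_
    have := A.c_sum (N := Op K G) (LinearMap.mulRight K (Y * A.co b) ∘ₗ eL) (A.br_mem hx (A.hb_mem b))
    change ∑ a, _ • (e (A.hb a) * (Y * A.co b)) = e (A.br x (A.hb b)) * (Y * A.co b) at this
    simp only [mul_assoc]
    exact this.symm

lemma HP_mul {W : Op K G} (hW : ∀ a, A.co a * W = W * A.co a) (Z : Op K G) (k : ℕ) : HP A η k Z * W = HP A η k (Z * W) := by
  induction k with
  | zero => rfl
  | succ k ih =>
    rw [HP_succ, HP_succ, HS_sum, HS_sum, Finset.sum_mul]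
    refine Finset.sum_congr rfl fun a _ => ?_
    rw [← ih]
    linear_combination (norm := noncomm_ring) η * e (A.hb a) * HP A η k Z * hW a

lemma HP_dd (Z : Op K G) (k : ℕ) : HP A η k Z * (A.dd * A.Pi) = HP A η k (Z * A.dd) * A.Pi := by
  induction k generalizing Z with
  | zero => exact (mul_assoc _ _ _).symm
  | succ k ih =>
    rw [HP_succ, HP_succ, HS_sum, HS_sum, Finset.sum_mul, Finset.sum_mul]
    refine Finset.sum_congr rfl fun a _ => ?_
    have h1 := ih Z
    have h2 := A.co_dd a
    have h3 := A.Pi_co a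
    linear_combination (norm := noncomm_ring) η * e (A.hb a) * HP A η k Z * h2 - η * e (A.hb a) * HP A η k Z * A.dd * h3 + η * e (A.hb a) * h1 * A.co a + η * e (A.hb a) * HP A η k (Z * A.dd) * h3

lemma HP_deg (Zg : Zig A η d) {Z : Op K G} (hZ : ∀ p, ∀ w ∈ Dg K G p, Z w ∈ Dg K G (p+1)) (k : ℕ) :
    ∀ p, ∀ w ∈ Dg K G p, HP A η k Z w ∈ Dg K G (p+1) := by
  induction k with
  | zero => exact hZ
  | succ k ih =>
    intro p w hw
    rw [HP_succ, HS_sum, LinearMap.sum_apply]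
    refine Submodule.sum_mem _ fun a _ => ?_
    change η (e (A.hb a) (HP A η k Z (A.co a w))) ∈ _
    rcases p with _ | _ | p
    · rw [show A.co a w = 0 from om_zero_deg _ _ hw]; simp
    · rw [show A.co a w = 0 from om_one_deg _ _ hw]; simp
    · exact Zg.deg _ _ (e_mem _ (ih _ _ (om_mem _ _ hw)))

/-- primitives -/
def bk (A : Fr K G ι) (η : Op K G) (c : Module.Dual K (Lam K G)) (k : ℕ) : Module.Dual K (Lam K G) := c ∘ₗ (HP A η k η * A.Pi : Op K G)

lemma bk_rel (Zg : Zig A η d) (hc : RelC A (m + 1) c) (k : ℕ) : RelC A m (bk A η c k) := by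
  refine ⟨fun q hq w hw => ?_, fun x hx w => ?_, fun x hx w => ?_⟩
  · exact hc.pure _ (by omega) _ (HP_deg Zg Zg.deg k _ _ (A.Pi_mem hw))
  · change c (HP A η k η ((A.Pi * e x : Op K G) w)) = 0
    rw [A.Pi_e0 hx]; simp
  · change c (HP A η k η ((A.Pi * der (A.br x) : Op K G) w)) = 0
    rw [A.Pi_L hx]
    change c ((HP A η k η * der (A.br x) : Op K G) (A.Pi w)) = 0
    rw [← HP_L Zg hx η (Zg.eqv x hx)]
    exact hc.hL x hx _

lemma bk_dd [Algebra ℚ K] (Zg : Zig A η d) (hj : 2 * j ≤ d) (hc : RelC A (2 * j) c) (hd : ∀ w, c (A.dd w) = 0)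
    {k : ℕ} (hk : k < j) (w : Lam K G) : bk A η c k (A.dd w) = c (HP A η k 1 (A.Pi w)) + c (HP A η (k + 1) 1 (A.Pi w)) := by
  change c ((HP A η k η * (A.Pi * A.dd) : Op K G) w) = _
  rw [A.LemA, mul_add, mul_add, HP_dd, LinearMap.add_apply, LinearMap.add_apply, map_add, map_add]
  have e1 : c ((HP A η k (η * A.dd) * A.Pi : Op K G) w) = c (HP A η k 1 (A.Pi w)) := by
    have := claim2 Zg hj hc hd hk 1 (A.Pi w)
    rwa [mul_one] at this
  have e2 : c ((HP A η k η * ∑ a, der (A.br (A.hb a)) * A.Pi * ct (A.th a) : Op K G) w) = 0 := by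
    rw [Finset.mul_sum, LinearMap.sum_apply, map_sum]
    refine Finset.sum_eq_zero fun a _ => ?_
    rw [mul_assoc (der _), ← mul_assoc, ← HP_L Zg (A.hb_mem a) η (Zg.eqv _ (A.hb_mem a))]
    exact hc.hL _ (A.hb_mem a) _
  have e3 : (HP A η k η * ∑ a, e (A.hb a) * A.co a * A.Pi : Op K G) = HP A η (k + 1) 1 * A.Pi := by
    rw [← Finset.sum_mul, ← mul_assoc, HP_succ', HS_apply, ES_apply, HP_mul]
    · simp
    · intro a
      rw [Finset.mul_sum, Finset.sum_mul]
      refine Finset.sum_congr rfl fun b _ => ?_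
      have h1 := A.co_e_h a (A.hb_mem b)
      have h2 := A.co_co a b
      linear_combination (norm := noncomm_ring) h1 * A.co b + e (A.hb b) * h2
  rw [e1, e2, e3, add_zero]; rfl

theorem surj_b [Algebra ℚ K] (Zg : Zig A η d) (hj : 2 * j ≤ d) (hc : RelC A (2 * j) c) (hd : ∀ w, c (A.dd w) = 0) (hj0 : 0 < j) :
    ∃ b, RelC A (2 * j - 1) b ∧ ∀ w, b (A.dd w) = c w - (-1 : K) ^ j • c (HP A η j 1 (A.Pi w)) := by
  have key : ∀ k, k ≤ j → ∃ b, RelC A (2 * j - 1) b ∧ ∀ w, b (A.dd w) = c w - (-1 : K) ^ k • c (HP A η k 1 (A.Pi w)) := by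
    intro k
    induction k with
    | zero =>
      intro _
      refine ⟨0, ⟨by intro q _ w _; rfl, by intro _ _ _; rfl, by intro _ _ _; rfl⟩, fun w => ?_⟩
      rw [HP_zero, Module.End.one_apply, A.fPi hc.he]; simp
    | succ k ih =>
      intro hk
      obtain ⟨b, hb, hb2⟩ := ih (by omega)
      have hr := bk_rel (m := 2 * j - 1) Zg (c := c) (by rw [Nat.sub_add_cancel (by omega)]; exact hc) k
      refine ⟨b + (-1 : K) ^ k • bk A η c k, ⟨fun q hq w hw => ?_, fun x hx w => ?_, fun x hx w => ?_⟩, fun w => ?_⟩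
      · rw [LinearMap.add_apply, LinearMap.smul_apply, hb.pure q hq w hw, hr.pure q hq w hw]; simp
      · rw [LinearMap.add_apply, LinearMap.smul_apply, hb.he x hx, hr.he x hx]; simp
      · rw [LinearMap.add_apply, LinearMap.smul_apply, hb.hL x hx, hr.hL x hx]; simp
      · rw [LinearMap.add_apply, LinearMap.smul_apply, hb2, bk_dd Zg hj hc hd (by omega), pow_succ]
        simp only [smul_eq_mul]; ring
  exact key j le_rfl
end Fr
end surj3
end CW

namespace CW
section surj4
open MvPolynomial
lemma sum_cons {ι N : Type*} [Fintype ι] [AddCommMonoid N] {k : ℕ} (f : (Fin (k + 1) → ι) → N) :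
    ∑ a, f a = ∑ x, ∑ b : Fin k → ι, f (Fin.cons x b) := by
  rw [← (Fin.consEquiv (fun _ : Fin (k+1) => ι)).sum_comp, Fintype.sum_prod_type]
  rfl

lemma comm_prod {R : Type*} [Ring R] {k : ℕ} (L : R) (z z' : Fin k → R) (h : ∀ t, L * z t = z t * L + z' t) :
    L * (List.ofFn z).prod = (List.ofFn z).prod * L + ∑ r, (List.ofFn (Function.update z r (z' r))).prod := by
  induction k with
  | zero => simp
  | succ k ih =>
    have h1 := ih (fun t => z t.succ) (fun t => z' t.succ) (fun t => h _)
    have h0 := h 0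
    simp only [List.ofFn_succ, List.prod_cons, Fin.sum_univ_succ, Function.update_self]
    have e1 : (fun i : Fin k => Function.update z 0 (z' 0) i.succ) = fun i => z i.succ := by
      funext i; rw [Function.update_of_ne (Fin.succ_ne_zero i)]
    have e2 : ∀ r : Fin k, (fun i : Fin k => Function.update z r.succ (z' r.succ) i.succ) = Function.update (fun i => z i.succ) r (z' r.succ) := by
      intro r; funext i
      by_cases hi : i = r
      · subst hi; simp
      · rw [Function.update_of_ne hi, Function.update_of_ne (by simpa using hi)]
    have e3 : ∀ r : Fin k, Function.update z r.succ (z' r.succ) 0 = z 0 := fun r => by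
      rw [Function.update_of_ne (Fin.succ_ne_zero r).symm]
    simp only [e1, e2, e3]
    rw [← Finset.mul_sum]
    linear_combination (norm := noncomm_ring) h0 * (List.ofFn fun i => z i.succ).prod + z 0 * h1

namespace Fr
variable {K : Type*} [CommRing K] {G : Type*} [AddCommGroup G] [Module K G] {ι : Type*} [Fintype ι]
variable {A : Fr K G ι} {η : Op K G} {d : ℕ} {m j : ℕ} {c : Module.Dual K (Lam K G)}

/-- product of curvature contractions -/
def Cl (A : Fr K G ι) {k : ℕ} (a : Fin k → ι) : Op K G := (List.ofFn fun t => A.co (a t)).prod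
lemma Cl_cons {k : ℕ} (x : ι) (a : Fin k → ι) : A.Cl (Fin.cons x a : Fin (k + 1) → ι) = A.co x * A.Cl a := by
  simp [Cl, List.ofFn_succ]
lemma co_Cl {k : ℕ} (x : ι) (a : Fin k → ι) : A.co x * A.Cl a = A.Cl a * A.co x := by
  rw [Cl]
  refine (Commute.list_prod_right _ _ fun y hy => ?_ : Commute (A.co x) _)
  obtain ⟨t, rfl⟩ := (List.mem_ofFn' _ _).1 hy
  exact A.co_co _ _
lemma Cl_perm {k : ℕ} (a : Fin k → ι) (σ : Equiv.Perm (Fin k)) : A.Cl (a ∘ σ) = A.Cl a := by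
  refine List.Perm.prod_eq' (Equiv.Perm.ofFn_comp_perm σ (fun t => A.co (a t))) ?_
  refine List.pairwise_of_forall_mem_list ?_
  intro x hx y hy
  obtain ⟨t, rfl⟩ := (List.mem_ofFn' _ _).1 hx
  obtain ⟨s, rfl⟩ := (List.mem_ofFn' _ _).1 hy
  exact A.co_co _ _
lemma Cl_Pi {k : ℕ} (a : Fin k → ι) : A.Pi * A.Cl a = A.Cl a * A.Pi := by
  rw [Cl]
  refine (Commute.list_prod_right _ _ fun y hy => ?_ : Commute A.Pi _)
  obtain ⟨t, rfl⟩ := (List.mem_ofFn' _ _).1 hy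
  exact A.Pi_co _
lemma Cl_mem {k : ℕ} (a : Fin k → ι) : ∀ {p : ℕ} {w : Lam K G}, w ∈ Dg K G (p + 2 * k) → A.Cl a w ∈ Dg K G p := by
  induction k with
  | zero => intro p w hw; exact hw
  | succ k ih =>
    intro p w hw
    rw [← Fin.cons_self_tail a, Cl_cons, co_Cl]
    exact ih _ (om_mem _ _ hw)

/-- product of wedge-homotopy operators -/
def Ul (η : Op K G) {k : ℕ} (u : Fin k → G) : Op K G := (List.ofFn fun t => η * e (u t)).prod

lemma HP_one (k : ℕ) : HP A η k 1 = ∑ a : Fin k → ι, Ul η (A.hb ∘ a) * A.Cl a := by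
  induction k with
  | zero => simp [HP_zero, Ul, Cl]
  | succ k ih =>
    rw [HP_succ, HS_sum, sum_cons, ih]
    refine Finset.sum_congr rfl fun x _ => ?_
    rw [Finset.mul_sum, Finset.sum_mul]
    refine Finset.sum_congr rfl fun a _ => ?_
    have : Ul η (A.hb ∘ (Fin.cons x a : Fin (k + 1) → ι)) = η * e (A.hb x) * Ul η (A.hb ∘ a) := by
      simp [Ul, List.ofFn_succ]
    rw [Cl_cons, this, co_Cl]; noncomm_ring

lemma CC_pow (k : ℕ) (s : MvPolynomial ι K) (w : Lam K G) :
    ((A.pco.CC ^ k : Module.End K (ST K G (MvPolynomial ι K)))) (tm s w) = ∑ a : Fin k → ι, tm ((∏ t, A.ell (A.hb (a t))) * s) (A.Cl a w) := by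
  induction k generalizing s w with
  | zero => simp [Cl]
  | succ k ih =>
    rw [pow_succ, Module.End.mul_apply, Co.CC_t, map_sum, sum_cons]
    refine Finset.sum_congr rfl fun x _ => ?_
    rw [ih]
    refine Finset.sum_congr rfl fun a _ => ?_
    rw [Cl_cons, co_Cl, Fin.prod_univ_succ, pco_X]
    simp only [Fin.cons_zero, Fin.cons_succ]
    congr 2; ring

lemma phi_sum {P : MultilinearMap K (fun _ : Fin j => G) K} (hP : Inv A j P) (w : Lam K G) :
    A.pco.phi (Ph A.hb P) j w = ∑ a : Fin j → ι, P (A.hb ∘ a) * eps0 (A.Cl a w) := by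
  rw [Co.phi_apply, CC_pow, map_sum]
  refine Finset.sum_congr rfl fun a _ => ?_
  rw [ev_t]
  congr 1
  rw [← hP.ell (A.hb ∘ a) (fun r => A.hb_mem _)]
  change Ph A.hb P (_ * 1) = _
  rw [mul_one]; rfl

/-- the multilinear form extracted from a cochain -/
def mform (η : Op K G) (c : Module.Dual K (Lam K G)) (j : ℕ) : MultilinearMap K (fun _ : Fin j => G) K :=
  (c ∘ₗ LinearMap.applyₗ (1 : Lam K G)).compMultilinearMap
    ((MultilinearMap.mkPiAlgebraFin K j (Op K G)).compLinearMap (fun _ => LinearMap.mulLeft K η ∘ₗ eL))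
lemma mform_apply (u : Fin j → G) : mform η c j u = c (Ul η u 1) := by
  simp [mform, Ul]; rfl

/-- symmetrized form -/
def Pform (η : Op K G) (c : Module.Dual K (Lam K G)) (j : ℕ) : MultilinearMap K (fun _ : Fin j => G) K :=
  (-1 : K) ^ j • ∑ σ : Equiv.Perm (Fin j), (mform η c j).domDomCongr σ
lemma Pform_apply (u : Fin j → G) : Pform η c j u = (-1 : K) ^ j • ∑ σ : Equiv.Perm (Fin j), mform η c j (u ∘ σ) := by
  simp [Pform, sum_apply]; rfl

lemma mform_inv (Zg : Zig A η d) (hc : RelC A m c) {x : G} (hx : x ∈ A.hs) (u : Fin j → G) :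
    ∑ r, mform η c j (Function.update u r (A.br x (u r))) = 0 := by
  have h := comm_prod (der (A.br x)) (fun t => η * e (u t)) (fun t => η * e (A.br x (u t))) (fun t => by
    have h1 := Zg.eqv x hx
    have h2 := A.L_brac x (u t)
    linear_combination (norm := noncomm_ring) h1 * e (u t) + η * h2)
  have h2 := congrArg (fun Z : Op K G => c (Z 1)) h
  simp only [LinearMap.add_apply, Module.End.mul_apply, der_one, map_zero, zero_add, hc.hL x hx, LinearMap.sum_apply, map_sum] at h2
  rw [h2]
  refine Finset.sum_congr rfl fun r _ => ?_
  rw [mform_apply, Ul]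
  congr 4
  funext t
  by_cases ht : t = r
  · subst ht; simp
  · simp [Function.update_of_ne ht]

lemma Pform_inv (Zg : Zig A η d) (hc : RelC A m c) : Inv A j (Pform η c j) := by
  refine ⟨fun w σ => ?_, fun x hx w _ => ?_⟩
  · rw [Pform_apply, Pform_apply]
    congr 1
    rw [← Equiv.sum_comp (Equiv.mulLeft σ) (fun τ => mform η c j (w ∘ τ))]
    rfl
  · simp only [Pform_apply]
    rw [← Finset.smul_sum, Finset.sum_comm]
    rw [Finset.sum_eq_zero, smul_zero]
    intro σ _
    rw [← mform_inv Zg hc hx (w ∘ σ), ← Equiv.sum_comp σ]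
    refine Finset.sum_congr rfl fun r _ => ?_
    congr 1
    funext t
    by_cases ht : t = r
    · subst ht; simp
    · simp [Function.update_of_ne ht, Function.update_of_ne (fun h => ht (σ.injective h))]

lemma mform_HP (w : Lam K G) (hw : w ∈ Dg K G (2 * j)) :
    c (HP A η j 1 (A.Pi w)) = ∑ a : Fin j → ι, mform η c j (A.hb ∘ a) * eps0 (A.Cl a w) := by
  rw [HP_one, LinearMap.sum_apply, map_sum]
  refine Finset.sum_congr rfl fun a _ => ?_
  rw [Module.End.mul_apply]
  have h0 : A.Cl a w ∈ Dg K G 0 := Cl_mem a (by simpa using hw)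
  have h1 : A.Cl a (A.Pi w) = eps0 (A.Cl a w) • 1 := by
    have := LinearMap.congr_fun (A.Cl_Pi a) w
    simp only [Module.End.mul_apply] at this
    rw [← this]
    conv_lhs => rw [eq_eps0 h0]
    rw [map_smul, Pi_one]
  rw [h1, map_smul, map_smul, mform_apply, smul_eq_mul, mul_comm]

/-- surjectivity, abstract form -/
theorem surj [Algebra ℚ K] (Zg : Zig A η d) (hj : 2 * j ≤ d) (hc : RelC A (2 * j) c) (hd : ∀ w, c (A.dd w) = 0) (hj0 : 0 < j) :
    ∃ P, Inv A j P ∧ ∃ b, RelC A (2 * j - 1) b ∧ ∀ w ∈ Dg K G (2 * j),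
      (j.factorial : K) * b (A.dd w) = (j.factorial : K) * c w - A.pco.phi (Ph A.hb P) j w := by
  obtain ⟨b, hb, hb2⟩ := surj_b Zg hj hc hd hj0
  refine ⟨Pform η c j, Pform_inv Zg hc, b, hb, fun w hw => ?_⟩
  rw [hb2, mform_HP w hw, phi_sum (Pform_inv Zg hc), mul_sub]
  congr 1
  have : ∀ σ : Equiv.Perm (Fin j), ∑ a : Fin j → ι, mform η c j (A.hb ∘ a) * eps0 (A.Cl a w)
      = ∑ a : Fin j → ι, mform η c j (A.hb ∘ a ∘ σ) * eps0 (A.Cl a w) := by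
    intro σ
    rw [← Equiv.sum_comp (Equiv.arrowCongr σ.symm (Equiv.refl ι))]
    refine Finset.sum_congr rfl fun a _ => ?_
    have h : (Equiv.arrowCongr σ.symm (Equiv.refl ι)) a = a ∘ σ := by
      funext t; simp [Equiv.arrowCongr]
    rw [h, Cl_perm]
  simp only [Pform_apply, smul_eq_mul, mul_assoc, Finset.sum_mul]
  rw [← Finset.mul_sum, Finset.sum_comm]
  have h2 : ∀ σ ∈ (Finset.univ : Finset (Equiv.Perm (Fin j))), ∑ a : Fin j → ι, mform η c j ((A.hb ∘ a) ∘ σ) * eps0 (A.Cl a w)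
     = ∑ a : Fin j → ι, mform η c j (A.hb ∘ a) * eps0 (A.Cl a w) := fun σ _ => (this σ).symm
  rw [Finset.sum_congr rfl h2, Finset.sum_const, Finset.card_univ, Fintype.card_perm, Fintype.card_fin, nsmul_eq_mul]
  ring
end Fr
end surj4
end CW

namespace CW
section weyl1
variable {R : Type*} [CommRing R]
/-- swap of conjugate variables -/
def sw {n : ℕ} (i : Fin (2*n)) : Fin (2*n) := if h : i.1 % 2 = 0 then ⟨i.1 + 1, by have := i.2; omega⟩ else ⟨i.1 - 1, by have := i.2; omega⟩
/-- sign of a variable -/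
def sg (R : Type*) [CommRing R] {n : ℕ} (i : Fin (2*n)) : R := if i.1 % 2 = 0 then 1 else -1
lemma sw_p {n : ℕ} (r : Fin n) : sw (pVar n r) = qVar n r := by simp [sw, pVar, qVar]
lemma sw_q {n : ℕ} (r : Fin n) : sw (qVar n r) = pVar n r := by
  have : (2 * r.1 + 1) % 2 ≠ 0 := by omega
  simp [sw, pVar, qVar]
lemma sg_p {n : ℕ} (r : Fin n) : sg R (pVar n r) = 1 := by simp [sg, pVar]
lemma sg_q {n : ℕ} (r : Fin n) : sg R (qVar n r) = -1 := by
  have : (2 * r.1 + 1) % 2 ≠ 0 := by omega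
  simp [sg, qVar]
lemma var_cases {n : ℕ} (i : Fin (2*n)) : (∃ r, i = pVar n r) ∨ ∃ r, i = qVar n r := by
  by_cases h : i.1 % 2 = 0
  · exact Or.inl ⟨⟨i.1 / 2, by have := i.2; omega⟩, by ext; simp [pVar]; omega⟩
  · exact Or.inr ⟨⟨i.1 / 2, by have := i.2; omega⟩, by ext; simp [qVar]; omega⟩
lemma p_inj {n : ℕ} {r s : Fin n} : pVar n r = pVar n s ↔ r = s := by simp [pVar, Fin.ext_iff]
lemma q_inj {n : ℕ} {r s : Fin n} : qVar n r = qVar n s ↔ r = s := by simp [qVar, Fin.ext_iff]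
lemma p_ne_q {n : ℕ} (r s : Fin n) : pVar n r ≠ qVar n s := by simp [pVar, qVar, Fin.ext_iff]; omega
lemma sw_sw {n : ℕ} (i : Fin (2*n)) : sw (sw i) = i := by
  rcases var_cases i with ⟨r, rfl⟩ | ⟨r, rfl⟩
  · rw [sw_p, sw_q]
  · rw [sw_q, sw_p]
lemma sg_sw {n : ℕ} (i : Fin (2*n)) : sg R (sw i) = - sg R i := by
  rcases var_cases i with ⟨r, rfl⟩ | ⟨r, rfl⟩
  · rw [sw_p, sg_p, sg_q]
  · rw [sw_q, sg_p, sg_q, neg_neg]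
lemma sg_sg {n : ℕ} (i : Fin (2*n)) : sg R i * sg R i = 1 := by
  rcases var_cases i with ⟨r, rfl⟩ | ⟨r, rfl⟩
  · rw [sg_p, one_mul]
  · rw [sg_q]; ring

/-- multiplication by a variable -/
def mX {σ : Type*} (u : σ) : Module.End R (MvPolynomial σ R) := LinearMap.mulLeft R (X u)
/-- partial derivative -/
def gD (R : Type*) [CommRing R] {σ : Type*} (u : σ) : Module.End R (MvPolynomial σ R) := (pderiv u).toLinearMap
lemma mX_apply {σ : Type*} (u : σ) (a : MvPolynomial σ R) : mX u a = X u * a := rfl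
lemma gD_apply {σ : Type*} (u : σ) (a : MvPolynomial σ R) : gD R u a = pderiv u a := rfl
lemma gD_mX {σ : Type*} [DecidableEq σ] (v u : σ) : gD R v * mX u = mX u * gD R v + if v = u then 1 else 0 := by
  refine LinearMap.ext fun a => ?_
  simp only [Module.End.mul_apply, mX_apply, gD_apply, LinearMap.add_apply, pderiv_mul, pderiv_X, Pi.single_apply]
  by_cases h : v = u
  · subst h; simp [add_comm]
  · simp [h, Ne.symm h]
lemma gD_comm {σ : Type*} (v u : σ) : gD R v * gD R u = gD R u * gD R v := by
  refine LinearMap.ext fun a => MvPolynomial.ext _ _ fun m => ?_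
  classical
  simp only [Module.End.mul_apply, gD_apply, coeff_pderiv, Finsupp.add_apply, Finsupp.single_apply]
  rw [add_right_comm]
  by_cases h : v = u
  · subst h; rfl
  · simp [h, Ne.symm h]; ring

variable [Algebra ℂ R]
/-- one half -/
def hf (R : Type*) [CommRing R] [Algebra ℂ R] : R := algebraMap ℂ R (1/2)
lemma hf_two : hf R + hf R = 1 := by rw [hf, ← map_add]; norm_num
/-- the operator alpha -/
def gal (R : Type*) [CommRing R] [Algebra ℂ R] (n : ℕ) : Module.End R (MvPolynomial (Fin 2 × Fin (2*n)) R) :=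
  algebraMap ℂ R (1/2) • ∑ r : Fin n,
    (gD R ((0 : Fin 2), pVar n r) * gD R ((1 : Fin 2), qVar n r) - gD R ((0 : Fin 2), qVar n r) * gD R ((1 : Fin 2), pVar n r))
lemma rg1 {S : Type*} [Ring S] {a b c d u : S} (ha : a * u = u * a) (hb : b * u = u * b) (hc : c * u = u * c) (hd : d * u = u * d) :
    (a * b - c * d) * u = u * (a * b - c * d) := by
  rw [sub_mul, mul_sub, mul_assoc, hb, ← mul_assoc, ha, mul_assoc, mul_assoc c, hd, ← mul_assoc c, hc, mul_assoc]
lemma rg2 {S : Type*} [Ring S] {a b c d x p q : S} (ha : a * x = x * a + p) (hb : b * x = x * b) (hc : c * x = x * c + q) (hd : d * x = x * d) :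
    (a * b - c * d) * x = x * (a * b - c * d) + (p * b - q * d) := by
  rw [sub_mul, mul_sub, mul_assoc, hb, ← mul_assoc, ha, mul_assoc c, hd, ← mul_assoc c, hc]
  noncomm_ring
lemma rg3 {S : Type*} [Ring S] {a b c d x p q : S} (ha : a * x = x * a) (hb : b * x = x * b + p) (hc : c * x = x * c) (hd : d * x = x * d + q) :
    (a * b - c * d) * x = x * (a * b - c * d) + (a * p - c * q) := by
  rw [sub_mul, mul_sub, mul_assoc, hb, mul_add, ← mul_assoc, ha, mul_assoc c, hd, mul_add, ← mul_assoc c, hc]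
  noncomm_ring
lemma al_D (n : ℕ) (u : Fin 2 × Fin (2*n)) : gal R n * gD R u = gD R u * gal R n := by
  rw [gal, smul_mul_assoc, mul_smul_comm, Finset.sum_mul, Finset.mul_sum]
  congr 1
  refine Finset.sum_congr rfl fun r _ => ?_
  have h1 := fun v : Fin 2 × Fin (2*n) => gD_comm (R := R) v u
  exact rg1 (h1 _) (h1 _) (h1 _) (h1 _)
lemma al_X0 (n : ℕ) (u : Fin (2*n)) : gal R n * mX ((0 : Fin 2), u) = mX ((0 : Fin 2), u) * gal R n + (hf R * sg R u) • gD R ((1 : Fin 2), sw u) := by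
  have key : ∀ r : Fin n, (gD R ((0 : Fin 2), pVar n r) * gD R ((1 : Fin 2), qVar n r) - gD R ((0 : Fin 2), qVar n r) * gD R ((1 : Fin 2), pVar n r)) * mX ((0 : Fin 2), u)
      = mX ((0 : Fin 2), u) * (gD R ((0 : Fin 2), pVar n r) * gD R ((1 : Fin 2), qVar n r) - gD R ((0 : Fin 2), qVar n r) * gD R ((1 : Fin 2), pVar n r))
       + ((if pVar n r = u then gD R ((1 : Fin 2), qVar n r) else 0) - (if qVar n r = u then gD R ((1 : Fin 2), pVar n r) else 0)) := by
    intro r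
    have h1 := fun v : Fin (2*n) => gD_mX (R := R) ((1 : Fin 2), v) (0, u)
    have h2 := fun v : Fin (2*n) => gD_mX (R := R) ((0 : Fin 2), v) (0, u)
    simp only [Prod.mk.injEq, true_and, one_ne_zero, false_and, if_false, add_zero] at h1 h2
    have e1 : (if pVar n r = u then (1 : Module.End R (MvPolynomial (Fin 2 × Fin (2*n)) R)) else 0) * gD R ((1 : Fin 2), qVar n r) = if pVar n r = u then gD R ((1 : Fin 2), qVar n r) else 0 := by split_ifs <;> simp
    have e2 : (if qVar n r = u then (1 : Module.End R (MvPolynomial (Fin 2 × Fin (2*n)) R)) else 0) * gD R ((1 : Fin 2), pVar n r) = if qVar n r = u then gD R ((1 : Fin 2), pVar n r) else 0 := by split_ifs <;> simp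
    rw [rg2 (h2 _) (h1 _) (h2 _) (h1 _), e1, e2]
  rw [gal, smul_mul_assoc, mul_smul_comm, Finset.sum_mul, Finset.sum_congr rfl fun r _ => key r, Finset.sum_add_distrib, ← Finset.mul_sum, smul_add, mul_smul]
  congr 2
  rcases var_cases u with ⟨r, rfl⟩ | ⟨r, rfl⟩
  · simp [p_inj, (p_ne_q _ _).symm, sg_p, sw_p]
  · simp [q_inj, p_ne_q, sg_q, sw_q]
lemma al_X1 (n : ℕ) (u : Fin (2*n)) : gal R n * mX ((1 : Fin 2), u) = mX ((1 : Fin 2), u) * gal R n + (-(hf R * sg R u)) • gD R ((0 : Fin 2), sw u) := by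
  have key : ∀ r : Fin n, (gD R ((0 : Fin 2), pVar n r) * gD R ((1 : Fin 2), qVar n r) - gD R ((0 : Fin 2), qVar n r) * gD R ((1 : Fin 2), pVar n r)) * mX ((1 : Fin 2), u)
      = mX ((1 : Fin 2), u) * (gD R ((0 : Fin 2), pVar n r) * gD R ((1 : Fin 2), qVar n r) - gD R ((0 : Fin 2), qVar n r) * gD R ((1 : Fin 2), pVar n r))
       + ((if qVar n r = u then gD R ((0 : Fin 2), pVar n r) else 0) - (if pVar n r = u then gD R ((0 : Fin 2), qVar n r) else 0)) := by
    intro r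
    have h1 := fun v : Fin (2*n) => gD_mX (R := R) ((1 : Fin 2), v) (1, u)
    have h2 := fun v : Fin (2*n) => gD_mX (R := R) ((0 : Fin 2), v) (1, u)
    simp only [Prod.mk.injEq, true_and, zero_ne_one, false_and, if_false, add_zero] at h1 h2
    have e1 : gD R ((0 : Fin 2), qVar n r) * (if pVar n r = u then (1 : Module.End R (MvPolynomial (Fin 2 × Fin (2*n)) R)) else 0) = if pVar n r = u then gD R ((0 : Fin 2), qVar n r) else 0 := by split_ifs <;> simp
    have e2 : gD R ((0 : Fin 2), pVar n r) * (if qVar n r = u then (1 : Module.End R (MvPolynomial (Fin 2 × Fin (2*n)) R)) else 0) = if qVar n r = u then gD R ((0 : Fin 2), pVar n r) else 0 := by split_ifs <;> simp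
    rw [rg3 (h2 _) (h1 _) (h2 _) (h1 _), e1, e2]
  rw [gal, smul_mul_assoc, mul_smul_comm, Finset.sum_mul, Finset.sum_congr rfl fun r _ => key r, Finset.sum_add_distrib, ← Finset.mul_sum, smul_add, ← mul_neg, mul_smul]
  congr 2
  rcases var_cases u with ⟨r, rfl⟩ | ⟨r, rfl⟩
  · simp [p_inj, (p_ne_q _ _).symm, sg_p, sw_p]
  · simp [q_inj, p_ne_q, sg_q, sw_q]
/-- polynomials of degree less than k -/
def Fd (R : Type*) [CommRing R] (σ : Type*) (k : ℕ) : Submodule R (MvPolynomial σ R) where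
  carrier := {a | ∀ s, k ≤ ∑ i ∈ s.support, s i → coeff s a = 0}
  add_mem' := fun ha hb s hs => by rw [coeff_add, ha s hs, hb s hs, add_zero]
  zero_mem' := fun s _ => coeff_zero s
  smul_mem' := fun r a ha s hs => by rw [coeff_smul, ha s hs, smul_zero]
lemma mem_Fd {σ : Type*} {k : ℕ} {a : MvPolynomial σ R} : a ∈ Fd R σ k ↔ ∀ s, k ≤ ∑ i ∈ s.support, s i → coeff s a = 0 := Iff.rfl
lemma Fd_mono {σ : Type*} {k l : ℕ} (h : k ≤ l) {a : MvPolynomial σ R} (ha : a ∈ Fd R σ k) : a ∈ Fd R σ l :=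
  fun s hs => ha s (h.trans hs)
lemma Fd_zero {σ : Type*} {a : MvPolynomial σ R} (ha : a ∈ Fd R σ 0) : a = 0 := MvPolynomial.ext _ _ fun s => ha s (Nat.zero_le _)
lemma mem_Fd_deg {σ : Type*} (a : MvPolynomial σ R) : a ∈ Fd R σ (a.totalDegree + 1) := fun s hs => coeff_eq_zero_of_totalDegree_lt hs
lemma gD_Fd {σ : Type*} (u : σ) {k : ℕ} {a : MvPolynomial σ R} (ha : a ∈ Fd R σ (k+1)) : gD R u a ∈ Fd R σ k := by
  intro s hs
  rw [gD_apply, coeff_pderiv, ha, zero_mul]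
  have h1 : ∀ s : σ →₀ ℕ, ∑ i ∈ s.support, s i = Finsupp.degree s := fun s => rfl
  rw [h1] at hs ⊢
  rw [map_add, Finsupp.degree_single]; omega
lemma gal_Fd {n k : ℕ} {a : MvPolynomial (Fin 2 × Fin (2*n)) R} (ha : a ∈ Fd R _ (k+1)) : gal R n a ∈ Fd R _ k := by
  rw [gal, LinearMap.smul_apply, LinearMap.sum_apply]
  refine Submodule.smul_mem _ _ (Submodule.sum_mem _ fun r _ => ?_)
  rw [LinearMap.sub_apply]
  exact Submodule.sub_mem _ (gD_Fd _ (Fd_mono (Nat.le_succ k) (gD_Fd _ ha))|> fun h => h) (gD_Fd _ (Fd_mono (Nat.le_succ k) (gD_Fd _ ha)) |> fun h => h)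
lemma gal_pow {n : ℕ} (m : ℕ) : ∀ {k : ℕ} {a : MvPolynomial (Fin 2 × Fin (2*n)) R}, a ∈ Fd R _ k → k ≤ m → (gal R n ^ m) a = 0 := by
  induction m with
  | zero => intro k a ha hk; obtain rfl : k = 0 := by omega
            rw [Fd_zero ha, map_zero]
  | succ m ih =>
    intro k a ha hk
    rw [pow_succ, Module.End.mul_apply]
    exact ih (gal_Fd (Fd_mono hk ha)) le_rfl
end weyl1
end CW

namespace CW
section weyl2
variable {R : Type*} [CommRing R] [Algebra ℂ R]
/-- exponential coefficients -/
def co (ε : R) (m : ℕ) : R := algebraMap ℂ R ((m.factorial : ℂ)⁻¹) * ε ^ m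
lemma co_zero (ε : R) : co ε 0 = 1 := by simp [co]
lemma co_succ (ε : R) (m : ℕ) : co ε (m+1) * ((m+1 : ℕ) : R) = ε * co ε m := by
  have : (algebraMap ℂ R (((m+1).factorial : ℂ)⁻¹)) * ((m+1 : ℕ) : R) = algebraMap ℂ R ((m.factorial : ℂ)⁻¹) := by
    rw [← map_natCast (algebraMap ℂ R), ← map_mul]; congr 1
    rw [Nat.factorial_succ]; push_cast
    have h1 : (m.factorial : ℂ) ≠ 0 := by exact_mod_cast m.factorial_ne_zero
    have h2 : ((m : ℂ) + 1) ≠ 0 := by exact_mod_cast m.succ_ne_zero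
    field_simp
  rw [co, co, ← this]; ring
/-- exponential -/
def gEx (n : ℕ) (ε : R) (a : MvPolynomial (Fin 2 × Fin (2*n)) R) : MvPolynomial (Fin 2 × Fin (2*n)) R :=
  ∑ m ∈ Finset.range (a.totalDegree + 1), co ε m • (gal R n ^ m) a
variable {n : ℕ} {ε : R}
lemma gEx_eq {a : MvPolynomial (Fin 2 × Fin (2*n)) R} {M : ℕ} (ha : a ∈ Fd R _ M) :
    gEx n ε a = ∑ m ∈ Finset.range M, co ε m • (gal R n ^ m) a := by
  rw [gEx]
  rcases le_total (a.totalDegree + 1) M with h | h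
  · refine Finset.sum_subset (Finset.range_mono h) fun m _ hm => ?_
    rw [gal_pow m (mem_Fd_deg a) (by simpa using hm), smul_zero]
  · refine (Finset.sum_subset (Finset.range_mono h) fun m _ hm => ?_).symm
    rw [gal_pow m ha (by simpa using hm), smul_zero]
lemma ex_Fd {σ : Type*} (a b : MvPolynomial σ R) : ∃ M, a ∈ Fd R σ M ∧ b ∈ Fd R σ M :=
  ⟨max (a.totalDegree + 1) (b.totalDegree + 1), Fd_mono (le_max_left _ _) (mem_Fd_deg a), Fd_mono (le_max_right _ _) (mem_Fd_deg b)⟩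
lemma gEx_add (a b : MvPolynomial (Fin 2 × Fin (2*n)) R) : gEx n ε (a + b) = gEx n ε a + gEx n ε b := by
  obtain ⟨M, ha, hb⟩ := ex_Fd a b
  rw [gEx_eq ha, gEx_eq hb, gEx_eq (Submodule.add_mem _ ha hb), ← Finset.sum_add_distrib]
  exact Finset.sum_congr rfl fun m _ => by rw [map_add, smul_add]
lemma gEx_smul (r : R) (a : MvPolynomial (Fin 2 × Fin (2*n)) R) : gEx n ε (r • a) = r • gEx n ε a := by
  rw [gEx_eq (mem_Fd_deg a), gEx_eq (Submodule.smul_mem _ r (mem_Fd_deg a)), Finset.smul_sum]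
  exact Finset.sum_congr rfl fun m _ => by rw [map_smul, smul_comm]
lemma gEx_D (u : Fin 2 × Fin (2*n)) (a : MvPolynomial (Fin 2 × Fin (2*n)) R) : gEx n ε (gD R u a) = gD R u (gEx n ε a) := by
  rw [gEx_eq (mem_Fd_deg a), gEx_eq (gD_Fd u (Fd_mono (Nat.le_succ _) (mem_Fd_deg a))), map_sum]
  refine Finset.sum_congr rfl fun m _ => ?_
  have h : (gal R n ^ m) * gD R u = gD R u * gal R n ^ m := ((show Commute (gal R n) (gD R u) from al_D n u).pow_left m)
  rw [map_smul, ← Module.End.mul_apply, h, Module.End.mul_apply]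
lemma pow_comm_aux {S : Type*} [Ring S] {α Y D : S} (h1 : α * Y = Y * α + D) (h2 : α * D = D * α) (m : ℕ) :
    α ^ (m+1) * Y = Y * α ^ (m+1) + ((m+1 : ℕ) : S) * (D * α ^ m) := by
  induction m with
  | zero => simp [h1]
  | succ m ih =>
    rw [pow_succ' α (m+1), mul_assoc, ih, mul_add, ← mul_assoc, h1, ← mul_assoc α, ← (Nat.cast_commute (m+1) α).eq, mul_assoc, ← mul_assoc α, h2, add_mul]
    rw [mul_assoc Y, mul_assoc D, ← pow_succ', ← pow_succ', add_assoc, Nat.cast_succ (m+1), add_mul _ 1, one_mul, add_comm (D * _)]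
lemma gEx_Y {Y D : Module.End R (MvPolynomial (Fin 2 × Fin (2*n)) R)} (h1 : gal R n * Y = Y * gal R n + D) (h2 : gal R n * D = D * gal R n)
    (a : MvPolynomial (Fin 2 × Fin (2*n)) R) : gEx n ε (Y a) = Y (gEx n ε a) + ε • D (gEx n ε a) := by
  obtain ⟨M, ha, hb⟩ := ex_Fd a (Y a)
  rw [gEx_eq (Fd_mono (Nat.le_succ M) hb), Finset.sum_range_succ', gEx_eq ha, map_sum D, Finset.smul_sum, ← gEx_eq ha, gEx_eq (Fd_mono (Nat.le_succ M) ha), Finset.sum_range_succ', map_add, map_sum]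
  have : ∀ m, co ε (m+1) • (gal R n ^ (m+1)) (Y a) = Y (co ε (m+1) • (gal R n ^ (m+1)) a) + ε • D (co ε m • (gal R n ^ m) a) := by
    intro m
    have h := LinearMap.congr_fun (pow_comm_aux h1 h2 m) a
    rw [Module.End.mul_apply, LinearMap.add_apply, Module.End.mul_apply, ← nsmul_eq_mul, LinearMap.smul_apply, Module.End.mul_apply] at h
    rw [h, smul_add, map_smul, map_smul, ← Nat.cast_smul_eq_nsmul R, smul_smul, smul_smul, co_succ]
  rw [Finset.sum_congr rfl fun m _ => this m, Finset.sum_add_distrib]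
  simp only [pow_zero, Module.End.one_apply, map_smul]
  abel

/-- multiplication map -/
def gmu (n : ℕ) : MvPolynomial (Fin 2 × Fin (2*n)) R →ₐ[R] MvPolynomial (Fin (2*n)) R := aeval (fun v => X v.2)
lemma gmu_X (v : Fin 2 × Fin (2*n)) : gmu n (X v : MvPolynomial _ R) = X v.2 := by rw [gmu, aeval_X]
lemma gmu_D (v : Fin (2*n)) (a : MvPolynomial (Fin 2 × Fin (2*n)) R) : pderiv v (gmu n a) = gmu n (pderiv (0, v) a + pderiv (1, v) a) := by
  induction a using MvPolynomial.induction_on with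
  | C r => simp [gmu]
  | add p q hp hq => simp only [map_add] at hp hq ⊢; rw [hp, hq]; abel
  | mul_X p u hp =>
    rw [map_mul, pderiv_mul, hp, pderiv_mul, pderiv_mul, gmu_X, pderiv_X, pderiv_X, pderiv_X]
    simp only [map_add, map_mul, gmu_X]
    rcases u with ⟨i, u⟩
    by_cases h : u = v
    · subst h
      fin_cases i <;> simp [Pi.single_apply] <;> ring
    · fin_cases i <;> simp [Pi.single_apply, h] <;> ring
/-- elementary tensors -/
def gT (n : ℕ) (f g : MvPolynomial (Fin (2*n)) R) : MvPolynomial (Fin 2 × Fin (2*n)) R := rename (fun v => ((0 : Fin 2), v)) f * rename (fun v => ((1 : Fin 2), v)) g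
lemma gD0_T (v : Fin (2*n)) (f g : MvPolynomial (Fin (2*n)) R) : gD R (0, v) (gT n f g) = gT n (pderiv v f) g := by
  rw [gD_apply, gT, pderiv_mul, pderiv_rename (f := fun v => ((0 : Fin 2), v)) (fun _ _ h => (Prod.ext_iff.1 h).2) v f]
  rw [pderiv_eq_zero_of_notMem_vars (f := rename (fun v => ((1 : Fin 2), v)) g), mul_zero, add_zero, gT]
  intro h
  classical
  have := vars_rename (fun v => ((1 : Fin 2), v)) g h
  simp at this
lemma gD1_T (v : Fin (2*n)) (f g : MvPolynomial (Fin (2*n)) R) : gD R (1, v) (gT n f g) = gT n f (pderiv v g) := by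
  rw [gD_apply, gT, pderiv_mul, pderiv_rename (f := fun v => ((1 : Fin 2), v)) (fun _ _ h => (Prod.ext_iff.1 h).2) v g]
  rw [pderiv_eq_zero_of_notMem_vars (f := rename (fun v => ((0 : Fin 2), v)) f), zero_mul, zero_add, gT]
  intro h
  classical
  have := vars_rename (fun v => ((0 : Fin 2), v)) f h
  simp at this
/-- star product -/
def gst (n : ℕ) (ε : R) (f g : MvPolynomial (Fin (2*n)) R) : MvPolynomial (Fin (2*n)) R := gmu n (gEx n ε (gT n f g))
lemma gst_addl (f f' g : MvPolynomial (Fin (2*n)) R) : gst n ε (f + f') g = gst n ε f g + gst n ε f' g := by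
  rw [gst, gT, map_add, add_mul, gEx_add, map_add]; rfl
lemma gst_addr (f g g' : MvPolynomial (Fin (2*n)) R) : gst n ε f (g + g') = gst n ε f g + gst n ε f g' := by
  rw [gst, gT, map_add, mul_add, gEx_add, map_add]; rfl
lemma gst_smull (r : R) (f g : MvPolynomial (Fin (2*n)) R) : gst n ε (r • f) g = r • gst n ε f g := by
  rw [gst, gT, map_smul, smul_mul_assoc, gEx_smul, map_smul]; rfl
lemma gst_smulr (r : R) (f g : MvPolynomial (Fin (2*n)) R) : gst n ε f (r • g) = r • gst n ε f g := by
  rw [gst, gT, map_smul, mul_smul_comm, gEx_smul, map_smul]; rfl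
/-- star product as a bilinear map -/
def gS (n : ℕ) (ε : R) : MvPolynomial (Fin (2*n)) R →ₗ[R] Module.End R (MvPolynomial (Fin (2*n)) R) :=
  LinearMap.mk₂ R (gst n ε) gst_addl gst_smull gst_addr gst_smulr
lemma gS_apply (f g : MvPolynomial (Fin (2*n)) R) : gS n ε f g = gst n ε f g := rfl
/-- Hamiltonian derivation -/
def dl (v : Fin (2*n)) : Module.End R (MvPolynomial (Fin (2*n)) R) := sg R v • gD R (sw v)
lemma dl_apply (v : Fin (2*n)) (f : MvPolynomial (Fin (2*n)) R) : dl v f = sg R v • pderiv (sw v) f := rfl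
lemma gS_Xl (v : Fin (2*n)) (f g : MvPolynomial (Fin (2*n)) R) : gS n ε (X v * f) g = X v * gS n ε f g + (ε * hf R) • gS n ε f (dl v g) := by
  have h0 : gT n (X v * f) g = mX ((0 : Fin 2), v) (gT n f g) := by rw [gT, map_mul, rename_X, mX_apply, gT, mul_assoc]
  have h2 : gal R n * ((hf R * sg R v) • gD R ((1 : Fin 2), sw v)) = ((hf R * sg R v) • gD R ((1 : Fin 2), sw v)) * gal R n := by
    rw [mul_smul_comm, al_D, smul_mul_assoc]
  rw [gS_apply, gst, h0, gEx_Y (al_X0 n v) h2, LinearMap.smul_apply, ← gEx_D, gD1_T, map_add, mX_apply, map_mul, gmu_X, map_smul, map_smul]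
  rw [dl_apply, map_smul, gS_apply, gS_apply, gst, gst, smul_smul, smul_smul, mul_assoc]
lemma gS_Xr (v : Fin (2*n)) (f g : MvPolynomial (Fin (2*n)) R) : gS n ε f (X v * g) = X v * gS n ε f g - (ε * hf R) • gS n ε (dl v f) g := by
  have h0 : gT n f (X v * g) = mX ((1 : Fin 2), v) (gT n f g) := by rw [gT, map_mul, rename_X, mX_apply, gT]; ring
  have h2 : gal R n * ((-(hf R * sg R v)) • gD R ((0 : Fin 2), sw v)) = ((-(hf R * sg R v)) • gD R ((0 : Fin 2), sw v)) * gal R n := by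
    rw [mul_smul_comm, al_D, smul_mul_assoc]
  rw [gS_apply, gst, h0, gEx_Y (al_X1 n v) h2, LinearMap.smul_apply, ← gEx_D, gD0_T, map_add, mX_apply, map_mul, gmu_X, map_smul, map_smul]
  rw [dl_apply, map_smul, LinearMap.smul_apply, gS_apply, gS_apply, gst, gst, smul_smul, smul_smul, sub_eq_add_neg, ← neg_smul]
  congr 2; ring
lemma gS_D (v : Fin (2*n)) (f g : MvPolynomial (Fin (2*n)) R) : pderiv v (gS n ε f g) = gS n ε (pderiv v f) g + gS n ε f (pderiv v g) := by
  rw [gS_apply, gst, gmu_D, map_add, ← gD_apply, ← gD_apply, ← gEx_D, ← gEx_D, gD0_T, gD1_T]; rfl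
lemma gS_dl (v : Fin (2*n)) (f g : MvPolynomial (Fin (2*n)) R) : dl v (gS n ε f g) = gS n ε (dl v f) g + gS n ε f (dl v g) := by
  rw [dl_apply, gS_D, dl_apply, dl_apply, map_smul, map_smul, LinearMap.smul_apply, smul_add]
lemma dl_mul (v : Fin (2*n)) (f g : MvPolynomial (Fin (2*n)) R) : dl v (f * g) = dl v f * g + f * dl v g := by
  rw [dl_apply, pderiv_mul, dl_apply, dl_apply, smul_add, smul_mul_assoc, mul_smul_comm]
lemma gal_rename1 (g : MvPolynomial (Fin (2*n)) R) : gal R n (gT n 1 g) = 0 := by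
  rw [gal, LinearMap.smul_apply, LinearMap.sum_apply, Finset.sum_eq_zero, smul_zero]
  intro r _
  rw [LinearMap.sub_apply, Module.End.mul_apply, Module.End.mul_apply, gD1_T, gD1_T, gD0_T, gD0_T, pderiv_one, pderiv_one, gT, gT, map_zero, zero_mul, zero_mul, sub_zero]
lemma gal_rename0 (f : MvPolynomial (Fin (2*n)) R) : gal R n (gT n f 1) = 0 := by
  rw [gal, LinearMap.smul_apply, LinearMap.sum_apply, Finset.sum_eq_zero, smul_zero]
  intro r _
  rw [LinearMap.sub_apply, Module.End.mul_apply, Module.End.mul_apply, gD1_T, gD1_T, gD0_T, gD0_T, pderiv_one, pderiv_one, gT, gT, map_zero, mul_zero, mul_zero, sub_zero]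
lemma gEx_ker {a : MvPolynomial (Fin 2 × Fin (2*n)) R} (h : gal R n a = 0) : gEx n ε a = a := by
  rw [gEx, Finset.sum_range_succ', Finset.sum_eq_zero, zero_add, co_zero, one_smul, pow_zero, Module.End.one_apply]
  intro m _
  rw [pow_succ, Module.End.mul_apply, h, map_zero, smul_zero]
lemma gmu_T (f g : MvPolynomial (Fin (2*n)) R) : gmu n (gT n f g) = f * g := by
  rw [gT, map_mul, gmu, aeval_rename, aeval_rename]
  congr 1 <;> exact aeval_X_left_apply _
lemma gS_one (g : MvPolynomial (Fin (2*n)) R) : gS n ε 1 g = g := by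
  rw [gS_apply, gst, gEx_ker (gal_rename1 g), gmu_T, one_mul]
lemma gS_one' (f : MvPolynomial (Fin (2*n)) R) : gS n ε f 1 = f := by
  rw [gS_apply, gst, gEx_ker (gal_rename0 f), gmu_T, mul_one]
lemma gS_assoc (f g k : MvPolynomial (Fin (2*n)) R) : gS n ε (gS n ε f g) k = gS n ε f (gS n ε g k) := by
  induction f using MvPolynomial.induction_on generalizing g k with
  | C r =>
    have h : (C r : MvPolynomial (Fin (2*n)) R) = r • 1 := by rw [smul_eq_C_mul, mul_one]
    rw [h, map_smul, LinearMap.smul_apply, gS_one, map_smul, LinearMap.smul_apply, LinearMap.smul_apply, gS_one]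
  | add p q hp hq => rw [map_add, LinearMap.add_apply, map_add, LinearMap.add_apply, hp, hq, LinearMap.add_apply]
  | mul_X p v hp =>
    rw [mul_comm p, gS_Xl, map_add, LinearMap.add_apply, gS_Xl, map_smul, LinearMap.smul_apply, hp, hp, hp, gS_Xl, gS_dl, map_add, smul_add]
    abel
end weyl2
end CW

namespace CW
section absbr
variable {R : Type*} [CommRing R] {G : Type*} [AddCommGroup G] [Module R G]
/-- commutator bracket -/
def cbr (m : G →ₗ[R] Module.End R G) (s : R) : G →ₗ[R] Module.End R G := s • (m - LinearMap.flip m)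
lemma cbr_apply (m : G →ₗ[R] Module.End R G) (s : R) (x y : G) : cbr m s x y = s • (m x y - m y x) := rfl
lemma cbr_alt (m : G →ₗ[R] Module.End R G) (s : R) (x : G) : cbr m s x x = 0 := by rw [cbr_apply, sub_self, smul_zero]
lemma cbr_jac {m : G →ₗ[R] Module.End R G} (h : ∀ x y z, m (m x y) z = m x (m y z)) (s : R) : Jac (cbr m s) := by
  intro x y z
  simp only [cbr_apply, map_smul, map_sub, LinearMap.smul_apply, LinearMap.sub_apply, h]
  module
end absbr
section weyl3
variable {R : Type*} [CommRing R] [Algebra ℂ R] {n N : ℕ}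
/-- matrices over the Weyl algebra -/
abbrev gG (R : Type*) [CommRing R] (n N : ℕ) := Matrix (Fin N) (Fin N) (MvPolynomial (Fin (2*n)) R)
/-- matrix product -/
def gM (n N : ℕ) (ε : R) : gG R n N →ₗ[R] Module.End R (gG R n N) :=
  LinearMap.mk₂ R (fun Z W i j => ∑ l, gS n ε (Z i l) (W l j))
    (fun Z Z' W => by ext1 i j; simp only [Matrix.add_apply, map_add, LinearMap.add_apply, Finset.sum_add_distrib]; rfl)
    (fun r Z W => by ext1 i j; simp only [Matrix.smul_apply, map_smul, LinearMap.smul_apply, ← Finset.smul_sum]; rfl)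
    (fun Z W W' => by ext1 i j; simp only [Matrix.add_apply, map_add, LinearMap.add_apply, Finset.sum_add_distrib]; rfl)
    (fun r Z W => by ext1 i j; simp only [Matrix.smul_apply, map_smul, LinearMap.smul_apply, ← Finset.smul_sum]; rfl)
variable {ε s : R}
lemma gM_apply (Z W : gG R n N) (i j) : gM n N ε Z W i j = ∑ l, gS n ε (Z i l) (W l j) := rfl
lemma gM_assoc (x y z : gG R n N) : gM n N ε (gM n N ε x y) z = gM n N ε x (gM n N ε y z) := by
  ext1 i j
  simp only [gM_apply, map_sum, LinearMap.sum_apply, gS_assoc]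
  exact Finset.sum_comm
/-- entrywise operator -/
def ew (N : ℕ) (f : Module.End R (MvPolynomial (Fin (2*n)) R)) : Module.End R (gG R n N) where
  toFun Z := fun i j => f (Z i j)
  map_add' Z W := by ext1 i j; simp only [Matrix.add_apply, map_add]; rfl
  map_smul' r Z := by ext1 i j; simp only [Matrix.smul_apply, map_smul, RingHom.id_apply]; rfl
lemma ew_apply (f : Module.End R (MvPolynomial (Fin (2*n)) R)) (Z : gG R n N) (i j) : ew N f Z i j = f (Z i j) := rfl
lemma ew_mul (f g : Module.End R (MvPolynomial (Fin (2*n)) R)) : ew N (f * g) = ew N f * ew N g := rfl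
lemma ew_add (f g : Module.End R (MvPolynomial (Fin (2*n)) R)) : ew N (f + g) = ew N f + ew N g := rfl
lemma ew_sub (f g : Module.End R (MvPolynomial (Fin (2*n)) R)) : ew N (f - g) = ew N f - ew N g := rfl
lemma ew_smul (r : R) (f : Module.End R (MvPolynomial (Fin (2*n)) R)) : ew N (r • f) = r • ew N f := rfl
lemma ew_one : ew N (1 : Module.End R (MvPolynomial (Fin (2*n)) R)) = 1 := rfl
lemma ew_zero : ew N (0 : Module.End R (MvPolynomial (Fin (2*n)) R)) = 0 := rfl
/-- scalar matrices -/
def dg (N : ℕ) (a : MvPolynomial (Fin (2*n)) R) : gG R n N := Matrix.diagonal fun _ => a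
lemma dg_apply (a : MvPolynomial (Fin (2*n)) R) (i j : Fin N) : dg N a i j = if i = j then a else 0 := Matrix.diagonal_apply _ _ _
lemma dg_add (a b : MvPolynomial (Fin (2*n)) R) : dg N (a + b) = dg N a + dg N b := by
  ext1 i j; rw [Matrix.add_apply, dg_apply, dg_apply, dg_apply]; split_ifs <;> simp
lemma dg_smul (r : R) (b : MvPolynomial (Fin (2*n)) R) : dg N (r • b) = r • dg N b := by
  ext1 i j; rw [Matrix.smul_apply, dg_apply, dg_apply]; split_ifs <;> simp
lemma dg_zero : dg N (0 : MvPolynomial (Fin (2*n)) R) = 0 := by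
  ext1 i j; rw [Matrix.zero_apply, dg_apply]; split_ifs <;> simp
lemma gM_dg (a : MvPolynomial (Fin (2*n)) R) : gM n N ε (dg N a) = ew N (gS n ε a) := by
  refine LinearMap.ext fun Z => ?_
  ext1 i j
  rw [gM_apply, ew_apply, Finset.sum_eq_single i]
  · rw [dg_apply, if_pos rfl]
  · intro l _ hl; rw [dg_apply, if_neg (Ne.symm hl), map_zero, LinearMap.zero_apply]
  · simp
lemma gM_dg' (a : MvPolynomial (Fin (2*n)) R) (Z : gG R n N) : gM n N ε Z (dg N a) = ew N ((gS n ε).flip a) Z := by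
  ext1 i j
  rw [gM_apply, ew_apply, Finset.sum_eq_single j, LinearMap.flip_apply]
  · rw [dg_apply, if_pos rfl]
  · intro l _ hl; rw [dg_apply, if_neg hl, map_zero]
  · simp
/-- the bracket -/
def gB (n N : ℕ) (ε s : R) : gG R n N →ₗ[R] Module.End R (gG R n N) := cbr (gM n N ε) s
lemma gB_dg (a : MvPolynomial (Fin (2*n)) R) : gB n N ε s (dg N a) = ew N (cbr (gS n ε) s a) := by
  refine LinearMap.ext fun Z => ?_
  rw [gB, cbr_apply, gM_dg, gM_dg']
  ext1 i j
  simp only [Matrix.smul_apply, Matrix.sub_apply, ew_apply, cbr_apply, LinearMap.flip_apply]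
lemma ew_dg (f : Module.End R (MvPolynomial (Fin (2*n)) R)) (a : MvPolynomial (Fin (2*n)) R) : ew N f (dg N a) = dg N (f a) := by
  ext1 i j; rw [ew_apply, dg_apply, dg_apply]; split_ifs <;> simp
lemma gS_X (v : Fin (2*n)) (f : MvPolynomial (Fin (2*n)) R) : gS n ε (X v) f = X v * f + (ε * hf R) • dl v f := by
  have := gS_Xl (ε := ε) v 1 f
  rwa [mul_one, gS_one, gS_one] at this
lemma gS_X' (v : Fin (2*n)) (f : MvPolynomial (Fin (2*n)) R) : gS n ε f (X v) = X v * f - (ε * hf R) • dl v f := by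
  have := gS_Xr (ε := ε) v f 1
  rwa [mul_one, gS_one', gS_one'] at this
lemma ad_X (hs : s * ε = 1) (v : Fin (2*n)) : cbr (gS n ε) s (X v) = dl v := by
  refine LinearMap.ext fun f => ?_
  rw [cbr_apply, gS_X, gS_X']
  have h : s * (ε * hf R + ε * hf R) = 1 := by rw [← mul_add, hf_two, mul_one, hs]
  rw [add_sub_sub_cancel, ← add_smul, smul_smul, h, one_smul]
lemma ad_XX (hs : s * ε = 1) (i j : Fin (2*n)) : cbr (gS n ε) s (X i * X j) = mX i * dl j + mX j * dl i := by
  refine LinearMap.ext fun f => ?_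
  rw [cbr_apply, gS_Xl, gS_Xr, gS_X, gS_X, gS_X', gS_X', LinearMap.add_apply, Module.End.mul_apply, Module.End.mul_apply, mX_apply, mX_apply]
  have h : s * (ε * hf R + ε * hf R) = 1 := by rw [← mul_add, hf_two, mul_one, hs]
  calc _ = (s * (ε * hf R + ε * hf R)) • (X i * dl j f + X j * dl i f) := by
          simp only [mul_add, mul_sub, mul_smul_comm]; module
    _ = _ := by rw [h, one_smul]
lemma dl_X (i j : Fin (2*n)) : dl i (X j : MvPolynomial (Fin (2*n)) R) = (if sw i = j then sg R i else 0) • 1 := by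
  rw [dl_apply, pderiv_X, Pi.single_apply]
  by_cases h : sw i = j
  · rw [if_pos h, if_pos h.symm]
  · rw [if_neg h, if_neg (Ne.symm h), zero_smul, smul_zero]
lemma dl_mX (i j : Fin (2*n)) : (dl i * mX j : Module.End R (MvPolynomial (Fin (2*n)) R)) = mX j * dl i + (if sw i = j then sg R i else 0) • 1 := by
  refine LinearMap.ext fun f => ?_
  rw [Module.End.mul_apply, mX_apply, dl_mul, dl_X, LinearMap.add_apply, Module.End.mul_apply, mX_apply, LinearMap.smul_apply, Module.End.one_apply, smul_mul_assoc, one_mul, add_comm]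
lemma dl_comm (i j : Fin (2*n)) : (dl i * dl j : Module.End R (MvPolynomial (Fin (2*n)) R)) = dl j * dl i := by
  rw [dl, dl, smul_mul_smul_comm, smul_mul_smul_comm, gD_comm, mul_comm (sg R i)]
lemma sw_inj {i j : Fin (2*n)} : sw i = sw j ↔ i = j := ⟨fun h => by rw [← sw_sw i, h, sw_sw], fun h => h ▸ rfl⟩
lemma sw_eq {i j : Fin (2*n)} : sw i = j ↔ i = sw j := ⟨fun h => by rw [← h, sw_sw], fun h => by rw [h, sw_sw]⟩
/-- dual multiplication operators -/
def gmul (i : Fin (2*n)) : Module.End R (MvPolynomial (Fin (2*n)) R) := sg R i • mX (sw i)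
lemma dl_gmul (i j : Fin (2*n)) : (dl i * gmul j : Module.End R (MvPolynomial (Fin (2*n)) R)) = gmul j * dl i + if i = j then 1 else 0 := by
  rw [gmul, mul_smul_comm, dl_mX, smul_add, smul_mul_assoc]
  simp only [sw_inj]
  by_cases h : i = j
  · rw [if_pos h, if_pos h, h, smul_smul, sg_sg, one_smul]
  · rw [if_neg h, if_neg h, zero_smul, smul_zero]
lemma nil_aux (k : ℕ) : ∀ x : gG R n N, (∀ i j, x i j ∈ Fd R _ k) → x ∈ Fil (fun i => ew N (dl (R := R) i)) k := by
  induction k with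
  | zero => intro x hx; rw [Fil_zero]; ext1 i j; exact Fd_zero (hx i j)
  | succ k ih =>
    intro x hx; rw [Fil_succ]; intro v
    exact ih _ fun i j => Submodule.smul_mem _ _ (gD_Fd _ (hx i j))
/-- the Heisenberg datum -/
def gH (n N : ℕ) (hN : 1 ≤ N) (hs : s * ε = 1) : Heis R (gG R n N) (2*n) where
  br := gB n N ε s
  alt := cbr_alt _ _
  jac := cbr_jac gM_assoc s
  pd := fun i => ew N (dl i)
  mu := fun i => ew N (gmul i)
  y := fun i => dg N (X i)
  one := dg N 1
  w := fun i j => if sw i = j then sg R i else 0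
  br_y := fun i => by rw [gB_dg, ad_X hs]
  pd_comm := fun i j => by rw [← ew_mul, dl_comm, ew_mul]
  pd_mu := fun i j => by
    rw [← ew_mul, dl_gmul, ew_add, ew_mul]
    split_ifs
    · rw [ew_one]
    · rw [ew_zero]
  br_one := by
    rw [gB_dg]
    have : cbr (gS n ε) s 1 = 0 := LinearMap.ext fun f => by rw [cbr_apply, gS_one, gS_one', sub_self, smul_zero]; rfl
    rw [this, ew_zero]
  br_yy := fun i j => by rw [gB_dg, ad_X hs, ew_dg, dl_X, dg_smul]
  nil := fun x => by
    refine ⟨∑ i, ∑ j, ((x i j).totalDegree + 1), nil_aux _ x fun i j => Fd_mono ?_ (mem_Fd_deg _)⟩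
    refine le_trans ?_ (Finset.single_le_sum (f := fun i => ∑ j, ((x i j).totalDegree + 1)) (fun _ _ => Nat.zero_le _) (Finset.mem_univ i))
    exact (Finset.single_le_sum (f := fun j => (x i j).totalDegree + 1) (fun _ _ => Nat.zero_le _) (Finset.mem_univ j))
  tf := fun k hk => by
    have h := congrFun (congrFun hk ⟨0, hN⟩) ⟨0, hN⟩
    have h2 := congrArg (coeff 0) h
    rw [Matrix.smul_apply, dg_apply, if_pos rfl, coeff_smul, Matrix.zero_apply, coeff_zero] at h2
    simpa using h2
/-- constant matrices -/
def cm (M : Matrix (Fin N) (Fin N) R) : gG R n N := fun i j => M i j • 1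
lemma cm_comm (M : Matrix (Fin N) (Fin N) R) (f : Module.End R (MvPolynomial (Fin (2*n)) R)) :
    gB n N ε s (cm M) * ew N f = ew N f * gB n N ε s (cm M) := by
  refine LinearMap.ext fun Z => ?_
  ext1 i j
  simp only [Module.End.mul_apply, ew_apply, gB, cbr_apply, Matrix.smul_apply, Matrix.sub_apply, gM_apply, cm, map_smul, LinearMap.smul_apply, gS_one, gS_one', map_sub, map_sum]
lemma cm_y (M : Matrix (Fin N) (Fin N) R) (a : MvPolynomial (Fin (2*n)) R) : gB n N ε s (cm M) (dg N a) = 0 := by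
  have h : ∀ x y, gB n N ε s x y = - gB n N ε s y x := fun x y => by rw [gB, cbr_apply, cbr_apply, ← smul_neg, neg_sub]
  rw [h, gB_dg, neg_eq_zero]
  ext1 i j
  rw [ew_apply, cm, map_smul, cbr_apply, gS_one, gS_one', sub_self, smul_zero, smul_zero, Matrix.zero_apply]
variable {hN : 1 ≤ N} {hs : s * ε = 1}
lemma cm_inv (M : Matrix (Fin N) (Fin N) R) : (gH n N hN hs).IsInv (cm M) := by
  refine ⟨fun _ _ => 0, fun j => ?_, fun i => ?_⟩
  · rw [Finset.sum_eq_zero fun i _ => zero_smul _ _]; exact cm_y M _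
  · rw [Finset.sum_eq_zero fun i _ => zero_smul _ _, sub_zero]; exact cm_comm M _
lemma XX_inv (i j : Fin (2*n)) : (gH n N hN hs).IsInv (dg N (X i * X j)) := by
  refine ⟨fun l k => (if l = i then (if sw j = k then sg R j else 0) else 0) + (if l = j then (if sw i = k then sg R i else 0) else 0), fun k => ?_, fun l => ?_⟩
  · change gB n N ε s (dg N (X i * X j)) (dg N (X k)) = ∑ l, _ • dg N (X l)
    rw [gB_dg, ew_dg, ad_XX hs]
    simp only [add_smul, Finset.sum_add_distrib, ite_smul, zero_smul, Finset.sum_ite_eq', Finset.mem_univ, if_true]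
    rw [LinearMap.add_apply, Module.End.mul_apply, Module.End.mul_apply, dl_X, dl_X, map_smul, map_smul, mX_apply, mX_apply, mul_one, mul_one, dg_add, dg_smul, dg_smul, ite_smul, ite_smul, zero_smul, zero_smul]
  · change gB n N ε s (dg N (X i * X j)) * ew N (gmul l) = ew N (gmul l) * gB n N ε s (dg N (X i * X j)) - ∑ k, _ • ew N (gmul k)
    have key : (mX i * dl j + mX j * dl i : Module.End R (MvPolynomial (Fin (2*n)) R)) * gmul l
       = gmul l * (mX i * dl j + mX j * dl i) - ((if l = i then sg R j • gmul (sw j) else 0) + if l = j then sg R i • gmul (sw i) else 0) := by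
      refine LinearMap.ext fun f => ?_
      have h1 : ∀ k : Fin (2*n), sg R k • gmul (sw k) f = - (X k * f) := by
        intro k
        rw [gmul, LinearMap.smul_apply, sw_sw, smul_smul, sg_sw, mul_neg, sg_sg, mX_apply, neg_smul, one_smul]
      have h2 := fun k => LinearMap.congr_fun (dl_gmul (R := R) k l) f
      simp only [Module.End.mul_apply, LinearMap.add_apply] at h2
      simp only [Module.End.mul_apply, LinearMap.add_apply, LinearMap.sub_apply, h2, mX_apply]
      have h3 : ∀ k, (if l = k then sg R j • gmul (sw j) else (0 : Module.End R (MvPolynomial (Fin (2*n)) R))) f = if l = k then - (X j * f) else 0 := by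
        intro k; split_ifs; · rw [LinearMap.smul_apply, h1]
        · rfl
      have h4 : ∀ k, (if l = k then sg R i • gmul (sw i) else (0 : Module.End R (MvPolynomial (Fin (2*n)) R))) f = if l = k then - (X i * f) else 0 := by
        intro k; split_ifs; · rw [LinearMap.smul_apply, h1]
        · rfl
      have h5 : ∀ k, (if k = l then (1 : Module.End R (MvPolynomial (Fin (2*n)) R)) else 0) f = if l = k then f else 0 := by
        intro k; by_cases h : l = k
        · rw [if_pos h, if_pos h.symm]; rfl
        · rw [if_neg h, if_neg (Ne.symm h)]; rfl
      rw [h3, h4, h5, h5]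
      simp only [gmul, LinearMap.smul_apply, mX_apply, map_add, smul_add]
      have h6 : ∀ (a b c : MvPolynomial (Fin (2*n)) R), a * (sg R l • (b * c)) = sg R l • (b * (a * c)) := by
        intro a b c; rw [mul_smul_comm]; congr 1; ring
      split_ifs <;> simp only [mul_add, h6] <;> ring
    rw [gB_dg, ad_XX hs, ← ew_mul, key, ew_sub, ew_mul]
    congr 1
    rw [ew_add]
    simp only [add_smul, Finset.sum_add_distrib, ite_smul, zero_smul]
    congr 1
    · by_cases h : l = i
      · simp only [if_pos h, Finset.sum_ite_eq, Finset.mem_univ, if_true, ew_smul]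
      · simp only [if_neg h, Finset.sum_const_zero, ew_zero]
    · by_cases h : l = j
      · simp only [if_pos h, Finset.sum_ite_eq, Finset.mem_univ, if_true, ew_smul]
      · simp only [if_neg h, Finset.sum_const_zero, ew_zero]
end weyl3
section invlin
variable {K : Type*} [CommRing K] {G : Type*} [AddCommGroup G] [Module K G] {d : ℕ} {A : Heis K G d}
lemma inv_zero : A.IsInv 0 := ⟨fun _ _ => 0, fun j => by simp, fun i => by simp⟩
lemma inv_add {x y : G} (hx : A.IsInv x) (hy : A.IsInv y) : A.IsInv (x + y) := by
  obtain ⟨a, h1, h2⟩ := hx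
  obtain ⟨b, h3, h4⟩ := hy
  refine ⟨fun i j => a i j + b i j, fun j => ?_, fun i => ?_⟩
  · rw [map_add, LinearMap.add_apply, h1, h3, ← Finset.sum_add_distrib]; simp only [add_smul]
  · rw [map_add, add_mul, h2, h4, mul_add]; simp only [add_smul, Finset.sum_add_distrib]; abel
lemma inv_smul (r : K) {x : G} (hx : A.IsInv x) : A.IsInv (r • x) := by
  obtain ⟨a, h1, h2⟩ := hx
  refine ⟨fun i j => r * a i j, fun j => ?_, fun i => ?_⟩
  · rw [map_smul, LinearMap.smul_apply, h1, Finset.smul_sum]; simp only [mul_smul]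
  · rw [map_smul, smul_mul_assoc, h2, mul_smul_comm, smul_sub, Finset.smul_sum]; simp only [mul_smul]
end invlin
end CW

namespace CW
section frame
variable {R : Type*} [CommRing R] [Algebra ℂ R] {n N : ℕ}
/-- index set of the frame -/
abbrev fI (n N : ℕ) := (Fin N × Fin N) ⊕ (Fin (2*n) × Fin (2*n))
/-- frame vectors -/
def fb (R : Type*) [CommRing R] (n N : ℕ) : fI n N → gG R n N
  | Sum.inl p => cm (Matrix.single p.1 p.2 1)
  | Sum.inr p => dg N (X p.1 * X p.2)
/-- entry functional -/
def ent (R : Type*) [CommRing R] (n : ℕ) {N : ℕ} (i j : Fin N) : gG R n N →ₗ[R] MvPolynomial (Fin (2*n)) R :=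
  { toFun := fun Z => Z i j, map_add' := fun _ _ => rfl, map_smul' := fun _ _ => rfl }
lemma ent_apply (i j : Fin N) (Z : gG R n N) : ent R n i j Z = Z i j := rfl
/-- frame coordinates -/
def fc (R : Type*) [CommRing R] [Algebra ℂ R] (n N : ℕ) (hN : 1 ≤ N) : fI n N → Module.Dual R (gG R n N)
  | Sum.inl p => (lcoeff R 0).comp (ent R n p.1 p.2)
  | Sum.inr p => hf R • (lcoeff R 0).comp ((gD R p.1 * gD R p.2).comp (ent R n ⟨0, hN⟩ ⟨0, hN⟩))
lemma fr_cm (hN : 1 ≤ N) (M : Matrix (Fin N) (Fin N) R) : ∑ a, fc R n N hN a (cm M) • fb R n N a = cm M := by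
  rw [Fintype.sum_sum_type]
  have h2 : ∀ p : Fin (2*n) × Fin (2*n), fc R n N hN (Sum.inr p) (cm M) = 0 := by
    intro p
    simp only [fc, LinearMap.smul_apply, LinearMap.comp_apply, ent_apply, cm, Module.End.mul_apply, map_smul]
    rw [gD_apply p.2, pderiv_one, map_zero, map_zero, smul_zero, smul_zero]
  have h1 : ∀ p : Fin N × Fin N, fc R n N hN (Sum.inl p) (cm M) = M p.1 p.2 := by
    intro p
    simp only [fc, LinearMap.comp_apply, ent_apply, cm, map_smul, lcoeff_apply]
    simp
  simp only [h1, h2, zero_smul, Finset.sum_const_zero, add_zero]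
  ext1 i j
  rw [Matrix.sum_apply, Finset.sum_eq_single (i, j)]
  · simp [fb, cm, Matrix.single_apply]
  · rintro ⟨k, l⟩ _ hkl
    have : ¬ (k = i ∧ l = j) := fun h => hkl (Prod.ext h.1 h.2)
    simp [fb, cm, Matrix.single_apply, this]
  · simp
lemma fr_dg (hN : 1 ≤ N) (i j : Fin (2*n)) : ∑ a, fc R n N hN a (dg N (X i * X j)) • fb R n N a = dg N (X i * X j) := by
  rw [Fintype.sum_sum_type]
  have h1 : ∀ p : Fin N × Fin N, fc R n N hN (Sum.inl p) (dg N (X i * X j)) = 0 := by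
    intro p
    simp only [fc, LinearMap.comp_apply, ent_apply, dg_apply, lcoeff_apply]
    split_ifs
    · rw [coeff_X_mul']; simp
    · exact coeff_zero _
  have h2 : ∀ p : Fin (2*n) × Fin (2*n), fc R n N hN (Sum.inr p) (dg N (X i * X j)) = hf R * ((if (i, j) = p then 1 else 0) + if (j, i) = p then 1 else 0) := by
    rintro ⟨k, l⟩
    have hX : ∀ u v : Fin (2*n), pderiv u (X v : MvPolynomial (Fin (2*n)) R) = C (if v = u then 1 else 0) := by
      intro u v; rw [pderiv_X, Pi.single_apply]; split_ifs <;> simp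
    simp only [fc, LinearMap.smul_apply, LinearMap.comp_apply, ent_apply, dg_apply, Module.End.mul_apply, gD_apply, if_true, lcoeff_apply, pderiv_mul, hX, map_add, pderiv_C, smul_eq_mul, Prod.mk.injEq, zero_mul, mul_zero, add_zero, zero_add, ← C_mul, coeff_add, coeff_zero_C]
    congr 1
    rw [add_comm]
    congr 1
    · rw [ite_and]; split_ifs <;> simp
    · rw [ite_and]; split_ifs <;> simp
  simp only [h1, h2, zero_smul, Finset.sum_const_zero, zero_add, mul_add, add_smul, Finset.sum_add_distrib, mul_ite, mul_one, mul_zero, ite_smul, Finset.sum_ite_eq, Finset.mem_univ, if_true]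
  simp only [fb]
  rw [mul_comm (X j), ← add_smul, hf_two, one_smul]
end frame
section conc
variable {n N : ℕ}
lemma moyal_eq (f g : Apol n) : moyal n f g = gst n eps f g := by
  rw [moyal, elemT, Fin.prod_univ_two]; rfl
lemma matMul_eq (Z W : glA n N) : matMul n N Z W = gM n N eps Z W := by
  ext1 i j
  rw [gM_apply, matMul]
  exact Finset.sum_congr rfl fun l _ => moyal_eq _ _
/-- inverse of the parameter -/
def ei : Kc := LaurentPolynomial.T (-1)
lemma ei_eps : ei * eps = 1 := by rw [ei, eps, ← LaurentPolynomial.T_add]; simp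
/-- the concrete bracket -/
abbrev brk (n N : ℕ) : glA n N →ₗ[Kc] Module.End Kc (glA n N) := gB n N eps ei
lemma glBr_eq (Z W : glA n N) : glBr n N Z W = brk n N Z W := by
  rw [glBr, matMul_eq, matMul_eq]; rfl
lemma hK_ind {p : glA n N → Prop} (h0 : p 0) (hadd : ∀ x y, p x → p y → p (x + y)) (hsm : ∀ (r : Kc) x, p x → p (r • x))
    (hc : ∀ M : Matrix (Fin N) (Fin N) Kc, p (cm M)) (hq : ∀ i j, p (dg N (X i * X j))) {x : glA n N} (hx : x ∈ hK n N) : p x := by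
  refine Submodule.span_induction (p := fun x _ => p x) ?_ h0 (fun x y _ _ => hadd x y) (fun r x _ => hsm r x) hx
  rintro x (⟨M, rfl⟩ | ⟨a, ha, rfl⟩)
  · convert! hc (M.map (algebraMap ℂ Kc)) using 1
    ext1 i j
    rw [Matrix.map_apply, cm, Matrix.map_apply, smul_eq_C_mul, mul_one]; rfl
  · change p (dg N a)
    refine Submodule.span_induction (p := fun a _ => p (dg N a)) ?_ ?_ ?_ ?_ ha
    · rintro _ ⟨i, j, rfl⟩; exact hq i j
    · rw [dg_zero]; exact h0
    · intro a b _ _ h1 h2; rw [dg_add]; exact hadd _ _ h1 h2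
    · intro r a _ h1
      rw [← algebraMap_smul Kc r a, dg_smul]; exact hsm _ _ h1
lemma fb_mem (a : fI n N) : fb Kc n N a ∈ hK n N := by
  rcases a with ⟨i, j⟩ | ⟨i, j⟩
  · refine Submodule.subset_span (Or.inl ⟨Matrix.single i j 1, ?_⟩)
    ext1 k l
    simp only [fb, cm, Matrix.map_apply, Matrix.single_apply]
    split_ifs <;> simp
  · exact Submodule.subset_span (Or.inr ⟨X i * X j, Submodule.subset_span ⟨i, j, rfl⟩, rfl⟩)
lemma fr_hK (hN : 1 ≤ N) {x : glA n N} (hx : x ∈ hK n N) : ∑ a, fc Kc n N hN a x • fb Kc n N a = x := by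
  refine hK_ind (p := fun x => ∑ a, fc Kc n N hN a x • fb Kc n N a = x) ?_ ?_ ?_ (fr_cm hN) (fr_dg hN) hx
  · simp
  · intro x y h1 h2; simp only [map_add, add_smul, Finset.sum_add_distrib]; rw [h1, h2]
  · intro r x h1; simp only [map_smul, smul_assoc, ← Finset.smul_sum]; rw [h1]
lemma hK_inv (hN : 1 ≤ N) {x : glA n N} (hx : x ∈ hK n N) : (gH n N hN ei_eps).IsInv x :=
  hK_ind (p := fun x => (gH n N hN ei_eps).IsInv x) inv_zero (fun _ _ => inv_add) (fun r _ => inv_smul r) cm_inv XX_inv hx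
/-- the frame datum -/
def cF (hN : 1 ≤ N) {pr : glA n N →ₗ[Kc] glA n N} (h : IsEquivProj n N pr) : Fr Kc (glA n N) (fI n N) where
  br := brk n N
  alt := cbr_alt _ _
  jac := cbr_jac gM_assoc _
  hs := hK n N
  hb := fb Kc n N
  c := fc Kc n N hN
  hb_mem := fb_mem
  frame := fun x hx => fr_hK hN hx
  pr := pr
  pr_mem := h.1
  pr_id := h.2.1
  pr_eq := fun x hx y => by rw [← glBr_eq, h.2.2 x hx, glBr_eq]
end conc
end CW

namespace CW
section pol
variable {K : Type*} [CommRing K] {G : Type*} [AddCommGroup G] [Module K G]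

lemma pol_coef {j : ℕ} (r : Fin j → Fin j) :
    ∑ s : Fin j → Bool, (∏ k, (if s k then (1:K) else -1)) * ∏ i, (if s (r i) then (1:K) else 0)
      = if Function.Bijective r then 1 else 0 := by
  classical
  have h1 : ∀ s : Fin j → Bool, (∏ k, (if s k then (1:K) else -1)) * ∏ i, (if s (r i) then (1:K) else 0)
      = ∏ k, ((if s k then (1:K) else -1) * (if s k then (1:K) else 0) ^ (Finset.univ.filter fun i => r i = k).card) := by
    intro s
    rw [Finset.prod_mul_distrib]
    congr 1
    rw [← Finset.prod_fiberwise_of_maps_to (s := Finset.univ) (t := Finset.univ) (g := r) (fun _ _ => Finset.mem_univ _)]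
    refine Finset.prod_congr rfl fun k _ => ?_
    rw [← Finset.prod_const]
    refine Finset.prod_congr rfl fun i hi => ?_
    rw [(Finset.mem_filter.1 hi).2]
  simp only [h1]
  have h2 := Finset.prod_univ_sum (fun _ : Fin j => (Finset.univ : Finset Bool))
    (fun k a => (if a then (1:K) else -1) * (if a then (1:K) else 0) ^ (Finset.univ.filter fun i => r i = k).card)
  rw [Fintype.piFinset_univ] at h2
  rw [← h2]
  split_ifs with hr
  · refine Finset.prod_eq_one fun k _ => ?_
    obtain ⟨i, hi⟩ := hr.2 k
    have : (Finset.univ.filter fun i => r i = k).card ≠ 0 := Finset.card_ne_zero_of_mem (a := i) (by simp [hi])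
    simp [this]
  · have : ¬ Function.Surjective r := fun h => hr (Finite.injective_iff_bijective.1 (Finite.injective_iff_surjective.2 h))
    rw [Function.Surjective] at this
    push Not at this
    obtain ⟨k, hk⟩ := this
    refine Finset.prod_eq_zero (Finset.mem_univ k) ?_
    have : (Finset.univ.filter fun i => r i = k) = ∅ := by
      apply Finset.filter_eq_empty_iff.2; intro i _; exact hk i
    simp [this]

lemma polarize [Algebra ℚ K] {j : ℕ} (P : MultilinearMap K (fun _ : Fin j => G) K) (hs : ∀ (w : Fin j → G) (σ : Equiv.Perm (Fin j)), P (w ∘ σ) = P w)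
    (H : Submodule K G) (h0 : ∀ u ∈ H, P (fun _ => u) = 0) (w : Fin j → G) (hw : ∀ r, w r ∈ H) : P w = 0 := by
  classical
  have h1 : ∀ s : Fin j → Bool, ∑ r : Fin j → Fin j, (∏ i, (if s (r i) then (1:K) else 0)) * P (w ∘ r) = 0 := by
    intro s
    refine Eq.trans ?_ (h0 (∑ k, (if s k then (1:K) else 0) • w k) (Submodule.sum_mem _ fun k _ => H.smul_mem _ (hw k)))
    rw [MultilinearMap.map_sum]
    refine Finset.sum_congr rfl fun r _ => ?_
    rw [MultilinearMap.map_smul_univ, smul_eq_mul]; rfl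
  have h2 : ∑ s : Fin j → Bool, (∏ k, (if s k then (1:K) else -1)) * ∑ r : Fin j → Fin j, (∏ i, (if s (r i) then (1:K) else 0)) * P (w ∘ r) = 0 :=
    Finset.sum_eq_zero fun s _ => by rw [h1, mul_zero]
  simp only [Finset.mul_sum] at h2
  rw [Finset.sum_comm] at h2
  simp only [← mul_assoc, ← Finset.sum_mul, pol_coef] at h2
  have h3 : ∀ r : Fin j → Fin j, (if Function.Bijective r then (1:K) else 0) * P (w ∘ r) = (if Function.Bijective r then (1:K) else 0) * P w := by
    intro r
    split_ifs with hr
    · rw [← hs w (Equiv.ofBijective r hr)]; rfl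
    · simp
  simp only [h3, ← Finset.sum_mul, Finset.sum_boole] at h2
  have h4 : IsUnit ((Finset.univ.filter fun r : Fin j → Fin j => Function.Bijective r).card : K) := by
    have : ((Finset.univ.filter fun r : Fin j → Fin j => Function.Bijective r).card : ℚ) ≠ 0 := by
      rw [Nat.cast_ne_zero]
      exact Finset.card_ne_zero_of_mem (a := id) (Finset.mem_filter.2 ⟨Finset.mem_univ _, Function.bijective_id⟩)
    simpa using this.isUnit.map (algebraMap ℚ K)
  exact (h4.mul_right_eq_zero).1 h2
end pol
section glue
variable {K : Type*} [CommRing K] {G : Type*} [AddCommGroup G] [Module K G]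
lemma pair_rs {p : ℕ} (v : Fin (p+2) → G) (x : G) (i l : Fin (p+2)) : pairTuple (p+1) v x i l = Fin.cons x (rs v i l) := by
  funext m
  refine Fin.cases ?_ (fun m => ?_) m
  · simp [pairTuple]
  · simp only [pairTuple, rs, Fin.val_succ, Fin.cons_succ, Nat.succ_ne_zero, Nat.add_sub_cancel, dif_neg, not_false_eq_true, dite_eq_ite]
    rfl
lemma mw_front {p : ℕ} (v : Fin p → G) (i : Fin p) : ∃ w, ∃ s : ℤˣ, (mw p v : Lam K G) = s • e (v i) w := by
  obtain ⟨q, rfl⟩ : ∃ q, p = q + 1 := ⟨p - 1, by have := i.2; omega⟩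
  refine ⟨mw q (Fin.tail (v ∘ Equiv.swap 0 i)), Equiv.Perm.sign (Equiv.swap 0 i), ?_⟩
  have h := (mw (K := K) (q+1)).map_perm v (Equiv.swap 0 i)
  have h2 := mw_succ (K := K) (v ∘ Equiv.swap 0 i)
  simp only [Function.comp_apply, Equiv.swap_apply_left] at h2
  rw [← h2, h, smul_smul, Int.units_mul_self, one_smul]
end glue
section conc
variable {n N : ℕ}
instance : Algebra ℚ Kc := ((algebraMap ℂ Kc).comp (algebraMap ℚ ℂ)).toAlgebra
/-- alternating map of a cochain -/
def cA {k : ℕ} {c : (Fin k → glA n N) → Kc} (h : IsTrivCochain n N k c) : (glA n N) [⋀^Fin k]→ₗ[Kc] Kc where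
  toFun := c
  map_update_add' := by
    intro inst v i x y
    rw [Subsingleton.elim inst (fun a b => instDecidableEqFin k a b)]
    exact h.1 v i x y
  map_update_smul' := by
    intro inst v i s x
    rw [Subsingleton.elim inst (fun a b => instDecidableEqFin k a b)]
    exact h.2.1 v i s x
  map_eq_zero_of_eq' := fun v i j h1 h2 => h.2.2 v i j h2 h1
/-- multilinear map of an invariant polynomial -/
def pM {j : ℕ} {P : (Fin j → glA n N) → Kc} (h : IsInvPoly n N j P) : MultilinearMap Kc (fun _ : Fin j => glA n N) Kc where
  toFun := P
  map_update_add' := by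
    intro inst v i x y
    rw [Subsingleton.elim inst (fun a b => instDecidableEqFin j a b)]
    exact h.1 v i x y
  map_update_smul' := by
    intro inst v i s x
    rw [Subsingleton.elim inst (fun a b => instDecidableEqFin j a b)]
    exact h.2.1 v i s x
variable (hN : 1 ≤ N) {pr : glA n N →ₗ[Kc] glA n N} (hp : IsEquivProj n N pr)
lemma pM_inv {j : ℕ} {P : (Fin j → glA n N) → Kc} (h : IsInvPoly n N j P) : Fr.Inv (cF hN hp) j (pM h) where
  symm := h.2.2.1
  inv := fun x hx w hw => by
    rw [← h.2.2.2 x hx w hw]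
    refine Finset.sum_congr rfl fun r _ => ?_
    rw [glBr_eq]; rfl
lemma inv_pM {j : ℕ} {P : MultilinearMap Kc (fun _ : Fin j => glA n N) Kc} (h : Fr.Inv (cF hN hp) j P) : IsInvPoly n N j P := by
  refine ⟨fun w r x y => P.map_update_add w r x y, fun w r s x => P.map_update_smul w r s x, h.symm, fun x hx w hw => ?_⟩
  rw [← h.inv x hx w hw]
  refine Finset.sum_congr rfl fun r _ => ?_
  rw [glBr_eq]; rfl
lemma dd_dTriv {k : ℕ} (f : Module.Dual Kc (Lam Kc (glA n N))) (v : Fin (k+1) → glA n N) :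
    f ((cF hN hp).dd (mw (k+1) v)) = - dTriv n N k (fun u => f (mw k u)) v := by
  cases k with
  | zero =>
    rw [show (cF hN hp).dd (mw 1 v) = 0 from bd_one_deg _ _ (mw_mem v), map_zero]
    simp [dTriv]
  | succ p =>
    rw [show (cF hN hp).dd (mw (p+2) v) = _ from bd_mw (cF hN hp).br (cF hN hp).alt v, map_neg, dTriv]
    congr 1
    simp only [map_sum]
    refine Finset.sum_congr rfl fun i _ => Finset.sum_congr rfl fun l _ => ?_
    split_ifs
    · rw [map_smul, pair_rs, mw_cons, glBr_eq]; rfl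
    · exact map_zero f
lemma fun_triv {k : ℕ} (f : Module.Dual Kc (Lam Kc (glA n N))) : IsTrivCochain n N k (fun v => f (mw k v)) := by
  refine ⟨fun v i x y => ?_, fun v i s x => ?_, fun v i j h1 h2 => ?_⟩
  · beta_reduce; rw [AlternatingMap.map_update_add, map_add]
  · beta_reduce; rw [AlternatingMap.map_update_smul, map_smul, smul_eq_mul]
  · beta_reduce; rw [AlternatingMap.map_eq_zero_of_eq _ v h2 h1, map_zero]
lemma fun_rel {k : ℕ} {f : Module.Dual Kc (Lam Kc (glA n N))} (he : ∀ x ∈ hK n N, ∀ w, f (e x w) = 0)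
    (hL : ∀ x ∈ hK n N, ∀ w, f (der (brk n N x) w) = 0) : IsRelTriv n N k (fun v => f (mw k v)) := by
  refine ⟨fun v i hi => ?_, fun Z hZ v => ?_⟩
  · obtain ⟨w, s, h⟩ := mw_front (K := Kc) v i
    beta_reduce
    rw [h, Units.smul_def, map_zsmul, he _ hi, smul_zero]
  · rw [← hL Z hZ (mw k v), der_mw, map_sum]
    refine Finset.sum_congr rfl fun r _ => ?_
    rw [glBr_eq]
lemma rel_fun {k : ℕ} {c : (Fin k → glA n N) → Kc} (h : IsTrivCochain n N k c) (hr : IsRelTriv n N k c) :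
    Fr.RelC (cF hN hp) k (hat (cA h)) where
  pure := fun q hq w hw => hat_ne hq _ hw
  he := by
    intro x hx
    have : (hat (cA h) ∘ₗ e x : Lam Kc (glA n N) →ₗ[Kc] Kc) = 0 := by
      refine op_eq_of_Dg fun p w hw => Dg_ind (fun v => ?_) hw
      rw [LinearMap.comp_apply, ← mw_cons, LinearMap.zero_apply]
      by_cases hpk : p + 1 = k
      · subst hpk
        rw [hat_mw]
        exact hr.1 _ 0 hx
      · exact hat_ne hpk _ (mw_mem _)
    exact fun w => LinearMap.congr_fun this w
  hL := by
    intro x hx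
    have : (hat (cA h) ∘ₗ der ((cF hN hp).br x) : Lam Kc (glA n N) →ₗ[Kc] Kc) = 0 := by
      refine op_eq_of_Dg fun p w hw => Dg_ind (fun v => ?_) hw
      rw [LinearMap.comp_apply, LinearMap.zero_apply, der_mw, map_sum]
      by_cases hpk : p = k
      · subst hpk
        simp only [hat_mw]
        rw [← hr.2 x hx v]
        refine Finset.sum_congr rfl fun r _ => ?_
        rw [glBr_eq]; rfl
      · exact Finset.sum_eq_zero fun i _ => hat_ne hpk _ (mw_mem _)
    exact fun w => LinearMap.congr_fun this w
lemma hat_fun {k : ℕ} {c : (Fin k → glA n N) → Kc} (h : IsTrivCochain n N k c) : (fun v => hat (cA h) (mw k v)) = c := by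
  funext v; rw [hat_mw]; rfl
lemma zig : ∃ η, Fr.Zig (cF hN hp) η (2*n) := by
  obtain ⟨η, h1, h2, h3⟩ := (gH n N hN ei_eps).exists_eta
  exact ⟨η, h1, h2, fun x hx => h3 x (hK_inv hN hx)⟩
/-- the Chern–Weil functional -/
def chF {j : ℕ} {P : (Fin j → glA n N) → Kc} (h : IsInvPoly n N j P) : Module.Dual Kc (Lam Kc (glA n N)) :=
  algebraMap ℂ Kc ((j.factorial : ℂ))⁻¹ • (cF hN hp).pco.phi (Ph (cF hN hp).hb (pM h)) j
lemma pM_apply {j : ℕ} {P : (Fin j → glA n N) → Kc} (h : IsInvPoly n N j P) (u) : pM h u = P u := rfl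
lemma curvOf_eq (x y : glA n N) : curvOf n N pr x y = (cF hN hp).curv x y := by
  rw [Fr.curv_apply, curvOf, glBr_eq, glBr_eq]; rfl
lemma chF_apply {j : ℕ} {P : (Fin j → glA n N) → Kc} (h : IsInvPoly n N j P) (w) :
    chF hN hp h w = algebraMap ℂ Kc ((j.factorial : ℂ))⁻¹ * (cF hN hp).pco.phi (Ph (cF hN hp).hb (pM h)) j w := rfl
lemma chern_eq {j : ℕ} {P : (Fin j → glA n N) → Kc} (h : IsInvPoly n N j P) :
    chern n N j pr P = fun v => chF hN hp h (mw (2*j) v) := by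
  funext v
  rw [chF_apply]
  have h1 := phi_mw (pM_inv hN hp h) v
  have h2 : ∀ σ : Equiv.Perm (Fin (2*j)), (if (∀ t : Fin j, σ ⟨2*t.1, by have := t.2; omega⟩ < σ ⟨2*t.1+1, by have := t.2; omega⟩)
      then (Equiv.Perm.sign σ : ℤ) •
        P (fun t : Fin j => curvOf n N pr
            (v (σ ⟨2*t.1, by have := t.2; omega⟩))
            (v (σ ⟨2*t.1+1, by have := t.2; omega⟩)))
      else 0) = if ∀ t : Fin j, σ (i0 t) < σ (i1 t) then
        (Equiv.Perm.sign σ : ℤ) • pM h (fun t => (cF hN hp).curv (v (σ (i0 t))) (v (σ (i1 t)))) else 0 := by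
    intro σ
    simp only [curvOf_eq hN hp]
    by_cases hc : ∀ t : Fin j, σ (i0 t) < σ (i1 t)
    · exact (if_pos hc).trans (if_pos hc).symm
    · exact (if_neg hc).trans (if_neg hc).symm
  rw [chern, Finset.sum_congr rfl fun σ _ => h2 σ]
  exact congrArg (fun z => algebraMap ℂ Kc ((j.factorial : ℂ))⁻¹ * z) h1.symm
lemma fac_mul (j : ℕ) : (j.factorial : Kc) * algebraMap ℂ Kc ((j.factorial : ℂ))⁻¹ = 1 := by
  rw [← map_natCast (algebraMap ℂ Kc), ← map_mul, mul_inv_cancel₀ (by exact_mod_cast j.factorial_ne_zero), map_one]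
lemma chF_dd {j : ℕ} {P : (Fin j → glA n N) → Kc} (h : IsInvPoly n N j P) (w) : chF hN hp h ((cF hN hp).dd w) = 0 := by
  rw [chF, LinearMap.smul_apply, Co.phi_dd _ _ (fun x hx s => (pM_inv hN hp h).ro x hx s), smul_zero]
lemma chF_rel {j k : ℕ} {P : (Fin j → glA n N) → Kc} (h : IsInvPoly n N j P) : IsRelTriv n N k (fun v => chF hN hp h (mw k v)) := by
  refine fun_rel (fun x hx w => ?_) (fun x hx w => ?_)
  · rw [chF, LinearMap.smul_apply, Co.phi_e _ _ _ hx, smul_zero]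
  · rw [chF, LinearMap.smul_apply]
    erw [Co.phi_L _ _ (fun x hx s => (pM_inv hN hp h).ro x hx s) _ hx]
    rw [smul_zero]
end conc
end CW

namespace CW
section conc
variable {n N : ℕ}
variable {pr : glA n N →ₗ[Kc] glA n N}
lemma cw_cocycle (hN : 1 ≤ N) (hp : IsEquivProj n N pr) {j : ℕ} {P : (Fin j → glA n N) → Kc} (h : IsInvPoly n N j P) :
    IsTrivCochain n N (2*j) (chern n N j pr P) ∧ IsRelTriv n N (2*j) (chern n N j pr P)
          ∧ ∀ v, dTriv n N (2*j) (chern n N j pr P) v = 0 := by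
  rw [chern_eq hN hp h]
  refine ⟨fun_triv _, chF_rel hN hp h, fun v => ?_⟩
  have := dd_dTriv hN hp (chF hN hp h) v
  rw [chF_dd] at this
  exact neg_eq_zero.1 this.symm
lemma chern_zero (P : (Fin 0 → glA n N) → Kc) (v : Fin (2*0) → glA n N) (w) : chern n N 0 pr P v = P w := by
  rw [chern, Finset.sum_eq_single 1]
  · rw [if_pos (fun t => t.elim0)]
    simp only [Nat.factorial_zero, Nat.cast_one, inv_one, map_one, one_mul, Equiv.Perm.sign_one, Units.val_one, one_smul]
    congr 1; exact Subsingleton.elim _ _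
  · intro b _ hb; exact absurd (Equiv.ext fun x => x.elim0) hb
  · intro h; exact absurd (Finset.mem_univ _) h
lemma cw_inj_pos (hN : 1 ≤ N) (hp : IsEquivProj n N pr) {j : ℕ} (hj : j ≤ n) (hj0 : 0 < j) {P : (Fin j → glA n N) → Kc} (h : IsInvPoly n N j P) {m : ℕ} (hm : m + 1 = 2 * j)
    {b : (Fin m → glA n N) → Kc} (hb : IsTrivCochain n N m b) (hr : IsRelTriv n N m b)
    (hc : ∀ v : Fin (m+1) → glA n N, chern n N j pr P (v ∘ Fin.cast hm.symm) = dTriv n N m b v) (w : Fin j → glA n N) (hw : ∀ r, w r ∈ hK n N) : P w = 0 := by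
  obtain ⟨η, Z⟩ := zig hN hp
  have hR := rel_fun hN hp hb hr
  have key : ∀ z ∈ Dg Kc (glA n N) (2*j), (cF hN hp).pco.phi (Ph (cF hN hp).hb (pM h)) j z = (-(j.factorial : Kc) • hat (cA hb)) ((cF hN hp).dd z) := by
    intro z hz
    rw [← LinearMap.comp_apply]
    refine Dg_ind (fun v => ?_) hz
    have h1 := hc (v ∘ Fin.cast hm)
    have h2 : (v ∘ Fin.cast hm) ∘ Fin.cast hm.symm = v := rfl
    rw [h2, chern_eq hN hp h] at h1
    have h3 := dd_dTriv hN hp (hat (cA hb)) (v ∘ Fin.cast hm)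
    have h4 : (mw (m+1) (v ∘ Fin.cast hm) : Lam Kc (glA n N)) = mw (2*j) v := by
      clear h1 h3 h2 hc
      generalize hk : 2 * j = k at *
      subst hm; rfl
    rw [h4, hat_fun] at h3
    beta_reduce at h1
    rw [LinearMap.comp_apply, LinearMap.smul_apply, h3, ← h1, smul_eq_mul, chF_apply, neg_mul_neg, ← mul_assoc, fac_mul, one_mul]
  have hz : ∀ u ∈ hK n N, pM h (fun _ => u) = 0 := by
    intro u hu
    have h5 := (cF hN hp).pco.phi_inj (Ph (cF hN hp).hb (pM h)) (fun x hx s => (pM_inv hN hp h).ro x hx s) hu Z.deg Z.hom (Z.eqv u hu)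
      (j := j) (by omega) (b := -(j.factorial : Kc) • hat (cA hb)) (fun w => by rw [LinearMap.smul_apply, hR.he u hu, smul_zero]) (fun w hw _ => key w hw) hj0
    have h6 : ∀ k, ((cF hN hp).pco.X u ^ k) (cF hN hp).pco.one = (cF hN hp).ell u ^ k := by
      intro k
      induction k with
      | zero => rfl
      | succ k ih => rw [pow_succ', pow_succ', Module.End.mul_apply, ih]; rfl
    rw [h6] at h5
    have h7 := (pM_inv hN hp h).ell (fun _ => u) (fun _ => hu)
    rw [Finset.prod_const, Finset.card_univ, Fintype.card_fin] at h7
    rw [← h7]; exact h5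
  exact polarize (pM h) h.2.2.1 (hK n N) hz w hw
lemma cw_inj (hN : 1 ≤ N) (hp : IsEquivProj n N pr) {j : ℕ} (hj : j ≤ n) {P : (Fin j → glA n N) → Kc} (h : IsInvPoly n N j P) (hc : IsRelTrivCobd n N (2*j) (chern n N j pr P))
    (w : Fin j → glA n N) (hw : ∀ r, w r ∈ hK n N) : P w = 0 := by
  cases j with
  | zero =>
    have hc' : chern n N 0 pr P = 0 := hc
    rw [← chern_zero (pr := pr) P (fun t => t.elim0) w, hc']; rfl
  | succ i =>
    obtain ⟨b, hb, hr, he⟩ : ∃ b, IsTrivCochain n N (2*i+1) b ∧ IsRelTriv n N (2*i+1) b ∧ chern n N (i+1) pr P = dTriv n N (2*i+1) b := hc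
    exact cw_inj_pos hN hp hj (by omega) h (m := 2*i+1) (by ring) hb hr (fun v => congrFun he v) w hw
lemma cw_surj (hN : 1 ≤ N) (hp : IsEquivProj n N pr) {j : ℕ} (hj : j ≤ n) {c : (Fin (2*j) → glA n N) → Kc} (h : IsTrivCochain n N (2*j) c) (hr : IsRelTriv n N (2*j) c)
    (hd : ∀ v, dTriv n N (2*j) c v = 0) : ∃ P, IsInvPoly n N j P ∧ IsRelTrivCobd n N (2*j) (fun v => c v - chern n N j pr P v) := by
  cases j with
  | zero =>
    refine ⟨fun _ => c (fun t => t.elim0), ⟨fun w r => r.elim0, fun w r => r.elim0, fun w r => rfl, fun Z hZ w hw => by simp⟩, ?_⟩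
    change (fun v => c v - chern n N 0 pr _ v) = 0
    funext v
    rw [chern_zero (pr := pr) _ v (fun t => t.elim0)]
    rw [show v = fun t => t.elim0 from funext fun t => t.elim0, sub_self]; rfl
  | succ i =>
    obtain ⟨η, Z⟩ := zig hN hp
    have hd' : ∀ w, hat (cA h) ((cF hN hp).dd w) = 0 := by
      have : (hat (cA h) ∘ₗ (cF hN hp).dd : Lam Kc (glA n N) →ₗ[Kc] Kc) = 0 := by
        refine op_eq_of_Dg fun p w hw => Dg_ind (fun v => ?_) hw
        rw [LinearMap.comp_apply, LinearMap.zero_apply]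
        cases p with
        | zero => rw [show (cF hN hp).dd (mw 0 v) = 0 from bd_zero_deg _ _ (mw_mem v), map_zero]
        | succ q =>
          by_cases hq : q = 2 * (i+1)
          · subst hq
            rw [dd_dTriv, hat_fun, hd, neg_zero]
          · exact hat_ne hq _ (bd_mem _ _ (mw_mem v))
      exact fun w => LinearMap.congr_fun this w
    obtain ⟨P, hP, b, hb, hbc⟩ := Fr.surj Z (j := i+1) (by omega) (rel_fun hN hp h hr) hd' (by omega)
    have hI := inv_pM hN hp hP
    refine ⟨P, hI, ?_⟩
    change ∃ b, IsTrivCochain n N (2*i+1) b ∧ IsRelTriv n N (2*i+1) b ∧ (fun v => c v - chern n N (i+1) pr P v) = dTriv n N (2*i+1) b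
    refine ⟨fun v => (-b) (mw (2*i+1) v), fun_triv _, fun_rel (fun x hx w => ?_) (fun x hx w => ?_), ?_⟩
    · rw [LinearMap.neg_apply, hb.he x hx, neg_zero]
    · rw [LinearMap.neg_apply]; exact neg_eq_zero.2 (hb.hL x hx w)
    · funext v
      have h1 : (-b) ((cF hN hp).dd (mw (2*(i+1)) v)) = - dTriv n N (2*i+1) (fun u => (-b) (mw (2*i+1) u)) v := dd_dTriv hN hp (-b) v
      have h2 := hbc (mw (2*(i+1)) v) (mw_mem v)
      rw [LinearMap.neg_apply, neg_inj] at h1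
      rw [← h1, chern_eq hN hp hI]
      beta_reduce
      rw [chF_apply]
      have h4 : hat (cA h) (mw (2*(i+1)) v) = c v := hat_mw _ _
      rw [h4] at h2
      have h5 := fac_mul (i+1)
      have h6 : (pM hI) = P := rfl
      rw [h6]
      linear_combination (-algebraMap ℂ Kc (((i+1).factorial : ℂ))⁻¹) * h2 + (b ((cF hN hp).dd (mw (2*(i+1)) v)) - c v) * h5
end conc
end CW

/-- let `g = gl_N(A^pol_{2n})`, `h = gl_N ⊕ sp_{2n}`, `N` large. For every
`j = 0,…,n` the Chern–Weil homomorphism `χ : (S^j h)^{*h} → H^{2j}(g,h)` (relative Lie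
algebra cohomology with trivial coefficients `K`) is an isomorphism. -/
theorem chern_weil_iso (n : ℕ) :
    ∃ N₀ : ℕ, ∀ N : ℕ, N₀ ≤ N → ∀ j : ℕ, j ≤ n →
      ∀ pr : glA n N →ₗ[Kc] glA n N, IsEquivProj n N pr →
      -- χ(P) is a relative cocycle:
      (∀ P, IsInvPoly n N j P →
        IsTrivCochain n N (2*j) (chern n N j pr P) ∧ IsRelTriv n N (2*j) (chern n N j pr P)
          ∧ ∀ v, dTriv n N (2*j) (chern n N j pr P) v = 0) ∧
      -- injectivity: χ(P) a coboundary only if P vanishes on h: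
      (∀ P, IsInvPoly n N j P → IsRelTrivCobd n N (2*j) (chern n N j pr P) →
        ∀ w : Fin j → glA n N, (∀ r, w r ∈ hK n N) → P w = 0) ∧
      -- surjectivity: every relative cocycle is cohomologous to some χ(P):
      (∀ c : (Fin (2*j) → glA n N) → Kc, IsTrivCochain n N (2*j) c →
        IsRelTriv n N (2*j) c → (∀ v, dTriv n N (2*j) c v = 0) →
        ∃ P, IsInvPoly n N j P ∧
          IsRelTrivCobd n N (2*j) (fun v => c v - chern n N j pr P v)) := by
  exact ⟨1, fun N hN j hj pr hp => ⟨fun P h => CW.cw_cocycle hN hp h,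
    fun P h hc => CW.cw_inj hN hp hj h hc, fun c h hr hd => CW.cw_surj hN hp hj h hr hd⟩⟩

end
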